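/- Let d ≥ 2 and assume the family {P^u}_{u∈(a,b)} satisfies P1–P3 and S1–S2. Then for each u ∈ (a,b) and for P^u[·|0 ∈ S_∞]-almost every configuration ω, there exists K = K(ω) < ∞ such that for all n ≥ 1 and all x ∈ Z^d, the lazy simple random walk on S started at 0 satisfies P_{ω,0}[X_n = x] ≤ K·n^{−d/2}. -/

import Mathlib

open MeasureTheory Filter
open scoped ENNReal

namespace Perco

/-- A point of the lattice `ℤ^d`. -/
abbrev Pt (d : ℕ) := Fin d → ℤ

/-- A percolation configuration on `ℤ^d`. -/
abbrev Config (d : ℕ) := Pt d → Bool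

variable {d : ℕ}

/-- The `ℓ¹`-distance on `ℤ^d`. -/
def dist1 (x y : Pt d) : ℕ := ∑ i, (x i - y i).natAbs

/-- The `ℓ^∞`-distance on `ℤ^d`. -/
def distInf (x y : Pt d) : ℕ := Finset.univ.sup fun i => (x i - y i).natAbs

/-- The closed `ℓ^∞`-ball of radius `R` around `x`. -/
def ballZ (x : Pt d) (R : ℕ) : Set (Pt d) := {y | distInf x y ≤ R}

/-- Nearest-neighbour adjacency in `ℤ^d`. -/
def adj (x y : Pt d) : Prop := dist1 x y = 1

/-- The occupied set of a configuration. -/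
def SS (ω : Config d) : Set (Pt d) := {x | ω x = true}

/-- One step of a nearest-neighbour path staying inside `T`. -/
def stepRel (T : Set (Pt d)) (x y : Pt d) : Prop := adj x y ∧ x ∈ T ∧ y ∈ T

/-- `x` and `y` are connected by a nearest-neighbour path inside `T`. -/
def connIn (T : Set (Pt d)) (x y : Pt d) : Prop :=
  x ∈ T ∧ y ∈ T ∧ Relation.ReflTransGen (stepRel T) x y

/-- The connected component (cluster) of `x` in `T`. -/
def cluster (T : Set (Pt d)) (x : Pt d) : Set (Pt d) := {y | connIn T x y}

/-- `S_r`: vertices of `S(ω)` in connected components of `ℓ¹`-diameter at least `r`. -/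
def Sr (ω : Config d) (r : ℝ) : Set (Pt d) :=
  {x | x ∈ SS ω ∧ ∃ y ∈ cluster (SS ω) x, ∃ z ∈ cluster (SS ω) x, r ≤ (dist1 y z : ℝ)}

/-- `S_∞`: vertices of `S(ω)` in infinite connected components. -/
def Sinf (ω : Config d) : Set (Pt d) := {x | x ∈ SS ω ∧ (cluster (SS ω) x).Infinite}

/-- The shift of a configuration by `x`. -/
def shift (x : Pt d) (ω : Config d) : Config d := fun y => ω (x + y)

/-- An increasing event. -/
def IncreasingEvent (G : Set (Config d)) : Prop :=
  ∀ ω ω' : Config d, (∀ x, ω x = true → ω' x = true) → ω ∈ G → ω' ∈ G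

/-- A decreasing event. -/
def DecreasingEvent (G : Set (Config d)) : Prop :=
  ∀ ω ω' : Config d, (∀ x, ω' x = true → ω x = true) → ω ∈ G → ω' ∈ G

/-- The event `G` depends only on the coordinates in `B`. -/
def DependsOn (G : Set (Config d)) (B : Set (Pt d)) : Prop :=
  ∀ ω ω' : Config d, (∀ x ∈ B, ω x = ω' x) → (ω ∈ G ↔ ω' ∈ G)

/-- The edge boundary of `A` in `Sset`: (directed representatives of) edges of `ℤ^d`
with one endpoint in `A` and the other in `Sset \ A`. -/
def edgeBd (Sset A : Set (Pt d)) : Set (Pt d × Pt d) :=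
  {p | adj p.1 p.2 ∧ p.1 ∈ A ∧ p.2 ∈ Sset \ A}

/-- The density `η(u) = P[0 ∈ S_∞]` of the infinite cluster. -/
noncomputable def eta (d : ℕ) (P : Measure (Config d)) : ℝ :=
  (P {ω | (0 : Pt d) ∈ Sinf ω}).toReal

/-- The first local-uniqueness event of axiom S1. -/
def locUniq1 (d : ℕ) (R : ℕ) : Set (Config d) :=
  {ω | (Sr ω R ∩ ballZ (0 : Pt d) R).Nonempty}

/-- The second local-uniqueness event of axiom S1. -/
def locUniq2 (d : ℕ) (R : ℕ) : Set (Config d) :=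
  {ω | ∀ x ∈ Sr ω ((R : ℝ)/10) ∩ ballZ (0 : Pt d) R,
       ∀ y ∈ Sr ω ((R : ℝ)/10) ∩ ballZ (0 : Pt d) R,
       connIn (SS ω ∩ ballZ (0 : Pt d) (2*R)) x y}

/-- The axioms **P1**–**P3** and **S1**–**S2** of Drewitz–Ráth–Sapozhnikov for a
one-parameter family of probability measures on `{0,1}^{ℤ^d}`. -/
structure Axioms (d : ℕ) (a b : ℝ) (P : ℝ → Measure (Config d)) where
  /-- decoupling exponent -/
  εP : ℝ
  /-- sprinkling exponent -/
  χP : ℝ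
  RP : ℕ
  LP : ℕ
  fP : ℕ → ℝ
  fS : ℝ → ℕ → ℝ
  ΔS : ℝ → ℝ
  RS : ℝ → ℕ
  prob : ∀ u ∈ Set.Ioo a b, IsProbabilityMeasure (P u)
  /-- P1: every lattice shift is measure preserving and ergodic. -/
  ergodic : ∀ u ∈ Set.Ioo a b, ∀ x : Pt d, x ≠ 0 → Ergodic (shift x) (P u)
  /-- P2: monotonicity. -/
  mono : ∀ u ∈ Set.Ioo a b, ∀ u' ∈ Set.Ioo a b, u ≤ u' →
    ∀ G : Set (Config d), MeasurableSet G → IncreasingEvent G → P u G ≤ P u' G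
  εP_pos : 0 < εP
  χP_pos : 0 < χP
  fP_lb : ∀ L : ℕ, LP ≤ L → Real.exp ((Real.log L) ^ εP) ≤ fP L
  /-- P3, decoupling for decreasing events. -/
  decoupleDec : ∀ (R L : ℕ), RP ≤ R → 1 ≤ L → ∀ x₁ x₂ : Pt d, R * L ≤ distInf x₁ x₂ →
    ∀ u uh : ℝ, uh ∈ Set.Ioo a b → u ∈ Set.Ioo a b → uh < u →
    (1 + (R : ℝ) ^ (-χP)) * uh ≤ u →
    ∀ A₁ A₂ : Set (Config d), MeasurableSet A₁ → MeasurableSet A₂ →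
      DecreasingEvent A₁ → DecreasingEvent A₂ →
      DependsOn A₁ (ballZ x₁ (10*L)) → DependsOn A₂ (ballZ x₂ (10*L)) →
      (P u (A₁ ∩ A₂)).toReal ≤ (P uh A₁).toReal * (P uh A₂).toReal + Real.exp (-(fP L))
  /-- P3, decoupling for increasing events. -/
  decoupleInc : ∀ (R L : ℕ), RP ≤ R → 1 ≤ L → ∀ x₁ x₂ : Pt d, R * L ≤ distInf x₁ x₂ →
    ∀ u uh : ℝ, uh ∈ Set.Ioo a b → u ∈ Set.Ioo a b → uh < u →
    (1 + (R : ℝ) ^ (-χP)) * uh ≤ u →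
    ∀ B₁ B₂ : Set (Config d), MeasurableSet B₁ → MeasurableSet B₂ →
      IncreasingEvent B₁ → IncreasingEvent B₂ →
      DependsOn B₁ (ballZ x₁ (10*L)) → DependsOn B₂ (ballZ x₂ (10*L)) →
      (P uh (B₁ ∩ B₂)).toReal ≤ (P u B₁).toReal * (P u B₂).toReal + Real.exp (-(fP L))
  ΔS_pos : ∀ u ∈ Set.Ioo a b, 0 < ΔS u
  fS_lb : ∀ u ∈ Set.Ioo a b, ∀ R : ℕ, RS u ≤ R → (Real.log R) ^ (1 + ΔS u) ≤ fS u R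
  /-- S1, first part. -/
  S1a : ∀ u ∈ Set.Ioo a b, ∀ R : ℕ, 1 ≤ R →
    1 - Real.exp (-(fS u R)) ≤ (P u (locUniq1 d R)).toReal
  /-- S1, second part. -/
  S1b : ∀ u ∈ Set.Ioo a b, ∀ R : ℕ, 1 ≤ R →
    1 - Real.exp (-(fS u R)) ≤ (P u (locUniq2 d R)).toReal
  /-- S2: positivity of the density of the infinite cluster. -/
  S2pos : ∀ u ∈ Set.Ioo a b, 0 < eta d (P u)
  /-- S2: continuity of the density of the infinite cluster. -/
  S2cont : ContinuousOn (fun u => eta d (P u)) (Set.Ioo a b)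


/-- The degree of `y` in `S(ω)`. -/
noncomputable def degS (ω : Config d) (y : Pt d) : ℕ := {z | adj y z ∧ z ∈ SS ω}.ncard

open scoped Classical in
/-- The transition kernel of the lazy simple random walk on `S(ω)`. -/
noncomputable def stepP (d : ℕ) (ω : Config d) (y z : Pt d) : ℝ :=
  if adj y z ∧ z ∈ SS ω then 1/(2*d)
  else if z = y then 1 - (degS ω y : ℝ)/(2*d) else 0

open scoped Classical in
/-- The `n`-step transition probabilities of the lazy simple random walk on `S(ω)`. -/
noncomputable def walkP (d : ℕ) (ω : Config d) : ℕ → Pt d → Pt d → ℝ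
  | 0, x, y => if y = x then 1 else 0
  | n+1, x, y => ∑' z : Pt d, walkP d ω n x z * stepP d ω z y

section Abstract
variable {V : Type*} [Fintype V]

/-- A symmetric stochastic kernel on a finite type. -/
structure SymSt (p : V → V → ℝ) : Prop where
  symm : ∀ x y, p x y = p y x
  nonneg : ∀ x y, 0 ≤ p x y
  sum_one : ∀ x, ∑ y, p x y = 1

/-- The operator of a kernel. -/
noncomputable def opP (p : V → V → ℝ) (f : V → ℝ) (x : V) : ℝ := ∑ y, p x y * f y

/-- The Dirichlet energy. -/
noncomputable def en (p : V → V → ℝ) (f : V → ℝ) : ℝ :=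
  (1/2) * ∑ x, ∑ y, p x y * (f x - f y)^2

/-- The two-step kernel. -/
noncomputable def qq (p : V → V → ℝ) (x y : V) : ℝ := ∑ u, p x u * p u y

theorem sum_left {p : V → V → ℝ} (hp : SymSt p) (h : V → ℝ) :
    ∑ x, ∑ y, p x y * h x = ∑ x, h x := by
  refine Finset.sum_congr rfl fun x _ => ?_
  rw [← Finset.sum_mul, hp.sum_one, one_mul]

theorem sum_right {p : V → V → ℝ} (hp : SymSt p) (h : V → ℝ) :
    ∑ x, ∑ y, p x y * h y = ∑ x, h x := by
  rw [Finset.sum_comm, ← sum_left hp h]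
  refine Finset.sum_congr rfl fun x _ => Finset.sum_congr rfl fun y _ => ?_
  rw [hp.symm]

theorem sum_bil {p : V → V → ℝ} (f g : V → ℝ) :
    ∑ x, f x * opP p g x = ∑ x, ∑ y, p x y * (f x * g y) := by
  refine Finset.sum_congr rfl fun x _ => ?_
  rw [opP, Finset.mul_sum]
  refine Finset.sum_congr rfl fun y _ => ?_
  ring

theorem opP_selfadj {p : V → V → ℝ} (hp : SymSt p) (f g : V → ℝ) :
    ∑ x, f x * opP p g x = ∑ x, opP p f x * g x := by
  rw [sum_bil]
  have : ∑ x, opP p f x * g x = ∑ x, g x * opP p f x := by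
    refine Finset.sum_congr rfl fun x _ => by ring
  rw [this, sum_bil, Finset.sum_comm]
  refine Finset.sum_congr rfl fun x _ => Finset.sum_congr rfl fun y _ => ?_
  rw [hp.symm]; ring

theorem en_eq {p : V → V → ℝ} (hp : SymSt p) (f : V → ℝ) :
    en p f = ∑ x, f x ^ 2 - ∑ x, f x * opP p f x := by
  have h1 := sum_left hp (fun x => f x ^ 2)
  have h2 := sum_right hp (fun x => f x ^ 2)
  rw [sum_bil, en]
  have : ∑ x, ∑ y, p x y * (f x - f y)^2 = ∑ x, ∑ y, p x y * f x ^2 + ∑ x, ∑ y, p x y * f y ^2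
      - 2 * ∑ x, ∑ y, p x y * (f x * f y) := by
    simp only [Finset.mul_sum, ← Finset.sum_add_distrib, ← Finset.sum_sub_distrib]
    refine Finset.sum_congr rfl fun x _ => Finset.sum_congr rfl fun y _ => ?_
    ring
  rw [this, h1, h2]; ring

theorem en_plus {p : V → V → ℝ} (hp : SymSt p) (f : V → ℝ) :
    0 ≤ ∑ x, f x ^ 2 + ∑ x, f x * opP p f x := by
  have h1 := sum_left hp (fun x => f x ^ 2)
  have h2 := sum_right hp (fun x => f x ^ 2)
  rw [sum_bil]
  have : ∑ x, ∑ y, p x y * (f x + f y)^2 = ∑ x, ∑ y, p x y * f x ^2 + ∑ x, ∑ y, p x y * f y ^2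
      + 2 * ∑ x, ∑ y, p x y * (f x * f y) := by
    simp only [Finset.mul_sum, ← Finset.sum_add_distrib]
    refine Finset.sum_congr rfl fun x _ => Finset.sum_congr rfl fun y _ => ?_
    ring
  have h3 : 0 ≤ ∑ x, ∑ y, p x y * (f x + f y)^2 :=
    Finset.sum_nonneg fun x _ => Finset.sum_nonneg fun y _ =>
      mul_nonneg (hp.nonneg x y) (sq_nonneg _)
  rw [this, h1, h2] at h3
  linarith

theorem opP_sq_le {p : V → V → ℝ} (hp : SymSt p) (f : V → ℝ) (x : V) :
    opP p f x ^ 2 ≤ ∑ y, p x y * f y ^ 2 := by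
  have h := Finset.sum_mul_sq_le_sq_mul_sq Finset.univ (fun y => √(p x y))
    (fun y => √(p x y) * f y)
  have e1 : ∀ y, √(p x y) * (√(p x y) * f y) = p x y * f y := fun y => by
    rw [← mul_assoc, Real.mul_self_sqrt (hp.nonneg x y)]
  have e2 : ∀ y, (√(p x y))^2 = p x y := fun y => Real.sq_sqrt (hp.nonneg x y)
  simp only [e1, mul_pow, e2, hp.sum_one, one_mul] at h
  exact h

theorem opP_contract {p : V → V → ℝ} (hp : SymSt p) (f : V → ℝ) :
    ∑ x, opP p f x ^ 2 ≤ ∑ x, f x ^ 2 := by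
  calc ∑ x, opP p f x ^ 2 ≤ ∑ x, ∑ y, p x y * f y ^ 2 :=
        Finset.sum_le_sum fun x _ => opP_sq_le hp f x
    _ = _ := sum_right hp (fun y => f y ^ 2)

theorem opP_nonneg {p : V → V → ℝ} (hp : SymSt p) {f : V → ℝ} (hf : ∀ x, 0 ≤ f x) (x : V) :
    0 ≤ opP p f x := Finset.sum_nonneg fun y _ => mul_nonneg (hp.nonneg x y) (hf y)

theorem opP_sum {p : V → V → ℝ} (hp : SymSt p) (f : V → ℝ) :
    ∑ x, opP p f x = ∑ x, f x := sum_right hp f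

theorem opP_qq (p : V → V → ℝ) (f : V → ℝ) : opP (qq p) f = opP p (opP p f) := by
  funext x
  simp only [opP, qq, Finset.sum_mul, Finset.mul_sum]
  rw [Finset.sum_comm]
  refine Finset.sum_congr rfl fun x _ => Finset.sum_congr rfl fun y _ => ?_
  ring

theorem symSt_qq {p : V → V → ℝ} (hp : SymSt p) : SymSt (qq p) where
  symm x y := by
    simp only [qq]
    refine Finset.sum_congr rfl fun u _ => ?_
    rw [hp.symm x u, hp.symm u y]; ring
  nonneg x y := Finset.sum_nonneg fun u _ => mul_nonneg (hp.nonneg _ _) (hp.nonneg _ _)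
  sum_one x := by
    simp only [qq]
    rw [Finset.sum_comm]
    simp only [← Finset.mul_sum, hp.sum_one, mul_one]

/-- dissipation of the half-lazy average. -/
theorem en_avg_le {p : V → V → ℝ} (hp : SymSt p) (f : V → ℝ) :
    en p (fun x => (f x + opP p f x)/2) ≤
      (1/2) * (∑ x, f x ^ 2 - ∑ x, opP p f x ^ 2) := by
  set g := opP p f with hg
  set k := opP p g with hk
  have hlin : ∀ a b : V → ℝ, ∀ x, opP p (fun x => a x - b x) x = opP p a x - opP p b x := by
    intro a b x; simp only [opP, mul_sub, Finset.sum_sub_distrib]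
  have hlin2 : ∀ x, opP p (fun x => (f x + g x)/2) x = (g x + k x)/2 := by
    intro x
    rw [hk, hg]
    simp only [opP]
    rw [← Finset.sum_add_distrib, Finset.sum_div]
    refine Finset.sum_congr rfl fun u _ => ?_
    ring
  have h1 := en_plus hp (fun x => f x - g x)
  rw [en_eq hp]
  simp only [hlin2]
  simp only [hlin, ← hg, ← hk] at h1
  have h2 : ∑ x, f x * k x = ∑ x, g x ^ 2 := by
    rw [hk, opP_selfadj hp]
    refine Finset.sum_congr rfl fun u _ => ?_
    rw [← hg]; ring
  have e1 : ∑ x, (f x - g x)^2 + ∑ x, (f x - g x) * (g x - k x) =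
      ∑ x, f x ^2 - ∑ x, f x * g x - ∑ x, f x * k x + ∑ x, g x * k x := by
    simp only [← Finset.sum_add_distrib, ← Finset.sum_sub_distrib]
    refine Finset.sum_congr rfl fun u _ => ?_
    ring
  have e2 : ∑ x, ((f x + g x)/2)^2 - ∑ x, (f x + g x)/2 * ((g x + k x)/2) =
      (1/4) * (∑ x, f x ^2 + ∑ x, f x * g x - ∑ x, f x * k x - ∑ x, g x * k x) := by
    simp only [← Finset.sum_add_distrib, ← Finset.sum_sub_distrib, Finset.mul_sum]
    refine Finset.sum_congr rfl fun u _ => ?_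
    ring
  rw [e1] at h1
  rw [e2]
  linarith

/-- weighted inequality for lazy kernels. -/
theorem weighted_step {q : V → V → ℝ} (hq : SymSt q) {α : ℝ} (hα : 0 < α)
    (hlazy : ∀ x, α ≤ q x x) (φ : V → ℝ) (hφ : ∀ x, 0 < φ x) (ψ : V → ℝ)
    (hψ : ∀ x y, q x y ≠ 0 → (φ x - φ y)^2 ≤ ψ x * ((φ x + φ y)/2))
    (f : V → ℝ) :
    ∑ x, φ x * opP q f x ^ 2 ≤ ∑ x, φ x * f x ^ 2 + (1/(4*α)) * ∑ x, ψ x * f x ^2 := by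
  classical
  have hD : ∀ x, opP q f x = f x + ∑ y, q x y * (f y - f x) := by
    intro x
    simp only [mul_sub, Finset.sum_sub_distrib, ← Finset.sum_mul, hq.sum_one, opP]; ring
  set D : V → ℝ := fun x => ∑ y, q x y * (f y - f x) with hDdef
  have hDsq : ∀ x, D x ^ 2 ≤ (1 - α) * ∑ y, q x y * (f y - f x)^2 := by
    intro x
    have h := Finset.sum_mul_sq_le_sq_mul_sq (Finset.univ.erase x) (fun y => √(q x y))
      (fun y => √(q x y) * (f y - f x))
    have e1 : ∀ y, √(q x y) * (√(q x y) * (f y - f x)) = q x y * (f y - f x) := fun y => by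
      rw [← mul_assoc, Real.mul_self_sqrt (hq.nonneg x y)]
    have e2 : ∀ y, (√(q x y))^2 = q x y := fun y => Real.sq_sqrt (hq.nonneg x y)
    simp only [e1, mul_pow, e2] at h
    have a1 : ∑ y ∈ Finset.univ.erase x, q x y * (f y - f x) = D x := by
      rw [hDdef]; simp only
      rw [← Finset.add_sum_erase _ _ (Finset.mem_univ x)]; simp
    have a2 : ∑ y ∈ Finset.univ.erase x, q x y * (f y - f x)^2 = ∑ y, q x y * (f y - f x)^2 := by
      rw [← Finset.add_sum_erase _ _ (Finset.mem_univ x)]; simp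
    have a3 : ∑ y ∈ Finset.univ.erase x, q x y ≤ 1 - α := by
      have := hq.sum_one x
      rw [← Finset.add_sum_erase _ _ (Finset.mem_univ x)] at this
      linarith [hlazy x]
    rw [a1, a2] at h
    refine h.trans ?_
    refine mul_le_mul_of_nonneg_right a3 ?_
    exact Finset.sum_nonneg fun y _ => mul_nonneg (hq.nonneg x y) (sq_nonneg _)
  have s1 : ∑ x, φ x * opP q f x ^ 2 = ∑ x, φ x * f x ^2 + 2 * ∑ x, φ x * f x * D x
      + ∑ x, φ x * D x ^2 := by
    simp only [Finset.mul_sum, ← Finset.sum_add_distrib]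
    refine Finset.sum_congr rfl fun x _ => ?_
    rw [hD]; ring
  have s2 : 2 * ∑ x, φ x * f x * D x =
      - ∑ x, ∑ y, q x y * ((φ x * f x - φ y * f y) * (f x - f y)) := by
    have t1 : ∑ x, φ x * f x * D x = ∑ x, ∑ y, q x y * (φ x * f x * (f y - f x)) := by
      refine Finset.sum_congr rfl fun x _ => ?_
      rw [hDdef]; simp only
      rw [Finset.mul_sum]
      refine Finset.sum_congr rfl fun y _ => ?_
      ring
    have t2 : ∑ x, ∑ y, q x y * (φ x * f x * (f y - f x)) =
        ∑ x, ∑ y, q x y * (φ y * f y * (f x - f y)) := by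
      rw [Finset.sum_comm]
      refine Finset.sum_congr rfl fun x _ => Finset.sum_congr rfl fun y _ => ?_
      rw [hq.symm]
    have t3 : ∑ x, φ x * f x * D x + ∑ x, φ x * f x * D x =
       - ∑ x, ∑ y, q x y * ((φ x * f x - φ y * f y) * (f x - f y)) := by
      conv_lhs => rw [t1]; arg 2; rw [t2]
      simp only [← Finset.sum_add_distrib, ← Finset.sum_neg_distrib]
      refine Finset.sum_congr rfl fun x _ => Finset.sum_congr rfl fun y _ => ?_
      ring
    linarith
  have s3 : ∑ x, φ x * D x ^2 ≤ (1 - α) * ∑ x, ∑ y, q x y * ((φ x + φ y)/2 * (f x - f y)^2) := by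
    have t1 : ∑ x, φ x * D x ^2 ≤ (1-α) * ∑ x, ∑ y, q x y * (φ x * (f x - f y)^2) := by
      rw [Finset.mul_sum]
      refine Finset.sum_le_sum fun x _ => ?_
      refine (mul_le_mul_of_nonneg_left (hDsq x) (hφ x).le).trans (le_of_eq ?_)
      rw [mul_left_comm, Finset.mul_sum]
      congr 1
      refine Finset.sum_congr rfl fun y _ => ?_
      ring
    have t2 : ∑ x, ∑ y, q x y * (φ x * (f x - f y)^2) = ∑ x, ∑ y, q x y * (φ y * (f x - f y)^2) := by
      rw [Finset.sum_comm]
      refine Finset.sum_congr rfl fun x _ => Finset.sum_congr rfl fun y _ => ?_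
      rw [hq.symm]; ring
    refine t1.trans (le_of_eq ?_)
    congr 1
    have t3 : ∑ x, ∑ y, q x y * (φ x * (f x - f y)^2) + ∑ x, ∑ y, q x y * (φ y * (f x - f y)^2)
      = 2 * ∑ x, ∑ y, q x y * ((φ x + φ y)/2 * (f x - f y)^2) := by
      simp only [Finset.mul_sum, ← Finset.sum_add_distrib]
      refine Finset.sum_congr rfl fun x _ => Finset.sum_congr rfl fun y _ => ?_
      ring
    linarith
  have key : ∀ x y, - (q x y * ((φ x * f x - φ y * f y) * (f x - f y))) +
      (1-α) * (q x y * ((φ x + φ y)/2 * (f x - f y)^2)) ≤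
      (1/(4*α)) * (q x y * (ψ x * f x ^2 + ψ y * f y ^2)/2) := by
    intro x y
    by_cases hxy : q x y = 0
    · simp [hxy]
    have h1 := hψ x y hxy
    have h2 := hψ y x (by rwa [hq.symm])
    have hpos := lt_of_le_of_ne (hq.nonneg x y) (Ne.symm hxy)
    have : - ((φ x * f x - φ y * f y) * (f x - f y)) +
      (1-α) * ((φ x + φ y)/2 * (f x - f y)^2) ≤
      (1/(4*α)) * ((ψ x * f x ^2 + ψ y * f y ^2)/2) := by
      set b := (φ x + φ y)/2 with hb
      have hbpos : 0 < b := by have := hφ x; have := hφ y; rw [hb]; linarith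
      set e := φ x - φ y with he
      set m := (f x + f y)/2 with hm
      set n := f x - f y with hn
      have r1 : (φ x * f x - φ y * f y) = b * n + m * e := by
        rw [hb, hn, hm, he]; ring
      rw [r1]
      have r2 : φ y - φ x = -e := by rw [he]; ring
      have r3 : (φ y + φ x)/2 = b := by rw [hb]; ring
      rw [r2, r3, neg_sq] at h2
      have r4 : m^2 ≤ (f x ^2 + f y^2)/2 := by rw [hm]; nlinarith [sq_nonneg (f x - f y)]
      have r5 : e^2 * ((f x ^2 + f y^2)/2) ≤ b * ((ψ x * f x ^2 + ψ y * f y ^2)/2) := by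
        nlinarith [mul_le_mul_of_nonneg_right h1 (sq_nonneg (f x)),
          mul_le_mul_of_nonneg_right h2 (sq_nonneg (f y))]
      have r6 : e^2*m^2 ≤ b * ((ψ x * f x ^2 + ψ y * f y ^2)/2) :=
        (mul_le_mul_of_nonneg_left r4 (sq_nonneg e)).trans r5
      set Z := (ψ x * f x ^2 + ψ y * f y ^2)/2
      have r9 : 1/(4*α) * Z = Z / (4*α) := by ring
      rw [r9, le_div_iff₀ (by positivity : (0:ℝ) < 4*α)]
      have r7 : 0 ≤ (2*α*b*n + m*e)^2 := sq_nonneg _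
      have r8 : b * ((-((b * n + m * e) * n) + (1 - α) * (b * n ^ 2)) * (4 * α)) ≤ b * Z := by
        nlinarith
      exact le_of_mul_le_mul_left r8 hbpos
    have := mul_le_mul_of_nonneg_left this hpos.le
    calc _ = q x y * (- ((φ x * f x - φ y * f y) * (f x - f y)) +
      (1-α) * ((φ x + φ y)/2 * (f x - f y)^2)) := by ring
      _ ≤ _ := this
      _ = _ := by ring
  have s4 : - ∑ x, ∑ y, q x y * ((φ x * f x - φ y * f y) * (f x - f y)) +
     (1 - α) * ∑ x, ∑ y, q x y * ((φ x + φ y)/2 * (f x - f y)^2) ≤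
     (1/(4*α)) * ∑ x, ψ x * f x ^2 := by
    have u1 := sum_left hq (fun x => ψ x * f x ^2)
    have u2 := sum_right hq (fun x => ψ x * f x ^2)
    have u3 : (1/(4*α)) * ∑ x, ψ x * f x ^2 =
       ∑ x, ∑ y, (1/(4*α)) * (q x y * (ψ x * f x ^2 + ψ y * f y ^2)/2) := by
      have : ∑ x, ψ x * f x ^2 = (1/2) * (∑ x, ∑ y, q x y * (ψ x * f x ^2) +
        ∑ x, ∑ y, q x y * (ψ y * f y ^2)) := by rw [u1, u2]; ring
      rw [this]
      simp only [Finset.mul_sum, ← Finset.sum_add_distrib]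
      refine Finset.sum_congr rfl fun x _ => Finset.sum_congr rfl fun y _ => ?_
      ring
    rw [u3]
    simp only [Finset.mul_sum, ← Finset.sum_add_distrib, ← Finset.sum_neg_distrib]
    exact Finset.sum_le_sum fun x _ => Finset.sum_le_sum fun y _ => key x y
  rw [s1, s2]
  linarith

end Abstract

section Abstract
variable {V : Type*} [Fintype V]

open scoped Classical in
/-- The even-time heat kernel. -/
noncomputable def ff (p : V → V → ℝ) (z : V) : ℕ → V → ℝ
  | 0 => fun y => if y = z then 1 else 0
  | k+1 => opP p (opP p (ff p z k))

theorem ff_nonneg {p : V → V → ℝ} (hp : SymSt p) (z : V) (k : ℕ) (x : V) : 0 ≤ ff p z k x := by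
  induction k generalizing x with
  | zero => simp only [ff]; split_ifs <;> norm_num
  | succ k ih => exact opP_nonneg hp (opP_nonneg hp ih) x

theorem ff_sum {p : V → V → ℝ} (hp : SymSt p) (z : V) (k : ℕ) : ∑ x, ff p z k x = 1 := by
  induction k with
  | zero =>
    classical
    rw [Finset.sum_eq_single z]
    · simp [ff]
    · intro b _ hb; simp [ff, hb]
    · simp
  | succ k ih => rw [ff, opP_sum hp, opP_sum hp, ih]

theorem ff_sq_anti {p : V → V → ℝ} (hp : SymSt p) (z : V) :
    Antitone fun k => ∑ x, ff p z k x ^ 2 := by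
  refine antitone_nat_of_succ_le fun k => ?_
  exact (opP_contract hp _).trans (opP_contract hp _)

theorem ff_sq_le_one {p : V → V → ℝ} (hp : SymSt p) (z : V) (k : ℕ) :
    ∑ x, ff p z k x ^ 2 ≤ 1 := by
  refine (ff_sq_anti hp z (Nat.zero_le k)).trans (le_of_eq ?_)
  show ∑ x, ff p z 0 x ^ 2 = 1
  rw [Finset.sum_eq_single z]
  · simp [ff]
  · intro b _ hb; simp [ff, hb]
  · simp

theorem qq_w {p : V → V → ℝ} {w : V → ℝ}
    (hw1 : ∀ x y, p x y ≠ 0 → |w x - w y| ≤ 1) (x y : V) (h : qq p x y ≠ 0) :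
    |w x - w y| ≤ 2 := by
  obtain ⟨u, -, hu⟩ := Finset.exists_ne_zero_of_sum_ne_zero h
  have h1 := hw1 x u (left_ne_zero_of_mul hu)
  have h2 := hw1 u y (right_ne_zero_of_mul hu)
  have := abs_sub_le (w x) (w u) (w y)
  linarith

theorem pow_weight (d : ℕ) (s t : ℝ) (hs : 2 ≤ s) (ht : 2 ≤ t) (hst : |s - t| ≤ 2) :
    (s^(2*d+2) - t^(2*d+2))^2 ≤ (2*(4*d+4)^2*4^d) * s^(2*d) * ((s^(2*d+2) + t^(2*d+2))/2) := by
  have hM := abs_pow_sub_pow_le s t (2*d+2)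
  set M := max |s| |t| with hMdef
  rw [abs_of_nonneg (by linarith : (0:ℝ) ≤ s), abs_of_nonneg (by linarith : (0:ℝ) ≤ t)] at hMdef
  have hM0 : 0 ≤ M := by rw [hMdef]; exact le_max_of_le_left (by linarith)
  have hMs : M ≤ 2 * s := by
    rw [hMdef]; apply max_le <;> linarith [(abs_le.1 hst).1]
  have h1 : |s^(2*d+2) - t^(2*d+2)| ≤ (4*d+4) * M^(2*d+1) := by
    refine hM.trans ?_
    have : (2*d+2-1) = 2*d+1 := by omega
    rw [this]
    refine mul_le_mul_of_nonneg_right ?_ (by positivity)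
    push_cast
    nlinarith
  have h2 : (s^(2*d+2) - t^(2*d+2))^2 ≤ ((4*d+4) * M^(2*d+1))^2 := by
    rw [← sq_abs]
    exact pow_le_pow_left₀ (abs_nonneg _) h1 2
  have h3 : M^(2*d+2) ≤ s^(2*d+2) + t^(2*d+2) := by
    have p1 : 0 ≤ s^(2*d+2) := by positivity
    have p2 : 0 ≤ t^(2*d+2) := by positivity
    rcases max_choice s t with h | h <;> rw [hMdef, h] <;> linarith
  have h4 : M^(2*d) ≤ 4^d * s^(2*d) := by
    calc M^(2*d) ≤ (2*s)^(2*d) := pow_le_pow_left₀ hM0 hMs _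
      _ = _ := by rw [mul_pow, pow_mul 2]; norm_num
  refine h2.trans ?_
  calc ((4*d+4) * M^(2*d+1))^2 = (4*d+4)^2 * (M^(2*d) * M^(2*d+2)) := by ring
    _ ≤ (4*d+4)^2 * ((4^d * s^(2*d)) * (s^(2*d+2) + t^(2*d+2))) := by gcongr
    _ = _ := by ring

theorem moment_step (d : ℕ) {α : ℝ} (hα : 0 < α) : ∃ C1 : ℝ, 0 < C1 ∧
    ∀ {V : Type} [Fintype V] (p : V → V → ℝ), SymSt p → ∀ (w : V → ℝ),
    (∀ x, 2 ≤ w x) → (∀ x y, p x y ≠ 0 → |w x - w y| ≤ 1) → (∀ x, α ≤ qq p x x) →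
    ∀ f : V → ℝ, ∑ x, w x ^ (2*d+2) * opP p (opP p f) x ^ 2 ≤
      ∑ x, w x ^ (2*d+2) * f x ^ 2 + C1 * ∑ x, w x ^(2*d) * f x ^ 2 := by
  refine ⟨(1/(4*α)) * (2*(4*d+4)^2*4^d), by positivity, ?_⟩
  intro V _ p hp w hw hw1 hl f
  have := weighted_step (symSt_qq hp) hα hl (fun x => w x ^(2*d+2))
    (fun x => by have := hw x; positivity) (fun x => (2*(4*d+4)^2*4^d) * w x ^(2*d))
    (fun x y hxy => pow_weight d _ _ (hw x) (hw y) (qq_w hw1 x y hxy)) f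
  rw [opP_qq] at this
  refine this.trans (le_of_eq ?_)
  congr 1
  rw [Finset.mul_sum, Finset.mul_sum]
  refine Finset.sum_congr rfl fun x _ => ?_
  ring

theorem moment_bound (d : ℕ) {α : ℝ} (hα : 0 < α) : ∃ D : ℝ, 1 ≤ D ∧
    ∀ {V : Type} [Fintype V] (p : V → V → ℝ), SymSt p → ∀ (z : V) (w : V → ℝ) (a : ℝ), 0 ≤ a →
    (∀ x, 2 ≤ w x) → w z = 2 → (∀ x y, p x y ≠ 0 → |w x - w y| ≤ 1) → (∀ x, α ≤ qq p x x) →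
    ∀ (F : ℝ), 1 ≤ F → ∀ t : ℕ,
    (∀ k : ℕ, 1 ≤ k → k < t → ∑ x, ff p z k x ^ 2 ≤ F * ((√k + a)/k)^d) →
    ∀ k : ℕ, 1 ≤ k → k ≤ t →
      ∑ x, w x ^ (2*d+2) * ff p z k x ^ 2 ≤ D * F * k * (√k + a)^d := by
  obtain ⟨C1, hC1, hstep⟩ := moment_step d hα
  set C2 : ℝ := C1 * (2*C1)^d with hC2
  have hC2pos : 0 < C2 := by positivity
  refine ⟨2*C2 + (2^(2*d+2) + C1 * 2^(2*d)) + 1, by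
    have : (0:ℝ) < 2^(2*d+2) + C1 * 2^(2*d) := by positivity
    linarith, ?_⟩
  set D : ℝ := 2*C2 + (2^(2*d+2) + C1 * 2^(2*d)) + 1 with hD
  have hDC : 2*C2 ≤ D := by
    have : (0:ℝ) < 2^(2*d+2) + C1 * 2^(2*d) := by positivity
    linarith
  have hDB : 2^(2*d+2) + C1 * 2^(2*d) ≤ D := by linarith
  have hDpos : 0 < D := by linarith
  intro V _ p hp z w a ha hw hwz hw1 hl F hF t he k hk
  induction k, hk using Nat.le_induction with
  | base =>
    intro _
    have h := hstep p hp w hw hw1 hl (ff p z 0)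
    have e1 : ∀ m : ℕ, ∑ x, w x ^ m * ff p z 0 x ^ 2 = 2^m := by
      intro m
      rw [Finset.sum_eq_single z]
      · simp [ff, hwz]
      · intro b _ hb; simp [ff, hb]
      · simp
    rw [e1, e1] at h
    have h' : ∑ x, w x ^ (2*d+2) * ff p z 1 x ^ 2 ≤ D := h.trans hDB
    refine h'.trans ?_
    have : (1:ℝ) ≤ (√((1:ℕ):ℝ) + a)^d := one_le_pow₀ (by simp; linarith)
    have h3 : D ≤ D * F := by nlinarith
    calc D ≤ D * F := h3
      _ ≤ D * F * (√((1:ℕ):ℝ) + a)^d := le_mul_of_one_le_right (by positivity) this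
      _ = _ := by simp
  | succ k hk ih =>
    intro hkt
    have ihk := ih (by omega)
    have hek := he k hk (by omega)
    have h := hstep p hp w hw hw1 hl (ff p z k)
    have hkpos : (0:ℝ) < k := by exact_mod_cast hk
    have hpt : ∀ x, w x^(2*d) ≤ (1/(2*C1*k)) * w x^(2*d+2) + (2*C1*k)^d := by
      intro x
      have hx := hw x
      rcases le_total (2*C1*k) (w x ^2) with h1 | h1
      · have : w x^(2*d) ≤ (1/(2*C1*k)) * w x^(2*d+2) := by
          rw [one_div, inv_mul_eq_div, le_div_iff₀ (by positivity), pow_add]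
          exact mul_le_mul_of_nonneg_left h1 (by positivity)
        have : 0 ≤ (2*C1*k)^d := by positivity
        linarith
      · have : w x^(2*d) ≤ (2*C1*k)^d := by
          rw [pow_mul]; exact pow_le_pow_left₀ (by positivity) h1 d
        have : 0 ≤ (1/(2*C1*k)) * w x^(2*d+2) := by positivity
        linarith
    have hsum : ∑ x, w x ^(2*d) * ff p z k x ^ 2 ≤
        (1/(2*C1*k)) * ∑ x, w x ^(2*d+2) * ff p z k x ^ 2 + (2*C1*k)^d * ∑ x, ff p z k x ^2 := by
      rw [Finset.mul_sum, Finset.mul_sum, ← Finset.sum_add_distrib]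
      refine Finset.sum_le_sum fun x _ => ?_
      nlinarith [mul_le_mul_of_nonneg_right (hpt x) (sq_nonneg (ff p z k x))]
    set X := (√k + a)^d with hX
    have hXpos : 0 ≤ X := by positivity
    have e2 : (2*C1*k)^d * ∑ x, ff p z k x ^2 ≤ (2*C1)^d * F * X := by
      calc (2*C1*k)^d * ∑ x, ff p z k x ^2 ≤ (2*C1*k)^d * (F * ((√k + a)/k)^d) := by gcongr
        _ = (2*C1)^d * F * X := by rw [hX, div_pow, mul_pow]; field_simp
    have hN : ∑ x, w x ^ (2*d+2) * ff p z (k+1) x ^ 2 ≤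
        (1 + 1/(2*k)) * (D * F * k * X) + C2 * F * X := by
      have e3 : C1 * ∑ x, w x ^(2*d) * ff p z k x ^ 2 ≤
          (1/(2*k)) * ∑ x, w x ^(2*d+2) * ff p z k x ^ 2 + C2 * F * X := by
        calc _ ≤ C1 * ((1/(2*C1*k)) * ∑ x, w x ^(2*d+2) * ff p z k x ^ 2 + (2*C1)^d * F * X) := by
              gcongr; linarith
          _ = _ := by rw [hC2]; field_simp
      have e4 : (1 + 1/(2*(k:ℝ))) * ∑ x, w x ^(2*d+2) * ff p z k x ^ 2 ≤
        (1 + 1/(2*k)) * (D * F * k * X) := by gcongr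
      have : ∑ x, w x ^ (2*d+2) * ff p z (k+1) x ^ 2 ≤ ∑ x, w x ^(2*d+2) * ff p z k x ^ 2 +
         C1 * ∑ x, w x ^(2*d) * ff p z k x ^ 2 := h
      linarith
    refine hN.trans ?_
    have e5 : (1 + 1/(2*(k:ℝ))) * (D * F * k * X) + C2 * F * X ≤ D * F * (k+1) * X := by
      have : (1 + 1/(2*(k:ℝ))) * (D * F * k * X) = D * F * k * X + D * F * X /2 := by
        field_simp
      rw [this]
      have : 2*C2 * (F*X) ≤ D * (F * X) := by gcongr
      nlinarith
    refine e5.trans ?_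
    push_cast
    have : X ≤ (√((k:ℝ)+1) + a)^d := by
      rw [hX]; gcongr; linarith
    gcongr
end Abstract

section Abstract2

theorem en_nonneg {V : Type} [Fintype V] {p : V → V → ℝ} (hp : SymSt p) (f : V → ℝ) :
    0 ≤ en p f := by
  have : 0 ≤ ∑ x, ∑ y, p x y * (f x - f y)^2 :=
    Finset.sum_nonneg fun x _ => Finset.sum_nonneg fun y _ =>
      mul_nonneg (hp.nonneg x y) (sq_nonneg _)
  rw [en]; linarith

theorem en_cutoff {V : Type} [Fintype V] {p : V → V → ℝ} (hp : SymSt p) (η g : V → ℝ) (c : ℝ)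
    (h0 : ∀ x, 0 ≤ η x) (h1 : ∀ x, η x ≤ 1)
    (hc : ∀ x y, p x y ≠ 0 → |η x - η y| ≤ c) :
    en p (fun x => η x * g x) ≤ 2 * en p g + c^2 * ∑ x, g x ^ 2 := by
  have h2 := sum_right hp (fun x => g x ^ 2)
  have key : ∑ x, ∑ y, p x y * (η x * g x - η y * g y)^2 ≤
      ∑ x, ∑ y, (2 * (p x y * (g x - g y)^2) + 2 * c^2 * (p x y * g y ^2)) := by
    refine Finset.sum_le_sum fun x _ => Finset.sum_le_sum fun y _ => ?_
    by_cases hxy : p x y = 0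
    · simp [hxy]
    have hpn := hp.nonneg x y
    have e1 : (η x * g x - η y * g y)^2 ≤
        2 * (η x * (g x - g y))^2 + 2 * (g y * (η x - η y))^2 := by
      nlinarith [sq_nonneg (η x * (g x - g y) - g y * (η x - η y))]
    have e2 : (η x * (g x - g y))^2 ≤ (g x - g y)^2 := by
      rw [mul_pow]
      have : η x ^ 2 ≤ 1 := pow_le_one₀ (h0 x) (h1 x)
      nlinarith [sq_nonneg (g x - g y)]
    have e3 : (g y * (η x - η y))^2 ≤ c^2 * g y^2 := by
      rw [mul_pow, mul_comm]
      have : (η x - η y)^2 ≤ c^2 := by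
        rw [← sq_abs]; exact pow_le_pow_left₀ (abs_nonneg _) (hc x y hxy) 2
      exact mul_le_mul_of_nonneg_right this (sq_nonneg _)
    have := mul_le_mul_of_nonneg_left (e1.trans (add_le_add
      (mul_le_mul_of_nonneg_left e2 zero_le_two) (mul_le_mul_of_nonneg_left e3 zero_le_two))) hpn
    refine this.trans (le_of_eq (by ring))
  have e : ∑ x, ∑ y, (2 * (p x y * (g x - g y)^2) + 2 * c^2 * (p x y * g y ^2)) =
      2 * ∑ x, ∑ y, p x y * (g x - g y)^2 + 2 * c^2 * ∑ x, g x^2 := by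
    rw [← h2]
    simp only [Finset.sum_add_distrib, Finset.mul_sum]
  rw [e] at key
  simp only [en]
  linarith

theorem moment_avg {V : Type} [Fintype V] {p : V → V → ℝ} (hp : SymSt p) (w : V → ℝ) (m : ℕ)
    (hw : ∀ x, 2 ≤ w x) (hw1 : ∀ x y, p x y ≠ 0 → |w x - w y| ≤ 1) (f : V → ℝ) :
    ∑ x, w x ^ m * ((f x + opP p f x)/2)^2 ≤ 2^m * ∑ x, w x ^ m * f x ^ 2 := by
  have h1 : ∑ x, w x ^ m * opP p f x ^ 2 ≤ 2^m * ∑ x, w x ^ m * f x ^ 2 := by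
    calc ∑ x, w x ^ m * opP p f x ^ 2 ≤ ∑ x, ∑ y, p x y * (2^m * (w y ^ m * f y ^ 2)) := by
          refine Finset.sum_le_sum fun x _ => ?_
          have hwx := hw x
          refine (mul_le_mul_of_nonneg_left (opP_sq_le hp f x) (by positivity)).trans ?_
          rw [Finset.mul_sum]
          refine Finset.sum_le_sum fun y _ => ?_
          by_cases hxy : p x y = 0
          · simp [hxy]
          have hwy := hw y
          have h3 : w x ≤ 2 * w y := by
            have := (abs_le.1 (hw1 x y hxy)).2
            linarith
          have h4 : w x ^ m ≤ 2^m * w y ^ m := by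
            rw [← mul_pow]; exact pow_le_pow_left₀ (by linarith) h3 m
          have h5 : 0 ≤ p x y * f y ^2 := mul_nonneg (hp.nonneg x y) (sq_nonneg _)
          calc w x ^ m * (p x y * f y ^2) ≤ (2^m * w y ^ m) * (p x y * f y ^2) :=
                mul_le_mul_of_nonneg_right h4 h5
            _ = _ := by ring
      _ = _ := by rw [sum_right hp (fun y => 2^m * (w y ^ m * f y ^ 2)), Finset.mul_sum]
  have h2 : ∑ x, w x ^ m * ((f x + opP p f x)/2)^2 ≤
      (1/2) * ∑ x, w x ^ m * f x ^ 2 + (1/2) * ∑ x, w x ^ m * opP p f x ^ 2 := by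
    rw [Finset.mul_sum, Finset.mul_sum, ← Finset.sum_add_distrib]
    refine Finset.sum_le_sum fun x _ => ?_
    have hwx := hw x
    have : 0 ≤ w x ^ m := by positivity
    nlinarith [mul_nonneg this (sq_nonneg (f x - opP p f x))]
  have h3 : 0 ≤ ∑ x, w x ^ m * f x ^ 2 := Finset.sum_nonneg fun x _ => by
    have := hw x; positivity
  have h4 : (1:ℝ) ≤ 2^m := one_le_pow₀ (by norm_num)
  nlinarith

set_option maxHeartbeats 2000000 in
theorem closing (d : ℕ) {α Γ : ℝ} (hα : 0 < α) (hΓ : 0 < Γ) :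
    ∃ A F D : ℝ, 1 ≤ A ∧ 1 ≤ F ∧ 1 ≤ D ∧
    ∀ {V : Type} [Fintype V] (p : V → V → ℝ), SymSt p → ∀ (z : V) (w : V → ℝ) (a L : ℝ), 0 ≤ a →
    (∀ x, 2 ≤ w x) → w z = 2 → (∀ x y, p x y ≠ 0 → |w x - w y| ≤ 1) → (∀ x, α ≤ qq p x x) →
    (∀ ρ : ℝ, 1 ≤ ρ → ρ ≤ L → ∀ φ : V → ℝ, (∀ x, 0 ≤ φ x) → ∑ x, φ x ≤ 1 →
      (∀ x, ρ ≤ w x → φ x = 0) → ∀ δ : ℝ, 0 < δ →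
      ∑ x, φ x ^ 2 ≤ δ * Γ * (ρ + a) * en p φ + (1/δ)^d) →
    ∀ t : ℕ, 1 ≤ t → 2 * A * √t ≤ L →
      ∑ x, ff p z t x ^ 2 ≤ F * ((√t + a)/t)^d ∧
      ∑ x, w x ^ (2*d+2) * ff p z t x ^ 2 ≤ D * F * t * (√t + a)^d := by
  obtain ⟨D, hD, hmom⟩ := moment_bound d hα
  set A : ℝ := 8 * 4^(d+1) * D with hA
  have h4 : (1:ℝ) ≤ 4^(d+1) := one_le_pow₀ (by norm_num)
  have hA1 : 1 ≤ A := by rw [hA]; nlinarith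
  have hApow : 8 * 4^(d+1) * D ≤ A^(2*d+2) := by
    rw [← hA]; exact le_self_pow₀ hA1 (by omega)
  set ε : ℝ := 1/(48*A*Γ*3^d) with hε
  have hεpos : 0 < ε := by positivity
  set F : ℝ := max 1 (4 * (1/ε)^d) with hF
  have hF1 : 1 ≤ F := le_max_left _ _
  have hF2 : 4 * (1/ε)^d ≤ F := le_max_right _ _
  refine ⟨A, F, D, hA1, hF1, hD, ?_⟩
  intro V _ p hp z w a L ha hw hwz hw1 hl hLS t ht htL
  have main : ∀ t : ℕ, 1 ≤ t → 2 * A * √t ≤ L → ∑ x, ff p z t x ^ 2 ≤ F * ((√t + a)/t)^d := by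
    intro t
    induction t using Nat.strong_induction_on with
    | _ t ih =>
    intro ht htL
    rcases Nat.lt_or_ge t 2 with h2 | h2
    · obtain rfl : t = 1 := by omega
      have : (1:ℝ) ≤ ((√((1:ℕ):ℝ) + a)/((1:ℕ):ℝ))^d := one_le_pow₀ (by simp; linarith)
      have := ff_sq_le_one hp z 1
      nlinarith
    have htpos : (0:ℝ) < t := by positivity
    have ihb : ∀ k : ℕ, 1 ≤ k → k < t → ∑ x, ff p z k x ^ 2 ≤ F * ((√k + a)/k)^d := by
      intro k hk hkt
      refine ih k hkt hk (le_trans ?_ htL)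
      have : √(k:ℝ) ≤ √(t:ℝ) := Real.sqrt_le_sqrt (by exact_mod_cast hkt.le)
      gcongr
    have hmomt := hmom p hp z w a ha hw hwz hw1 hl F hF1 t ihb
    set Tt := √(t:ℝ) with hTt
    have hTpos : 0 < Tt := Real.sqrt_pos.2 htpos
    have hTsq : Tt^2 = t := Real.sq_sqrt htpos.le
    have hT1 : 1 ≤ Tt := by
      rw [hTt]; exact Real.one_le_sqrt.2 (by exact_mod_cast ht)
    set Y := Tt + a with hY
    have hYpos : 0 < Y := by linarith
    set X := (Y/t)^d with hX
    have hXpos : 0 < X := by positivity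
    set m := t/2 with hm
    have hm1 : 1 ≤ m := by omega
    have hmt : m < t := by omega
    have hm3 : (t:ℝ) ≤ 3 * m := by
      have : t ≤ 3 * m := by omega
      exact_mod_cast this
    set e : ℕ → ℝ := fun k => ∑ x, ff p z k x ^ 2 with he
    have hem : e m ≤ F * (3^d * X) := by
      refine (ihb m hm1 hmt).trans ?_
      have hmpos : (0:ℝ) < m := by exact_mod_cast hm1
      have : (√(m:ℝ) + a)/m ≤ 3 * (Y/t) := by
        rw [← mul_div_assoc, div_le_div_iff₀ hmpos htpos]
        have h1 : √(m:ℝ) + a ≤ Y := by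
          rw [hY, hTt]; gcongr
        calc (√(m:ℝ) + a) * t ≤ Y * (3 * m) := by gcongr
          _ = _ := by ring
      rw [hX, ← mul_pow]
      gcongr
    have hem0 : 0 ≤ e m := Finset.sum_nonneg fun x _ => sq_nonneg _
    -- choice of s
    obtain ⟨s, hs, hsle⟩ : ∃ s ∈ Finset.Ico m t,
        e s - ∑ x, opP p (ff p z s) x ^ 2 ≤ 2 * e m / t := by
      apply Finset.exists_le_of_sum_le (s := Finset.Ico m t) (Finset.nonempty_Ico.2 hmt)
      have h1 : ∑ s ∈ Finset.Ico m t, (e s - ∑ x, opP p (ff p z s) x ^ 2) ≤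
          ∑ s ∈ Finset.Ico m t, (e s - e (s+1)) := by
        refine Finset.sum_le_sum fun s _ => ?_
        have : e (s+1) ≤ ∑ x, opP p (ff p z s) x ^ 2 := opP_contract hp _
        linarith
      have h2 : ∑ s ∈ Finset.Ico m t, (e s - e (s+1)) = e m - e t := by
        have := Finset.sum_Ico_sub e hmt.le
        rw [← neg_inj, ← Finset.sum_neg_distrib]
        simp only [neg_sub]; exact this
      have h3 : 0 ≤ e t := Finset.sum_nonneg fun x _ => sq_nonneg _
      rw [Finset.sum_const, Nat.card_Ico, nsmul_eq_mul]
      have h4 : (t:ℝ) ≤ 2 * ((t - m : ℕ):ℝ) := by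
        have : t ≤ 2 * (t-m) := by omega
        exact_mod_cast this
      have h5 : e m ≤ ((t - m : ℕ):ℝ) * (2 * e m / t) := by
        rw [← mul_div_assoc, le_div_iff₀ htpos]
        nlinarith
      linarith
    rw [Finset.mem_Ico] at hs
    have hs1 : 1 ≤ s := by omega
    set f := ff p z s with hf
    set Pf := opP p f with hPf
    set g : V → ℝ := fun x => (f x + Pf x)/2 with hg
    have hf0 : ∀ x, 0 ≤ f x := ff_nonneg hp z s
    have hPf0 : ∀ x, 0 ≤ Pf x := opP_nonneg hp hf0
    have hg0 : ∀ x, 0 ≤ g x := fun x => by have := hf0 x; have := hPf0 x; simp only [hg]; linarith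
    have hgsum : ∑ x, g x = 1 := by
      simp only [hg]
      rw [← Finset.sum_div, Finset.sum_add_distrib, hPf, opP_sum hp, hf, ff_sum hp]; norm_num
    have heng : en p g ≤ (1/2) * (2 * e m / t) := (en_avg_le hp f).trans (by gcongr)
    have hPe : ∑ x, Pf x ^ 2 ≤ e s := opP_contract hp f
    have hes : e s ≤ e m := ff_sq_anti hp z hs.1
    have hg2le : ∑ x, g x ^2 ≤ e m := by
      have : ∑ x, g x^2 ≤ (1/2) * ∑ x, f x^2 + (1/2) * ∑ x, Pf x^2 := by
        rw [Finset.mul_sum, Finset.mul_sum, ← Finset.sum_add_distrib]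
        refine Finset.sum_le_sum fun x _ => ?_
        simp only [hg]; nlinarith [sq_nonneg (f x - Pf x)]
      have h2 : ∑ x, f x ^ 2 = e s := rfl
      linarith
    have het : e t ≤ 2 * ∑ x, g x^2 := by
      have h1 : (1/4) * ∑ x, f x^2 + (1/4) * ∑ x, Pf x^2 ≤ ∑ x, g x^2 := by
        rw [Finset.mul_sum, Finset.mul_sum, ← Finset.sum_add_distrib]
        refine Finset.sum_le_sum fun x _ => ?_
        simp only [hg]; nlinarith [mul_nonneg (hf0 x) (hPf0 x)]
      have h2 : ∑ x, f x ^ 2 = e s := rfl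
      have h3 : e t ≤ e (s+1) := ff_sq_anti hp z hs.2
      have h4 : e (s+1) ≤ ∑ x, Pf x^2 := opP_contract hp _
      linarith
    -- cutoff
    set ρ := A * Tt with hρ
    have hρpos : 0 < ρ := by positivity
    set η : V → ℝ := fun x => max 0 (min 1 (2 - w x / ρ)) with hη
    have hη0 : ∀ x, 0 ≤ η x := fun x => le_max_left _ _
    have hη1 : ∀ x, η x ≤ 1 := fun x => max_le zero_le_one (min_le_left _ _)
    have hηL : ∀ x y, p x y ≠ 0 → |η x - η y| ≤ 1/ρ := by
      intro x y hxy
      have h1 : |η x - η y| ≤ |(2 - w x/ρ) - (2 - w y/ρ)| := by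
        simp only [hη]
        refine (abs_max_sub_max_le_max _ _ _ _).trans ?_
        simp only [sub_self, abs_zero]
        refine max_le (abs_nonneg _) ?_
        refine (abs_min_sub_min_le_max _ _ _ _).trans ?_
        simp
      refine h1.trans ?_
      have : (2 - w x/ρ) - (2 - w y/ρ) = -(w x - w y)/ρ := by ring
      rw [this, abs_div, abs_neg, abs_of_pos hρpos]
      exact div_le_div_of_nonneg_right (hw1 x y hxy) hρpos.le
    have hen : en p (fun x => η x * g x) ≤ 3 * e m / t := by
      refine (en_cutoff hp η g (1/ρ) hη0 hη1 hηL).trans ?_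
      have : (1/ρ)^2 ≤ 1/t := by
        rw [div_pow, one_pow]
        apply one_div_le_one_div_of_le htpos
        rw [hρ, mul_pow, hTsq]
        exact le_mul_of_one_le_left htpos.le (one_le_pow₀ hA1)
      calc 2 * en p g + (1/ρ)^2 * ∑ x, g x^2 ≤ 2 * ((1/2) * (2 * e m / t)) + 1/t * e m := by
            gcongr
        _ = _ := by ring
    set δ := ε * t / Y with hδ
    have hδpos : 0 < δ := by positivity
    have hls := hLS (2*ρ) (by rw [hρ]; nlinarith) (by rw [hρ]; linarith) (fun x => η x * g x)
      (fun x => mul_nonneg (hη0 x) (hg0 x))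
      (by
        rw [← hgsum]
        exact Finset.sum_le_sum fun x _ => mul_le_of_le_one_left (hg0 x) (hη1 x))
      (by
        intro x hx
        have : η x = 0 := by
          simp only [hη]
          apply max_eq_left
          apply min_le_of_right_le
          have : 2 ≤ w x / ρ := by rw [le_div_iff₀ hρpos]; linarith
          linarith
        simp [this]) δ hδpos
    have hls2 : ∑ x, (η x * g x)^2 ≤ 6 * A * Γ * ε * e m + (1/ε)^d * X := by
      refine hls.trans ?_
      have h1 : 2*ρ + a ≤ 2 * A * Y := by
        rw [hρ, hY]; nlinarith
      have h2 : (1/δ)^d = (1/ε)^d * X := by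
        rw [hX, ← mul_pow, hδ]; congr 1; field_simp
      rw [h2]
      have h3 : δ * Γ * (2*ρ+a) * en p (fun x => η x * g x) ≤
          δ * Γ * (2 * A * Y) * (3 * e m / t) := by
        have := en_nonneg hp (fun x => η x * g x)
        gcongr
      have h4 : δ * Γ * (2 * A * Y) * (3 * e m / t) = 6 * A * Γ * ε * e m := by
        rw [hδ]; field_simp; ring
      linarith
    have hmoms := hmomt s hs1 hs.2.le
    have htail : ∑ x, w x^(2*d+2) * g x^2 ≤ 2^(2*d+2) * (D * F * t * Y^d) := by
      refine (moment_avg hp w (2*d+2) hw hw1 f).trans ?_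
      have hst : (s:ℝ) ≤ t := by exact_mod_cast hs.2.le
      have : √(s:ℝ) + a ≤ Y := by rw [hY, hTt]; gcongr
      have h0 : 0 ≤ √(s:ℝ) + a := by positivity
      refine mul_le_mul_of_nonneg_left (hmoms.trans ?_) (by positivity)
      gcongr
    have hsplit : ∑ x, g x^2 ≤ ∑ x, (η x * g x)^2 + (1/ρ^(2*d+2)) * ∑ x, w x^(2*d+2) * g x^2 := by
      rw [Finset.mul_sum, ← Finset.sum_add_distrib]
      refine Finset.sum_le_sum fun x _ => ?_
      have hwx := hw x
      rcases le_total (w x) ρ with h | h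
      · have : η x = 1 := by
          simp only [hη]
          have : w x / ρ ≤ 1 := (div_le_one hρpos).2 h
          rw [min_eq_left (by linarith), max_eq_right zero_le_one]
        rw [this, one_mul]
        have : 0 ≤ 1/ρ^(2*d+2) * (w x^(2*d+2) * g x^2) := by positivity
        linarith
      · have h1 : 1 ≤ w x ^(2*d+2)/ρ^(2*d+2) := by
          rw [one_le_div (by positivity)]
          exact pow_le_pow_left₀ hρpos.le h _
        have h2 : g x^2 ≤ w x ^(2*d+2)/ρ^(2*d+2) * g x^2 := le_mul_of_one_le_left (sq_nonneg _) h1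
        have h3 : 0 ≤ (η x * g x)^2 := sq_nonneg _
        calc g x^2 ≤ w x ^(2*d+2)/ρ^(2*d+2) * g x^2 := h2
          _ = 1/ρ^(2*d+2) * (w x^(2*d+2) * g x^2) := by ring
          _ ≤ _ := by linarith
    have htail2 : (1/ρ^(2*d+2)) * ∑ x, w x^(2*d+2) * g x^2 ≤ (1/8) * (F * X) := by
      calc (1/ρ^(2*d+2)) * ∑ x, w x^(2*d+2) * g x^2
          ≤ (1/ρ^(2*d+2)) * (2^(2*d+2) * (D * F * t * Y^d)) := by gcongr
        _ = (4^(d+1) * D / A^(2*d+2)) * (F * X) := by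
            have e1 : ρ^(2*d+2) = A^(2*d+2) * (t:ℝ)^(d+1) := by
              rw [hρ, mul_pow, ← hTsq, ← pow_mul]; ring
            have e2 : (2:ℝ)^(2*d+2) = 4^(d+1) := by
              rw [show 2*d+2 = 2*(d+1) by ring, pow_mul]; norm_num
            rw [e1, e2, hX, div_pow, pow_succ (t:ℝ) d]
            field_simp
        _ ≤ (1/8) * (F * X) := by
            refine mul_le_mul_of_nonneg_right ?_ (by positivity)
            rw [div_le_iff₀ (by positivity)]
            linarith
    have hfin : e t ≤ F * X := by
      have h1 : 6 * A * Γ * ε * e m ≤ (1/8) * (F * X) := by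
        calc 6 * A * Γ * ε * e m ≤ 6 * A * Γ * ε * (F * (3^d * X)) := by gcongr
          _ = (1/8) * (F * X) := by rw [hε]; field_simp; norm_num
      have h2 : (1/ε)^d * X ≤ (1/4) * (F * X) := by
        have := mul_le_mul_of_nonneg_right hF2 hXpos.le
        linarith
      linarith
    exact hfin
  refine ⟨main t ht htL, ?_⟩
  refine hmom p hp z w a ha hw hwz hw1 hl F hF1 t ?_ t ht le_rfl
  intro k hk hkt
  refine main k hk (le_trans ?_ htL)
  have : √(k:ℝ) ≤ √(t:ℝ) := Real.sqrt_le_sqrt (by exact_mod_cast hkt.le)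
  gcongr
end Abstract2

section Abstract3

theorem offdiag_real (d : ℕ) (s l U U1 U2 C : ℝ) (hs : 0 < s) (hsl : s < l) (hU : 0 ≤ U)
    (hC : 1 ≤ C) (h1 : U1^2 * s^d ≤ C * s^2 * l^d) (h2 : U2^2 * s^d ≤ C * s^2 * l^d)
    (h3 : l^(d+1) * U ≤ 2^(d+1) * (U1 + U2)) : U * s^d ≤ 4^(d+2) * C := by
  have hl : 0 < l := hs.trans hsl
  have e1 : (l^(d+1) * U)^2 ≤ (2^(d+1) * (U1+U2))^2 := pow_le_pow_left₀ (by positivity) h3 2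
  have e2 : (U1+U2)^2 ≤ 2*(U1^2+U2^2) := by nlinarith [sq_nonneg (U1-U2)]
  have e3 : (U1+U2)^2 * s^d ≤ 4 * (C * s^2 * l^d) := by
    have : 0 < s^d := by positivity
    nlinarith
  have e4 : (l^(d+1) * U)^2 * s^d ≤ 4^(d+1) * (4 * (C * s^2 * l^d)) := by
    calc (l^(d+1) * U)^2 * s^d ≤ (2^(d+1) * (U1+U2))^2 * s^d := by gcongr
      _ = 4^(d+1) * ((U1+U2)^2 * s^d) := by
        rw [mul_pow, ← pow_mul, mul_comm (d+1) 2, pow_mul]; norm_num; ring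
      _ ≤ _ := by gcongr
  have e5 : U^2 * s^d * l^(d+2) * l^d ≤ 4^(d+2) * C * s^2 * l^d := by
    calc U^2 * s^d * l^(d+2) * l^d = (l^(d+1) * U)^2 * s^d := by ring
      _ ≤ _ := e4
      _ = _ := by ring
  have e6 : U^2 * s^d * l^(d+2) ≤ 4^(d+2) * C * s^2 := le_of_mul_le_mul_right e5 (by positivity)
  have e7 : (U * s^d)^2 * s^2 ≤ 4^(d+2) * C * s^2 := by
    calc (U * s^d)^2 * s^2 = U^2 * s^d * s^(d+2) := by ring
      _ ≤ U^2 * s^d * l^(d+2) := by gcongr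
      _ ≤ _ := e6
  have e8 : (U * s^d)^2 ≤ 4^(d+2) * C := le_of_mul_le_mul_right e7 (by positivity)
  have e9 : (1:ℝ) ≤ 4^(d+2) * C := by
    have : (1:ℝ) ≤ 4^(d+2) := one_le_pow₀ (by norm_num)
    nlinarith
  refine le_of_sq_le_sq₀ ?_ (by positivity)
  nlinarith
where
  le_of_sq_le_sq₀ {x y : ℝ} (h : x^2 ≤ y^2) (hy : 0 ≤ y) : x ≤ y := abs_le_of_sq_le_sq' h hy |>.2

theorem offdiag (d : ℕ) {α Γ : ℝ} (hα : 0 < α) (hΓ : 0 < Γ) :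
    ∃ A K : ℝ, 1 ≤ A ∧ 1 ≤ K ∧
    ∀ {V : Type} [Fintype V] (p : V → V → ℝ), SymSt p → ∀ (D : V → V → ℝ) (o x : V) (L : ℝ),
    (∀ y z, 0 ≤ D y z) → (∀ z, D z z = 0) → (∀ y, D o x ≤ D o y + D x y) →
    (∀ z y y', p y y' ≠ 0 → |D z y - D z y'| ≤ 1) → (∀ x, α ≤ qq p x x) →
    (∀ z, z = o ∨ z = x → ∀ ρ : ℝ, 1 ≤ ρ → ρ ≤ L → ∀ φ : V → ℝ, (∀ x, 0 ≤ φ x) → ∑ x, φ x ≤ 1 →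
      (∀ y, ρ ≤ D z y + 2 → φ y = 0) → ∀ δ : ℝ, 0 < δ →
      ∑ x, φ x ^ 2 ≤ δ * Γ * (ρ + D o z) * en p φ + (1/δ)^d) →
    ∀ k : ℕ, 1 ≤ k → 2 * A * √k ≤ L →
      (∑ y, ff p o k y * ff p x k y) * √k^d ≤ K := by
  obtain ⟨A, F, D0, hA, hF, hD0, hcl⟩ := closing d hα hΓ
  have h2d : (1:ℝ) ≤ 2^d := one_le_pow₀ (by norm_num)
  have hC1 : 1 ≤ D0 * F^2 * 2^d := by
    have : 1 ≤ F^2 := one_le_pow₀ hF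
    have : 1 ≤ D0 * F^2 := by nlinarith
    nlinarith
  refine ⟨A, max (F * 2^d) (4^(d+2) * (D0 * F^2 * 2^d)), hA, le_max_of_le_left (by nlinarith), ?_⟩
  intro V _ p hp D o x L hD hDz htri hlip hl hLS k hk hkL
  have hcl' : ∀ z, z = o ∨ z = x → _ := fun z hz =>
    hcl p hp z (fun y => D z y + 2) (D o z) L (hD o z) (fun y => by have := hD z y; linarith)
      (by simp [hDz]) (fun y y' h => by simpa using hlip z y y' h) hl (hLS z hz) k hk hkL
  obtain ⟨heo, hNo⟩ := hcl' o (Or.inl rfl)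
  obtain ⟨hex, hNx⟩ := hcl' x (Or.inr rfl)
  have hkpos : (0:ℝ) < k := by exact_mod_cast hk
  set s := √(k:ℝ) with hs
  have hspos : 0 < s := Real.sqrt_pos.2 hkpos
  have hsk : (k:ℝ) = s^2 := (Real.sq_sqrt hkpos.le).symm
  set l := D o x with hl'
  rw [hDz, add_zero] at heo hNo
  rw [hsk] at heo hNo hex hNx
  have ha0 : ∀ y, 0 ≤ ff p o k y := ff_nonneg hp o k
  have hb0 : ∀ y, 0 ≤ ff p x k y := ff_nonneg hp x k
  set fa := ff p o k with hfa
  set fb := ff p x k with hfb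
  have heo' : (∑ y, fa y^2) * s^d ≤ F := by
    calc (∑ y, fa y^2) * s^d ≤ (F * (s/s^2)^d) * s^d := by gcongr
      _ = F := by
        rw [mul_assoc, ← mul_pow]
        have : s / s^2 * s = 1 := by field_simp
        rw [this]; simp
  rcases le_or_gt l s with hls | hls
  · refine le_max_of_le_left ?_
    have hex' : (∑ y, fb y^2) * s^d ≤ F * 2^d := by
      calc (∑ y, fb y^2) * s^d ≤ (F * ((s+l)/s^2)^d) * s^d := by gcongr
        _ ≤ (F * ((2 * s)/s^2)^d) * s^d := by
          have : 0 ≤ l := hD o x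
          gcongr; linarith
        _ = F * 2^d := by
          rw [mul_assoc, ← mul_pow]
          have : (2 * s) / s^2 * s = 2 := by field_simp
          rw [this]
    have h1 : ∑ y, fa y * fb y ≤ (1/2) * ∑ y, fa y^2 + (1/2) * ∑ y, fb y^2 := by
      rw [Finset.mul_sum, Finset.mul_sum, ← Finset.sum_add_distrib]
      refine Finset.sum_le_sum fun y _ => ?_
      nlinarith [sq_nonneg (fa y - fb y)]
    have h2 := mul_le_mul_of_nonneg_right h1 (pow_pos hspos d).le
    nlinarith
  · refine le_max_of_le_right ?_
    have hlpos : 0 < l := hspos.trans hls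
    set U1 := ∑ y, (D o y + 2)^(d+1) * fa y * fb y with hU1
    set U2 := ∑ y, (D x y + 2)^(d+1) * fb y * fa y with hU2
    refine offdiag_real d s l _ U1 U2 _ hspos hls (Finset.sum_nonneg fun y _ =>
      mul_nonneg (ha0 y) (hb0 y)) hC1 ?_ ?_ ?_
    · have c1 : U1^2 ≤ (∑ y, (D o y + 2)^(2*d+2) * fa y^2) * ∑ y, fb y^2 := by
        have := Finset.sum_mul_sq_le_sq_mul_sq Finset.univ (fun y => (D o y + 2)^(d+1) * fa y) fb
        refine this.trans (le_of_eq ?_)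
        congr 1
        refine Finset.sum_congr rfl fun y _ => ?_
        ring
      have c2 : (∑ y, (D o y + 2)^(2*d+2) * fa y^2) * ∑ y, fb y^2 ≤
          (D0 * F * s^2 * s^d) * (F * ((2*l)/s^2)^d) := by
        refine mul_le_mul hNo (hex.trans ?_) (Finset.sum_nonneg fun y _ => sq_nonneg _)
          (by positivity)
        gcongr; linarith
      calc U1^2 * s^d ≤ (D0 * F * s^2 * s^d) * (F * ((2*l)/s^2)^d) * s^d := by
            gcongr; exact c1.trans c2
        _ = D0 * F^2 * 2^d * s^2 * l^d := by
          rw [div_pow, mul_pow]; field_simp; ring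
    · have c1 : U2^2 ≤ (∑ y, (D x y + 2)^(2*d+2) * fb y^2) * ∑ y, fa y^2 := by
        have := Finset.sum_mul_sq_le_sq_mul_sq Finset.univ (fun y => (D x y + 2)^(d+1) * fb y) fa
        refine this.trans (le_of_eq ?_)
        congr 1
        refine Finset.sum_congr rfl fun y _ => ?_
        ring
      have c2 : ∑ y, (D x y + 2)^(2*d+2) * fb y^2 ≤ D0 * F * s^2 * (2*l)^d := by
        refine hNx.trans ?_
        gcongr; linarith
      calc U2^2 * s^d ≤ ((∑ y, (D x y + 2)^(2*d+2) * fb y^2) * ∑ y, fa y^2) * s^d := by gcongr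
        _ = (∑ y, (D x y + 2)^(2*d+2) * fb y^2) * ((∑ y, fa y^2) * s^d) := by ring
        _ ≤ (D0 * F * s^2 * (2*l)^d) * F := by
          refine mul_le_mul c2 heo' ?_ (by positivity)
          exact mul_nonneg (Finset.sum_nonneg fun y _ => sq_nonneg _) (by positivity)
        _ = D0 * F^2 * 2^d * s^2 * l^d := by
          rw [mul_pow]; ring
    · rw [hU1, hU2, ← Finset.sum_add_distrib, Finset.mul_sum, Finset.mul_sum]
      refine Finset.sum_le_sum fun y _ => ?_
      have hab : 0 ≤ fa y * fb y := mul_nonneg (ha0 y) (hb0 y)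
      have p1 : 0 ≤ D o y + 2 := by have := hD o y; linarith
      have p2 : 0 ≤ D x y + 2 := by have := hD x y; linarith
      have : l^(d+1) ≤ 2^(d+1) * ((D o y + 2)^(d+1) + (D x y + 2)^(d+1)) := by
        have q1 : 0 ≤ (D o y + 2)^(d+1) := by positivity
        have q2 : 0 ≤ (D x y + 2)^(d+1) := by positivity
        rcases le_total (D o y) (D x y) with h | h
        · calc l^(d+1) ≤ (2 * (D x y + 2))^(d+1) := by
                refine pow_le_pow_left₀ hlpos.le ?_ _
                have := htri y; linarith
            _ = 2^(d+1) * (D x y + 2)^(d+1) := mul_pow _ _ _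
            _ ≤ _ := by gcongr; linarith
        · calc l^(d+1) ≤ (2 * (D o y + 2))^(d+1) := by
                refine pow_le_pow_left₀ hlpos.le ?_ _
                have := htri y; linarith
            _ = 2^(d+1) * (D o y + 2)^(d+1) := mul_pow _ _ _
            _ ≤ _ := by gcongr; linarith
      have := mul_le_mul_of_nonneg_right this hab
      nlinarith
end Abstract3

section Sobolev
variable {d : ℕ}

/-- Finite box. -/
noncomputable def boxAt (x : Pt d) (N : ℕ) : Finset (Pt d) :=
  Fintype.piFinset fun i => Finset.Icc (x i - (N:ℤ)) (x i + N)

theorem distInf_le_iff (x y : Pt d) (N : ℕ) : distInf x y ≤ N ↔ ∀ i, |x i - y i| ≤ (N:ℤ) := by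
  unfold distInf
  simp only [Finset.sup_le_iff, Finset.mem_univ, true_imp_iff]
  refine forall_congr' fun i => ?_
  rw [Int.abs_eq_natAbs]; norm_cast

theorem mem_boxAt (x y : Pt d) (N : ℕ) : y ∈ boxAt x N ↔ distInf x y ≤ N := by
  rw [distInf_le_iff]
  simp only [boxAt, Fintype.mem_piFinset, Finset.mem_Icc]
  refine forall_congr' fun i => ?_
  rw [abs_le]
  constructor <;> rintro ⟨h1, h2⟩ <;> constructor <;> linarith

theorem card_boxAt (x : Pt d) (N : ℕ) : (boxAt x N).card = (2*N+1)^d := by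
  simp only [boxAt, Fintype.card_piFinset, Int.card_Icc]
  have : ∀ i : Fin d, (x i + (N:ℤ) + 1 - (x i - N)).toNat = 2*N+1 := fun i => by omega
  simp [this]

theorem distInf_self (x : Pt d) : distInf x x = 0 := by
  have := (distInf_le_iff x x 0).2 (by simp)
  omega

theorem distInf_comm (x y : Pt d) : distInf x y = distInf y x := by
  unfold distInf
  congr 1; funext i
  rw [← Int.natAbs_neg, neg_sub]

theorem abs_le_distInf (x y : Pt d) (i : Fin d) : |x i - y i| ≤ (distInf x y : ℤ) :=
  (distInf_le_iff x y _).1 le_rfl i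

theorem distInf_tri (x y z : Pt d) : distInf x z ≤ distInf x y + distInf y z := by
  rw [distInf_le_iff]
  intro i
  have h1 := abs_le_distInf x y i
  have h2 := abs_le_distInf y z i
  have := abs_sub_le (x i) (y i) (z i)
  push_cast; linarith

theorem adj_comm {x y : Pt d} (h : adj x y) : adj y x := by
  unfold adj dist1 at *
  rw [← h]
  refine Finset.sum_congr rfl fun i _ => ?_
  rw [← Int.natAbs_neg, neg_sub]

theorem adj_distInf {x y : Pt d} (h : adj x y) : distInf x y ≤ 1 := by
  unfold adj dist1 at h
  unfold distInf
  refine Finset.sup_le fun i _ => ?_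
  rw [← h]
  exact Finset.single_le_sum (f := fun i => (x i - y i).natAbs) (fun _ _ => Nat.zero_le _)
    (Finset.mem_univ i)

theorem adj_single (x : Pt d) (i : Fin d) : adj x (x + Pi.single i 1) := by
  unfold adj dist1
  rw [Finset.sum_eq_single i]
  · simp
  · intro j _ hj; simp [hj]
  · simp

theorem pi_count_eq : Measure.pi (fun _ : Fin d => (Measure.count : Measure ℤ)) = Measure.count := by
  refine Measure.ext_of_singleton fun x => ?_
  rw [Measure.pi_singleton]; simp

theorem line_bound (h : ℤ → ℝ) (N : ℕ) (hN : ∀ m, (N:ℤ) < |m| → h m = 0) (m : ℤ) :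
    ENNReal.ofReal |h m| ≤ ∑' t : ℤ, ENNReal.ofReal |h (t+1) - h t| := by
  set n : ℕ := (N:ℤ).natAbs + m.natAbs + 1 with hn
  have h0 : h (m + n) = 0 := by
    apply hN
    rw [lt_abs]; left; omega
  have h1 : |h m| ≤ ∑ j ∈ Finset.range n, |h ((m + j) + 1) - h (m + j)| := by
    have := Finset.sum_range_sub (fun j : ℕ => h (m + j)) n
    simp only [Nat.cast_zero, add_zero, h0, zero_sub] at this
    rw [← abs_neg, ← this]
    refine (Finset.abs_sum_le_sum_abs _ _).trans (le_of_eq ?_)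
    refine Finset.sum_congr rfl fun j _ => ?_
    push_cast; rw [add_assoc]
  calc ENNReal.ofReal |h m| ≤ ENNReal.ofReal (∑ j ∈ Finset.range n, |h ((m + j) + 1) - h (m + j)|) :=
        ENNReal.ofReal_le_ofReal h1
    _ = ∑ j ∈ Finset.range n, ENNReal.ofReal |h ((m + j) + 1) - h (m + j)| :=
        ENNReal.ofReal_sum_of_nonneg fun _ _ => abs_nonneg _
    _ ≤ ∑' j : ℕ, ENNReal.ofReal |h ((m + j) + 1) - h (m + j)| := ENNReal.sum_le_tsum _
    _ ≤ _ := ENNReal.tsum_comp_le_tsum_of_injective (f := fun j : ℕ => m + (j:ℤ))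
        (fun a b hab => by simpa using hab) (fun t => ENNReal.ofReal |h (t+1) - h t|)

set_option maxHeartbeats 1000000 in
theorem gns (hd : 2 ≤ d) {q : ℝ} (hq : Real.HolderConjugate d q) (H : Pt d → ℝ)
    (H0 : ∀ x, 0 ≤ H x) (N : ℕ) (hs : ∀ x, N < distInf 0 x → H x = 0) :
    ∑ x ∈ boxAt 0 N, H x ^ q ≤
      (∑ x ∈ boxAt (0 : Pt d) (N+1), ∑ i, |H (x + Pi.single i 1) - H x|)^q := by
  set f : Pt d → ℝ≥0∞ := fun x => ∑ i, ENNReal.ofReal |H (x + Pi.single i 1) - H x| with hf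
  have hd1 : (0:ℝ) < (d:ℝ) - 1 := by
    have : (2:ℝ) ≤ d := by exact_mod_cast hd
    linarith
  have hgl := lintegral_prod_lintegral_pow_le (ι := Fin d) (fun _ => (Measure.count : Measure ℤ))
    (p := q) (by simpa using hq) (f := f) (by fun_prop)
  rw [pi_count_eq] at hgl
  simp only [lintegral_count, Fintype.card_fin] at hgl
  have hqd : q = d * (1/((d:ℝ)-1)) := by rw [hq.conjugate_eq]; ring
  have hline : ∀ x i, ENNReal.ofReal (H x) ≤ ∑' t : ℤ, f (Function.update x i t) := by
    intro x i
    have := line_bound (fun t => H (Function.update x i t)) N (by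
      intro m hm
      apply hs
      have := abs_le_distInf 0 (Function.update x i m) i
      simp only [Pi.zero_apply, Function.update_self, zero_sub, abs_neg] at this
      omega) (x i)
    simp only [Function.update_eq_self] at this
    rw [abs_of_nonneg (H0 x)] at this
    refine this.trans (ENNReal.tsum_le_tsum fun t => ?_)
    have e : Function.update x i (t+1) = Function.update x i t + Pi.single i 1 := by
      funext j
      by_cases hj : j = i
      · subst hj; simp
      · simp [hj]
    rw [e]
    simp only [hf]
    generalize Function.update x i t = y
    exact Finset.single_le_sum_of_canonicallyOrdered
      (f := fun i => ENNReal.ofReal |H (y + Pi.single i 1) - H y|) (Finset.mem_univ i)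
  have hx : ∀ x, ENNReal.ofReal (H x ^ q) ≤
      ∏ i, (∑' t : ℤ, f (Function.update x i t))^(1/((d:ℝ)-1)) := by
    intro x
    calc ENNReal.ofReal (H x ^ q) = ∏ i : Fin d, ENNReal.ofReal (H x) ^ (1/((d:ℝ)-1)) := by
          rw [Finset.prod_const, Finset.card_univ, Fintype.card_fin, ← ENNReal.rpow_natCast,
            ← ENNReal.rpow_mul, mul_comm, ← hqd, ENNReal.ofReal_rpow_of_nonneg (H0 x) hq.symm.nonneg]
      _ ≤ _ := Finset.prod_le_prod' fun i _ => ENNReal.rpow_le_rpow (hline x i) (by positivity)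
  have hf0 : ∀ x, x ∉ boxAt (0 : Pt d) (N+1) → f x = 0 := by
    intro x hx
    rw [mem_boxAt] at hx
    simp only [hf]
    refine Finset.sum_eq_zero fun i _ => ?_
    rw [hs x (by omega), hs (x + Pi.single i 1)]
    · simp
    · have := distInf_tri 0 (x + Pi.single i 1) x
      have := adj_distInf (adj_comm (adj_single x i))
      omega
  have hfs : ∑' x, f x = ENNReal.ofReal
      (∑ x ∈ boxAt (0 : Pt d) (N+1), ∑ i, |H (x + Pi.single i 1) - H x|) := by
    rw [tsum_eq_sum hf0, ENNReal.ofReal_sum_of_nonneg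
      fun _ _ => Finset.sum_nonneg fun _ _ => abs_nonneg _]
    refine Finset.sum_congr rfl fun x _ => ?_
    rw [ENNReal.ofReal_sum_of_nonneg fun _ _ => abs_nonneg _]
  have hG0 : 0 ≤ ∑ x ∈ boxAt (0 : Pt d) (N+1), ∑ i, |H (x + Pi.single i 1) - H x| :=
    Finset.sum_nonneg fun _ _ => Finset.sum_nonneg fun _ _ => abs_nonneg _
  rw [hfs, ENNReal.ofReal_rpow_of_nonneg hG0 hq.symm.nonneg] at hgl
  rw [← ENNReal.ofReal_le_ofReal_iff (by positivity), ENNReal.ofReal_sum_of_nonneg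
    fun x _ => Real.rpow_nonneg (H0 x) _]
  calc _ ≤ ∑' x, ENNReal.ofReal (H x ^ q) := ENNReal.sum_le_tsum _
    _ ≤ _ := ENNReal.tsum_le_tsum hx
    _ ≤ _ := hgl
end Sobolev

section Sobolev2
variable {d : ℕ}

theorem sum_comp_le {ι : Type*} (B B' : Finset ι) (F : ι → ℝ) (hF : ∀ x, 0 ≤ F x)
    (h0 : ∀ x, x ∉ B → F x = 0) (σ : ι → ι) (hσ : Function.Injective σ) :
    ∑ x ∈ B', F (σ x) ≤ ∑ x ∈ B, F x := by
  classical
  rw [← Finset.sum_image (f := F) (s := B') (g := σ) hσ.injOn]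
  rw [Finset.sum_subset (Finset.subset_union_left (s₁ := B) (s₂ := B'.image σ))
    (fun x _ hx => h0 x hx)]
  exact Finset.sum_le_sum_of_subset_of_nonneg Finset.subset_union_right fun x _ _ => hF x

theorem wsob (hd : 2 ≤ d) {q : ℝ} (hq : Real.HolderConjugate d q) (g : Pt d → ℝ)
    (g0 : ∀ x, 0 ≤ g x) (N : ℕ) (hs : ∀ x, N < distInf 0 x → g x = 0)
    (κ : Pt d → ℝ) (hκ : ∀ x, 0 < κ x) :
    (∑ x ∈ boxAt (0 : Pt d) N, (g x ^2) ^ q)^(1/q) ≤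
      4 * d * (∑ x ∈ boxAt (0 : Pt d) (N+1), κ x ^ (d:ℝ))^(1/(d:ℝ)) *
        ∑ x ∈ boxAt (0 : Pt d) (N+1), ∑ i, (κ x)⁻¹ * (g (x + Pi.single i 1) - g x)^2 := by
  set S := ∑ x ∈ boxAt (0 : Pt d) N, (g x ^2) ^ q with hS
  set K := (∑ x ∈ boxAt (0 : Pt d) (N+1), κ x ^ (d:ℝ))^(1/(d:ℝ)) with hK
  set Y := ∑ x ∈ boxAt (0 : Pt d) (N+1), ∑ i, (κ x)⁻¹ * (g (x + Pi.single i 1) - g x)^2 with hY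
  have hqpos : 0 < q := hq.symm.pos
  have hS0 : 0 ≤ S := Finset.sum_nonneg fun x _ => by positivity
  have hK0 : 0 ≤ K := by
    apply Real.rpow_nonneg
    exact Finset.sum_nonneg fun x _ => Real.rpow_nonneg (hκ x).le _
  have hY0 : 0 ≤ Y := Finset.sum_nonneg fun x _ => Finset.sum_nonneg fun i _ =>
    mul_nonneg (inv_nonneg.2 (hκ x).le) (sq_nonneg _)
  set G := ∑ x ∈ boxAt (0 : Pt d) (N+1), ∑ i, |g (x + Pi.single i 1)^2 - g x^2| with hG
  have hG0 : 0 ≤ G := Finset.sum_nonneg fun _ _ => Finset.sum_nonneg fun _ _ => abs_nonneg _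
  have h1 : S ≤ G^q := gns hd hq (fun x => g x^2) (fun x => sq_nonneg _) N
    (fun x hx => by simp [hs x hx])
  have h2 : S^(1/q) ≤ G := by
    calc S^(1/q) ≤ (G^q)^(1/q) := Real.rpow_le_rpow hS0 h1 (by positivity)
      _ = G := by rw [← Real.rpow_mul hG0, mul_one_div_cancel hqpos.ne', Real.rpow_one]
  -- Hoelder
  have hH : ∀ σ : Pt d → Pt d, Function.Injective σ →
      ∑ x ∈ boxAt (0 : Pt d) (N+1), κ x * g (σ x)^2 ≤ K * S^(1/q) := by
    intro σ hσ
    refine (Real.inner_le_Lp_mul_Lq_of_nonneg _ hq (fun x _ => (hκ x).le)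
      (fun x _ => sq_nonneg (g (σ x)))).trans ?_
    refine mul_le_mul_of_nonneg_left ?_ hK0
    refine Real.rpow_le_rpow (Finset.sum_nonneg fun x _ => by positivity) ?_ (by positivity)
    refine sum_comp_le (boxAt 0 N) _ (fun x => (g x^2)^q) (fun x => by positivity) ?_ σ hσ
    intro x hx
    rw [mem_boxAt] at hx
    rw [hs x (by omega)]
    simp [hqpos.ne']
  have hG2 : G^2 ≤ (4 * d * K * S^(1/q)) * Y := by
    have c1 : G ≤ ∑ p ∈ boxAt (0 : Pt d) (N+1) ×ˢ (Finset.univ : Finset (Fin d)),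
        (√(κ p.1) * (g (p.1 + Pi.single p.2 1) + g p.1)) *
          ((√(κ p.1))⁻¹ * |g (p.1 + Pi.single p.2 1) - g p.1|) := by
      rw [hG, Finset.sum_product]
      refine Finset.sum_le_sum fun x _ => Finset.sum_le_sum fun i _ => le_of_eq ?_
      have : 0 < √(κ x) := Real.sqrt_pos.2 (hκ x)
      rw [show g (x + Pi.single i 1)^2 - g x^2 =
        (g (x + Pi.single i 1) + g x) * (g (x + Pi.single i 1) - g x) by ring, abs_mul,
        abs_of_nonneg (add_nonneg (g0 _) (g0 _))]
      field_simp
    have c2 := Finset.sum_mul_sq_le_sq_mul_sq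
      (boxAt (0 : Pt d) (N+1) ×ˢ (Finset.univ : Finset (Fin d)))
      (fun p => √(κ p.1) * (g (p.1 + Pi.single p.2 1) + g p.1))
      (fun p => (√(κ p.1))⁻¹ * |g (p.1 + Pi.single p.2 1) - g p.1|)
    have c3 : ∑ p ∈ boxAt (0 : Pt d) (N+1) ×ˢ (Finset.univ : Finset (Fin d)),
        ((√(κ p.1))⁻¹ * |g (p.1 + Pi.single p.2 1) - g p.1|)^2 = Y := by
      rw [hY, Finset.sum_product]
      refine Finset.sum_congr rfl fun x _ => Finset.sum_congr rfl fun i _ => ?_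
      rw [mul_pow, inv_pow, Real.sq_sqrt (hκ x).le, sq_abs]
    have c4 : ∑ p ∈ boxAt (0 : Pt d) (N+1) ×ˢ (Finset.univ : Finset (Fin d)),
        (√(κ p.1) * (g (p.1 + Pi.single p.2 1) + g p.1))^2 ≤ 4 * d * K * S^(1/q) := by
      rw [Finset.sum_product_right]
      have : ∀ i ∈ (Finset.univ : Finset (Fin d)), ∑ x ∈ boxAt (0 : Pt d) (N+1),
          (√(κ x) * (g (x + Pi.single i 1) + g x))^2 ≤ 4 * (K * S^(1/q)) := by
        intro i _
        have a1 := hH (fun x => x + Pi.single i 1) (add_left_injective _)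
        have a2 := hH id Function.injective_id
        have a3 : ∑ x ∈ boxAt (0 : Pt d) (N+1), (√(κ x) * (g (x + Pi.single i 1) + g x))^2 ≤
           2 * ∑ x ∈ boxAt (0 : Pt d) (N+1), κ x * g (x + Pi.single i 1)^2 +
           2 * ∑ x ∈ boxAt (0 : Pt d) (N+1), κ x * g (id x)^2 := by
          rw [Finset.mul_sum, Finset.mul_sum, ← Finset.sum_add_distrib]
          refine Finset.sum_le_sum fun x _ => ?_
          rw [mul_pow, Real.sq_sqrt (hκ x).le, id]
          nlinarith [mul_nonneg (hκ x).le (sq_nonneg (g (x + Pi.single i 1) - g x))]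
        linarith
      refine (Finset.sum_le_sum this).trans (le_of_eq ?_)
      simp; ring
    calc G^2 ≤ _ := pow_le_pow_left₀ hG0 c1 2
      _ ≤ _ := c2
      _ ≤ _ := by rw [c3]; exact mul_le_mul_of_nonneg_right c4 hY0
  rcases eq_or_lt_of_le (Real.rpow_nonneg hS0 (1/q)) with h | h
  · rw [← h]; positivity
  · refine le_of_mul_le_mul_right ?_ h
    calc S^(1/q) * S^(1/q) ≤ G * G := mul_le_mul h2 h2 h.le hG0
      _ = G^2 := by ring
      _ ≤ _ := hG2
      _ = _ := by ring

theorem interp {ι : Type*} (hd : 2 ≤ d) {q : ℝ} (hq : Real.HolderConjugate d q) (s : Finset ι)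
    (φ : ι → ℝ) (h0 : ∀ x, 0 ≤ φ x) (h1 : ∑ x ∈ s, φ x ≤ 1) (δ : ℝ) (hδ : 0 < δ) :
    ∑ x ∈ s, φ x^2 ≤ δ * (∑ x ∈ s, (φ x^2)^q)^(1/q) + (1/δ)^d := by
  classical
  set τ := (1/δ)^d with hτ
  have hτpos : 0 < τ := by positivity
  have hqpos : 0 < q := hq.symm.pos
  rw [← Finset.sum_filter_add_sum_filter_not s (fun x => τ < φ x)]
  refine add_le_add ?_ ?_
  · set s' := s.filter (fun x => τ < φ x) with hs'
    have e1 : ∑ x ∈ s', φ x^2 ≤ (∑ x ∈ s', (1:ℝ)^(d:ℝ))^(1/(d:ℝ)) *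
        (∑ x ∈ s', (φ x^2)^q)^(1/q) := by
      have := Real.inner_le_Lp_mul_Lq_of_nonneg s' hq (f := fun _ => (1:ℝ)) (g := fun x => φ x^2)
        (fun _ _ => zero_le_one) (fun x _ => sq_nonneg _)
      simpa using this
    refine e1.trans ?_
    refine mul_le_mul ?_ ?_ (Real.rpow_nonneg (Finset.sum_nonneg fun x _ => by positivity) _) hδ.le
    · have c : (s'.card:ℝ) * τ ≤ 1 := by
        calc (s'.card:ℝ) * τ = ∑ x ∈ s', τ := by simp
          _ ≤ ∑ x ∈ s', φ x := Finset.sum_le_sum fun x hx => (Finset.mem_filter.1 hx).2.le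
          _ ≤ ∑ x ∈ s, φ x := Finset.sum_le_sum_of_subset_of_nonneg (Finset.filter_subset _ _)
              fun x _ _ => h0 x
          _ ≤ 1 := h1
      have c2 : (s'.card:ℝ) ≤ δ^(d:ℝ) := by
        rw [Real.rpow_natCast]
        have : (s'.card:ℝ) ≤ 1/τ := by rwa [le_div_iff₀ hτpos]
        refine this.trans (le_of_eq ?_)
        rw [hτ]; simp
      have hd0 : (0:ℝ) < d := by positivity
      simp only [Real.one_rpow, Finset.sum_const, nsmul_eq_mul, mul_one]
      calc (s'.card:ℝ)^(1/(d:ℝ)) ≤ (δ^(d:ℝ))^(1/(d:ℝ)) :=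
            Real.rpow_le_rpow (by positivity) c2 (by positivity)
        _ = δ := by rw [← Real.rpow_mul hδ.le, mul_one_div_cancel hd0.ne', Real.rpow_one]
    · refine Real.rpow_le_rpow (Finset.sum_nonneg fun x _ => by positivity) ?_ (by positivity)
      exact Finset.sum_le_sum_of_subset_of_nonneg (Finset.filter_subset _ _)
        fun x _ _ => by positivity
  · calc ∑ x ∈ s.filter (fun x => ¬ τ < φ x), φ x^2 ≤ ∑ x ∈ s.filter (fun x => ¬ τ < φ x), τ * φ x := by
          refine Finset.sum_le_sum fun x hx => ?_
          have := not_lt.1 (Finset.mem_filter.1 hx).2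
          nlinarith [h0 x]
      _ ≤ ∑ x ∈ s, τ * φ x := Finset.sum_le_sum_of_subset_of_nonneg (Finset.filter_subset _ _)
              fun x _ _ => mul_nonneg hτpos.le (h0 x)
      _ = τ * ∑ x ∈ s, φ x := by rw [Finset.mul_sum]
      _ ≤ τ := by nlinarith

theorem ksum (d : ℕ) : ∃ C : ℝ, 0 < C ∧ ∀ (u : Pt d) (B : Finset (Pt d)) (r : Pt d → ℕ),
    (∀ x ∈ B, 1 ≤ r x ∧ distInf x u ≤ r x) → ∑ x ∈ B, 1/((r x:ℝ)^(2*d)) ≤ C := by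
  classical
  set h : ℤ → ℝ := fun n => 1/(max 1 |(n:ℝ)|)^2 with hh
  have hsum : Summable h := by
    have h1 : Summable (fun n : ℤ => 1/(n:ℝ)^2) := Real.summable_one_div_int_pow.2 (by norm_num)
    refine summable_of_hasFiniteSupport (f := fun n => h n - 1/(n:ℝ)^2) ?_ |>.add h1 |>.congr ?_
    · refine Set.Finite.subset (Set.finite_singleton 0) fun n hn => ?_
      by_contra h0
      apply hn
      have h0' : n ≠ 0 := h0
      have : (1:ℝ) ≤ |(n:ℝ)| := by
        have := Int.one_le_abs h0'
        exact_mod_cast this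
      simp only [hh]
      rw [max_eq_right this, sq_abs, sub_self]
    · intro n; ring
  have hpos : ∀ n, 0 < h n := fun n => by simp only [hh]; positivity
  set c := ∑' n, h n with hc
  have hcpos : 0 < c := hsum.tsum_pos (fun n => (hpos n).le) 0 (hpos 0)
  refine ⟨c^d, by positivity, ?_⟩
  intro u B r hr
  have e1 : ∑ x ∈ B, 1/((r x:ℝ)^(2*d)) ≤ ∑ x ∈ B, ∏ i, h (x i - u i) := by
    refine Finset.sum_le_sum fun x hx => ?_
    obtain ⟨hr1, hr2⟩ := hr x hx
    have : ∏ i : Fin d, 1/(r x:ℝ)^2 ≤ ∏ i, h (x i - u i) := by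
      refine Finset.prod_le_prod (fun i _ => by positivity) fun i _ => ?_
      simp only [hh]
      apply one_div_le_one_div_of_le (by positivity)
      refine pow_le_pow_left₀ (by positivity) (max_le (by exact_mod_cast hr1) ?_) 2
      have := (abs_le_distInf x u i).trans (by exact_mod_cast hr2 : (distInf x u:ℤ) ≤ r x)
      exact_mod_cast this
    refine le_trans (le_of_eq ?_) this
    rw [Finset.prod_const, Finset.card_univ, Fintype.card_fin, div_pow, one_pow, pow_mul]
  refine e1.trans ?_
  set t : Fin d → Finset ℤ := fun i => B.image (fun x => x i) with ht
  have hB : B ⊆ Fintype.piFinset t := by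
    intro x hx
    rw [Fintype.mem_piFinset]
    intro i
    exact Finset.mem_image_of_mem (fun x : Pt d => x i) hx
  calc ∑ x ∈ B, ∏ i, h (x i - u i) ≤ ∑ x ∈ Fintype.piFinset t, ∏ i, h (x i - u i) :=
        Finset.sum_le_sum_of_subset_of_nonneg hB fun x _ _ => Finset.prod_nonneg fun i _ => (hpos _).le
    _ = ∏ i, ∑ n ∈ t i, h (n - u i) := (Finset.prod_univ_sum t (fun i n => h (n - u i))).symm
    _ ≤ ∏ i : Fin d, c := by
        refine Finset.prod_le_prod (fun i _ => Finset.sum_nonneg fun _ _ => (hpos _).le) fun i _ => ?_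
        have : ∑ n ∈ t i, h (n - u i) = ∑ n ∈ (t i).image (fun n => n - u i), h n := by
          rw [Finset.sum_image (s := t i) (g := fun n => n - u i)
            (fun a _ b _ hab => by simpa using hab)]
        rw [this]
        exact hsum.sum_le_tsum _ fun n _ => (hpos n).le
    _ = c^d := by simp
end Sobolev2

section Sobolev3
variable {d : ℕ}

/-- The graph of nearest-neighbour edges inside `T`. -/
def gr (T : Set (Pt d)) : SimpleGraph (Pt d) where
  Adj := stepRel T
  symm := ⟨fun _ _ h => ⟨adj_comm h.1, h.2.2, h.2.1⟩⟩
  loopless := ⟨fun x h => by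
    have := h.1
    simp [adj, dist1] at this⟩

theorem walk_tele {T : Set (Pt d)} (φ : Pt d → ℝ) {x y : Pt d} (p : (gr T).Walk x y) :
    |φ x - φ y| ≤ (p.darts.map (fun e => |φ e.fst - φ e.snd|)).sum := by
  induction p with
  | nil => simp
  | cons h p ih =>
    rename_i a b c
    simp only [SimpleGraph.Walk.darts_cons, List.map_cons, List.sum_cons]
    have := abs_sub_le (φ a) (φ b) (φ c)
    linarith

open scoped Classical in
theorem path_bound (U : Finset (Pt d)) (T : Set (Pt d)) (x y : Pt d)
    (h : connIn (T ∩ (U : Set (Pt d))) x y) (φ : Pt d → ℝ) :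
    (φ x - φ y)^2 ≤ U.card * ∑ e ∈ U ×ˢ U,
      if stepRel T e.1 e.2 then (φ e.1 - φ e.2)^2 else 0 := by
  obtain ⟨hx, hy, hxy⟩ := h
  have hr : (gr (T ∩ (U : Set (Pt d)))).Reachable x y := by
    rw [SimpleGraph.reachable_iff_reflTransGen]; exact hxy
  obtain ⟨w⟩ := hr
  obtain ⟨p, hp⟩ : ∃ p : (gr (T ∩ (U : Set (Pt d)))).Walk x y, p.IsPath := ⟨w.bypass, w.bypass_isPath⟩
  have hnd : p.darts.Nodup := SimpleGraph.Walk.darts_nodup_of_support_nodup hp.support_nodup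
  have hadj : ∀ e ∈ p.darts, stepRel (T ∩ (U : Set (Pt d))) e.fst e.snd := fun e _ => e.adj
  set Ds : Finset (gr (T ∩ (U : Set (Pt d)))).Dart := p.darts.toFinset with hDs
  have h1 : |φ x - φ y| ≤ ∑ e ∈ Ds, |φ e.fst - φ e.snd| := by
    rw [hDs, List.sum_toFinset _ hnd]; exact walk_tele φ p
  have hinj : ∀ a ∈ Ds, ∀ b ∈ Ds, a.fst = b.fst → a = b := by
    intro a ha b hb hab
    rw [hDs, List.mem_toFinset] at ha hb
    have hnd2 : (p.darts.map (·.fst)).Nodup := by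
      have := hp.support_nodup
      rw [← SimpleGraph.Walk.map_fst_darts_append] at this
      exact (List.nodup_append.1 this).1
    exact List.inj_on_of_nodup_map hnd2 ha hb hab
  have hcard : Ds.card ≤ U.card := by
    refine Finset.card_le_card_of_injOn (fun e => e.fst) ?_ ?_
    · intro e he
      rw [Finset.mem_coe, hDs, List.mem_toFinset] at he
      exact (hadj e he).2.1.2
    · intro a ha b hb hab
      exact hinj a ha b hb hab
  have h2 : (φ x - φ y)^2 ≤ Ds.card * ∑ e ∈ Ds, (φ e.fst - φ e.snd)^2 := by
    rw [← sq_abs]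
    refine (pow_le_pow_left₀ (abs_nonneg _) h1 2).trans ?_
    refine (sq_sum_le_card_mul_sum_sq).trans (le_of_eq ?_)
    simp only [sq_abs]
  have h3 : ∑ e ∈ Ds, (φ e.fst - φ e.snd)^2 ≤ ∑ e ∈ U ×ˢ U,
      if stepRel T e.1 e.2 then (φ e.1 - φ e.2)^2 else 0 := by
    have : ∑ e ∈ Ds, (φ e.fst - φ e.snd)^2 = ∑ e ∈ Ds.image (fun e => e.toProd),
        if stepRel T e.1 e.2 then (φ e.1 - φ e.2)^2 else 0 := by
      rw [Finset.sum_image]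
      · refine Finset.sum_congr rfl fun e he => ?_
        rw [hDs, List.mem_toFinset] at he
        have := hadj e he
        rw [if_pos ⟨this.1, this.2.1.1, this.2.2.1⟩]
      · intro a ha b hb hab
        exact hinj a ha b hb (congrArg Prod.fst hab)
    rw [this]
    refine Finset.sum_le_sum_of_subset_of_nonneg ?_ fun e _ _ => by split_ifs <;> positivity
    intro e he
    obtain ⟨a, ha, rfl⟩ := Finset.mem_image.1 he
    rw [hDs, List.mem_toFinset] at ha
    have := hadj a ha
    exact Finset.mem_product.2 ⟨this.2.1.2, this.2.2.2⟩
  refine h2.trans ?_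
  have : (Ds.card:ℝ) ≤ U.card := by exact_mod_cast hcard
  exact mul_le_mul this h3 (Finset.sum_nonneg fun e _ => sq_nonneg _) (by positivity)

open scoped Classical in
/-- Dirichlet form on a finite window. -/
noncomputable def EE (T : Set (Pt d)) (W : Finset (Pt d)) (φ : Pt d → ℝ) : ℝ :=
  ∑ e ∈ W ×ˢ W, if stepRel T e.1 e.2 then (φ e.1 - φ e.2)^2 else 0

theorem Ybound (d : ℕ) : ∃ C : ℝ, 0 < C ∧ ∀ (T : Set (Pt d)) (π : Pt d → Pt d) (r : Pt d → ℕ),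
    (∀ x, 1 ≤ r x) →
    (∀ x i, connIn (T ∩ ballZ x (r x)) (π x) (π (x + Pi.single i 1))) →
    ∀ (W : Finset (Pt d)) (φ : Pt d → ℝ),
    (∀ u v, adj u v → φ u ≠ 0 → u ∈ W ∧ v ∈ W) → ∀ B : Finset (Pt d),
    ∑ x ∈ B, ∑ i, ((r x:ℝ)^(3*d))⁻¹ * (φ (π (x + Pi.single i 1)) - φ (π x))^2 ≤ C * EE T W φ := by
  classical
  obtain ⟨C, hC, hk⟩ := ksum d
  refine ⟨d * 3^d * C + 1, by positivity, ?_⟩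
  intro T π r hr hconn W φ hφ B
  set c : Pt d × Pt d → ℝ := fun e => if stepRel T e.1 e.2 then (φ e.1 - φ e.2)^2 else 0 with hc
  have hc0 : ∀ e, 0 ≤ c e := fun e => by simp only [hc]; split_ifs <;> positivity
  have hcW : ∀ e, c e ≠ 0 → e ∈ W ×ˢ W := by
    intro e he
    simp only [hc] at he
    have hst : stepRel T e.1 e.2 := by by_contra h; simp [h] at he
    rw [if_pos hst] at he
    rw [Finset.mem_product]
    by_cases h1 : φ e.1 = 0
    · have h2 : φ e.2 ≠ 0 := by
        intro h2; apply he; rw [h1, h2]; simp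
      exact (hφ _ _ (adj_comm hst.1) h2).symm
    · exact hφ _ _ hst.1 h1
  have hloc : ∀ x i, (φ (π (x + Pi.single i 1)) - φ (π x))^2 ≤
      (3 * r x)^d * ∑ e ∈ W ×ˢ W, if distInf x e.1 ≤ r x then c e else 0 := by
    intro x i
    have hb : ballZ x (r x) = (boxAt x (r x) : Set (Pt d)) := by
      ext y; simp [ballZ, mem_boxAt]
    have h1 := hconn x i
    rw [hb] at h1
    have h2 := path_bound _ T _ _ h1 φ
    rw [card_boxAt] at h2
    have h3 : ∑ e ∈ boxAt x (r x) ×ˢ boxAt x (r x), c e ≤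
        ∑ e ∈ W ×ˢ W, if distInf x e.1 ≤ r x then c e else 0 := by
      calc ∑ e ∈ boxAt x (r x) ×ˢ boxAt x (r x), c e
          ≤ ∑ e ∈ (W ×ˢ W).filter (fun e => distInf x e.1 ≤ r x), c e := by
            rw [← Finset.sum_filter_ne_zero]
            refine Finset.sum_le_sum_of_subset_of_nonneg ?_ fun e _ _ => hc0 e
            intro e he
            rw [Finset.mem_filter] at he ⊢
            exact ⟨hcW e he.2, (mem_boxAt _ _ _).1 (Finset.mem_product.1 he.1).1⟩
        _ = _ := Finset.sum_filter _ _
    have h4 : (((2 * r x + 1)^d : ℕ):ℝ) ≤ (3 * r x)^d := by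
      push_cast
      have : (1:ℝ) ≤ r x := by exact_mod_cast hr x
      gcongr; linarith
    calc (φ (π (x + Pi.single i 1)) - φ (π x))^2 = (φ (π x) - φ (π (x + Pi.single i 1)))^2 := by ring
      _ ≤ _ := h2
      _ ≤ _ := mul_le_mul h4 h3 (Finset.sum_nonneg fun e _ => hc0 e) (by positivity)
  have hE0 : 0 ≤ EE T W φ := Finset.sum_nonneg fun e _ => hc0 e
  have hfin : ∑ x ∈ B, ∑ i, ((r x:ℝ)^(3*d))⁻¹ * (φ (π (x + Pi.single i 1)) - φ (π x))^2 ≤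
      (d * 3^d) * ∑ e ∈ W ×ˢ W, c e * C := by
    calc _ ≤ ∑ x ∈ B, ∑ i : Fin d, 3^d * ∑ e ∈ W ×ˢ W,
            (if distInf x e.1 ≤ r x then c e * (1/(r x:ℝ)^(2*d)) else 0) := by
          refine Finset.sum_le_sum fun x _ => Finset.sum_le_sum fun i _ => ?_
          have hr0 : (0:ℝ) < r x := by exact_mod_cast hr x
          refine (mul_le_mul_of_nonneg_left (hloc x i) (by positivity)).trans (le_of_eq ?_)
          have : ((r x:ℝ)^(3*d))⁻¹ * (3 * r x)^d = 3^d * (1/(r x:ℝ)^(2*d)) := by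
            rw [show 3*d = 2*d + d by ring, pow_add, mul_pow]; field_simp
          rw [← mul_assoc, this, mul_assoc, Finset.mul_sum]
          congr 1
          refine Finset.sum_congr rfl fun e _ => ?_
          split_ifs <;> ring
      _ = (d * 3^d) * ∑ x ∈ B, ∑ e ∈ W ×ˢ W,
            (if distInf x e.1 ≤ r x then c e * (1/(r x:ℝ)^(2*d)) else 0) := by
          rw [Finset.mul_sum]
          refine Finset.sum_congr rfl fun x _ => ?_
          rw [Finset.sum_const, Finset.card_univ, Fintype.card_fin, nsmul_eq_mul, mul_assoc]
      _ ≤ _ := by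
          refine mul_le_mul_of_nonneg_left ?_ (by positivity)
          rw [Finset.sum_comm]
          refine Finset.sum_le_sum fun e _ => ?_
          rw [← Finset.sum_filter, ← Finset.mul_sum]
          refine mul_le_mul_of_nonneg_left ?_ (hc0 e)
          exact hk e.1 _ r fun x hx => ⟨hr x, (Finset.mem_filter.1 hx).2⟩
  refine hfin.trans ?_
  rw [← Finset.sum_mul]
  have : ∑ e ∈ W ×ˢ W, c e = EE T W φ := rfl
  rw [this]
  nlinarith

theorem LSdet (hd : 2 ≤ d) (T : Set (Pt d)) (π : Pt d → Pt d) (r : Pt d → ℕ) (M : ℝ)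
    (hπ : ∀ x ∈ T, π x = x) (hr1 : ∀ x, 1 ≤ r x) (hπd : ∀ x, distInf x (π x) ≤ r x)
    (hconn : ∀ x i, connIn (T ∩ ballZ x (r x)) (π x) (π (x + Pi.single i 1)))
    (hM : ∀ N : ℕ, 1 ≤ N → ∑ x ∈ boxAt (0 : Pt d) N, (r x:ℝ)^(3*d*d) ≤ M * N^d) :
    ∃ Γ : ℝ, 0 < Γ ∧ ∀ ρ : ℕ, 1 ≤ ρ → ∀ φ : Pt d → ℝ, (∀ x, 0 ≤ φ x) →
      (∀ x, φ x ≠ 0 → x ∈ T ∧ distInf 0 x ≤ ρ) → ∑ x ∈ boxAt (0 : Pt d) ρ, φ x ≤ 1 →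
      ∀ δ : ℝ, 0 < δ → ∀ W : Finset (Pt d), (∀ u v, adj u v → φ u ≠ 0 → u ∈ W ∧ v ∈ W) →
      ∑ x ∈ boxAt (0 : Pt d) ρ, φ x^2 ≤ δ * Γ * ρ * EE T W φ + (1/δ)^d := by
  classical
  obtain ⟨C, hC, hY⟩ := Ybound d
  obtain ⟨M', hMM', hM'1⟩ : ∃ M' : ℕ, M ≤ M' ∧ 1 ≤ M' := by
    obtain ⟨m, hm⟩ := exists_nat_ge M
    exact ⟨m+1, hm.trans (by push_cast; linarith), by omega⟩
  have hd0 : (0:ℝ) < d := by positivity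
  set c0 := 2 + 2 * M' with hc0
  set q : ℝ := Real.conjExponent d with hq'
  have hq : Real.HolderConjugate d q := Real.HolderConjugate.conjExponent
    (by exact_mod_cast (by omega : 1 < d))
  have hqpos : 0 < q := hq.symm.pos
  refine ⟨4 * d * (M' * (c0 + 1)) * C, by positivity, ?_⟩
  intro ρ hρ φ h0 hsupp hsum δ hδ W hW
  set g : Pt d → ℝ := fun x => φ (π x) with hg
  set N := c0 * ρ with hN
  have hgs : ∀ x, N < distInf 0 x → g x = 0 := by
    intro v hv
    by_contra hne
    obtain ⟨-, hpv⟩ := hsupp _ hne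
    have h1 : distInf 0 v ≤ ρ + r v := by
      have := distInf_tri 0 (π v) v
      have h2 := hπd v
      rw [distInf_comm] at h2
      omega
    set n := distInf 0 v with hn
    have hn1 : 1 ≤ n := by omega
    have h2 : (r v:ℝ)^(3*d*d) ≤ M * n^d := by
      refine le_trans ?_ (hM n hn1)
      exact Finset.single_le_sum (f := fun x => (r x:ℝ)^(3*d*d)) (fun _ _ => by positivity)
        ((mem_boxAt 0 v n).2 le_rfl)
    have h3 : (r v)^(3*d*d) ≤ (M' * n)^d := by
      have : (r v:ℝ)^(3*d*d) ≤ (M' * n)^d := by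
        refine h2.trans ?_
        rw [mul_pow]
        refine mul_le_mul_of_nonneg_right (hMM'.trans ?_) (by positivity)
        exact le_self_pow₀ (by exact_mod_cast hM'1) (by omega)
      exact_mod_cast this
    have h4 : (r v)^(3*d) ≤ M' * n := by
      rw [pow_mul] at h3
      exact (pow_le_pow_iff_left₀ (by positivity) (by positivity) (by omega : d ≠ 0)).1 h3
    have h5 : (r v)^2 ≤ M' * n := (Nat.pow_le_pow_right (hr1 v) (by omega)).trans h4
    have h6 : n ≤ c0 * ρ := by
      rcases le_or_gt (r v) (2 * M') with h | h
      · rw [hc0]; nlinarith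
      · have : 2 * r v < n := by
          have : M' * (2 * r v) < M' * n := by nlinarith
          exact Nat.lt_of_mul_lt_mul_left this
        rw [hc0]; nlinarith
    omega
  have hmain := wsob hd hq g (fun x => h0 _) N hgs (fun x => (r x:ℝ)^(3*d))
    (fun x => by have : (0:ℝ) < r x := by exact_mod_cast hr1 x
                 positivity)
  have hK : (∑ x ∈ boxAt (0 : Pt d) (N+1), ((r x:ℝ)^(3*d)) ^ (d:ℝ))^(1/(d:ℝ)) ≤
      M' * (c0 + 1) * ρ := by
    have e1 : ∑ x ∈ boxAt (0 : Pt d) (N+1), ((r x:ℝ)^(3*d)) ^ (d:ℝ) ≤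
        (M' * (c0+1) * ρ)^(d:ℝ) := by
      simp only [Real.rpow_natCast, ← pow_mul]
      refine (hM (N+1) (by omega)).trans ?_
      calc M * ((N+1:ℕ):ℝ)^d ≤ M'^d * ((c0+1)*ρ)^d := by
            refine mul_le_mul (hMM'.trans (le_self_pow₀ (by exact_mod_cast hM'1) (by omega)))
              ?_ (by positivity) (by positivity)
            refine pow_le_pow_left₀ (by positivity) ?_ d
            rw [hN]; push_cast
            have : (1:ℝ) ≤ ρ := by exact_mod_cast hρ
            nlinarith
        _ = _ := by rw [← mul_pow]; ring
    calc _ ≤ ((M' * (c0+1) * ρ : ℝ)^(d:ℝ))^(1/(d:ℝ)) :=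
          Real.rpow_le_rpow (Finset.sum_nonneg fun x _ => by positivity) e1 (by positivity)
      _ = _ := by rw [← Real.rpow_mul (by positivity), mul_one_div_cancel hd0.ne', Real.rpow_one]
  have hYb := hY T π r hr1 hconn W φ hW (boxAt (0 : Pt d) (N+1))
  have hE0 : 0 ≤ EE T W φ := Finset.sum_nonneg fun e _ => by split_ifs <;> positivity
  have hS : (∑ x ∈ boxAt (0 : Pt d) ρ, (φ x ^2) ^ q)^(1/q) ≤
      4 * d * (M' * (c0 + 1) * ρ) * (C * EE T W φ) := by
    refine le_trans (Real.rpow_le_rpow (Finset.sum_nonneg fun x _ => by positivity) ?_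
      (by positivity)) (hmain.trans ?_)
    · calc ∑ x ∈ boxAt (0 : Pt d) ρ, (φ x ^2) ^ q ≤ ∑ x ∈ boxAt (0 : Pt d) ρ, (g x ^2) ^ q := by
            refine Finset.sum_le_sum fun x _ => ?_
            by_cases hx : φ x = 0
            · rw [hx]; simp only [ne_eq, OfNat.ofNat_ne_zero, not_false_eq_true, zero_pow]
              rw [Real.zero_rpow hqpos.ne']; positivity
            · simp only [hg]; rw [hπ x (hsupp x hx).1]
        _ ≤ _ := by
            refine Finset.sum_le_sum_of_subset_of_nonneg ?_ fun x _ _ => by positivity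
            intro x hx
            rw [mem_boxAt] at hx ⊢
            rw [hN, hc0]; nlinarith
    · refine mul_le_mul (mul_le_mul_of_nonneg_left hK (by positivity)) hYb ?_ (by positivity)
      exact Finset.sum_nonneg fun x _ => Finset.sum_nonneg fun i _ => by positivity
  refine (interp hd hq _ φ h0 hsum δ hδ).trans ?_
  have := mul_le_mul_of_nonneg_left hS hδ.le
  refine add_le_add (this.trans (le_of_eq ?_)) le_rfl
  ring
end Sobolev3

section Det
variable {d : ℕ}

theorem connIn_map {T T' : Set (Pt d)} (f : Pt d → Pt d) (hf : ∀ x ∈ T, f x ∈ T')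
    (ha : ∀ x y, adj x y → adj (f x) (f y)) {x y : Pt d} (h : connIn T x y) :
    connIn T' (f x) (f y) := by
  refine ⟨hf _ h.1, hf _ h.2.1, ?_⟩
  exact h.2.2.lift f fun a b hab => ⟨ha _ _ hab.1, hf _ hab.2.1, hf _ hab.2.2⟩

theorem connIn_mono {T T' : Set (Pt d)} (h : T ⊆ T') {x y : Pt d} (hxy : connIn T x y) :
    connIn T' x y := connIn_map id h (fun _ _ h => h) hxy

theorem connIn_trans {T : Set (Pt d)} {x y z : Pt d} (h : connIn T x y) (h' : connIn T y z) :
    connIn T x z := ⟨h.1, h'.2.1, h.2.2.trans h'.2.2⟩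

theorem connIn_symm {T : Set (Pt d)} {x y : Pt d} (h : connIn T x y) : connIn T y x := by
  refine ⟨h.2.1, h.1, ?_⟩
  have h3 := h.2.2
  induction h3 with
  | refl => exact Relation.ReflTransGen.refl
  | tail hab hbc ih =>
    exact Relation.ReflTransGen.head ⟨adj_comm hbc.1, hbc.2.2, hbc.2.1⟩
      (ih ⟨h.1, hbc.2.1, hab⟩)

theorem dist1_add (v x y : Pt d) : dist1 (v + x) (v + y) = dist1 x y := by
  simp [dist1]

theorem distInf_add (v x y : Pt d) : distInf (v + x) (v + y) = distInf x y := by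
  simp [distInf]

theorem mem_SS_shift (v x : Pt d) (ω : Config d) : x ∈ SS (shift v ω) ↔ v + x ∈ SS ω := Iff.rfl

theorem shift_connIn (v : Pt d) (ω : Config d) {x y : Pt d} (h : connIn (SS (shift v ω)) x y) :
    connIn (SS ω) (v + x) (v + y) :=
  connIn_map (fun x => v + x) (fun _ hx => hx)
    (fun a b hab => by unfold adj at *; rwa [dist1_add]) h

theorem shift_connIn' (v : Pt d) (ω : Config d) {x y : Pt d} (h : connIn (SS ω) x y) :
    connIn (SS (shift v ω)) (-v + x) (-v + y) :=
  connIn_map (fun x => -v + x) (fun x hx => by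
      rw [mem_SS_shift]; simpa using hx)
    (fun a b hab => by unfold adj at *; rwa [dist1_add]) h

theorem shift_Sr (v : Pt d) (ω : Config d) (r : ℝ) {x : Pt d} (h : x ∈ Sr (shift v ω) r) :
    v + x ∈ Sr ω r := by
  obtain ⟨h1, y, hy, z, hz, hr⟩ := h
  refine ⟨h1, v + y, shift_connIn v ω hy, v + z, shift_connIn v ω hz, ?_⟩
  rwa [dist1_add]

theorem shift_Sr' (v : Pt d) (ω : Config d) (r : ℝ) {x : Pt d} (h : x ∈ Sr ω r) :
    -v + x ∈ Sr (shift v ω) r := by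
  obtain ⟨h1, y, hy, z, hz, hr⟩ := h
  refine ⟨by rw [mem_SS_shift]; simpa using h1, -v + y, shift_connIn' v ω hy, -v + z,
    shift_connIn' v ω hz, ?_⟩
  rwa [dist1_add]

theorem shift_lu1 (v : Pt d) (ω : Config d) (R : ℕ) (h : shift v ω ∈ locUniq1 d R) :
    (Sr ω R ∩ ballZ v R).Nonempty := by
  obtain ⟨x, hx, hb⟩ := h
  refine ⟨v + x, shift_Sr v ω _ hx, ?_⟩
  have := distInf_add v 0 x
  rw [add_zero] at this
  simp only [ballZ, Set.mem_ofPred_eq] at hb ⊢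
  omega

theorem shift_lu2 (v : Pt d) (ω : Config d) (R : ℕ) (h : shift v ω ∈ locUniq2 d R) :
    ∀ x ∈ Sr ω ((R:ℝ)/10) ∩ ballZ v R, ∀ y ∈ Sr ω ((R:ℝ)/10) ∩ ballZ v R,
      connIn (SS ω ∩ ballZ v (2*R)) x y := by
  intro x hx y hy
  have hb : ∀ x, distInf 0 (-v + x) = distInf v x := by
    intro x
    have := distInf_add (-v) v x
    simpa using this
  have := h (-v + x) ⟨shift_Sr' v ω _ hx.1, by
      have := hx.2; simp only [ballZ, Set.mem_ofPred_eq] at this ⊢; rwa [hb]⟩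
    (-v + y) ⟨shift_Sr' v ω _ hy.1, by
      have := hy.2; simp only [ballZ, Set.mem_ofPred_eq] at this ⊢; rwa [hb]⟩
  have := connIn_map (T' := SS ω ∩ ballZ v (2*R)) (fun x => v + x) (fun x hx => ⟨hx.1, by
      have h2 := hx.2; simp only [ballZ, Set.mem_ofPred_eq] at h2 ⊢
      have := hb (v + x)
      simp only [neg_add_cancel_left] at this
      omega⟩)
    (fun a b hab => by unfold adj at *; rwa [dist1_add]) this
  simpa using this

theorem Sr_anti (ω : Config d) {r r' : ℝ} (h : r ≤ r') : Sr ω r' ⊆ Sr ω r := by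
  rintro x ⟨h1, y, hy, z, hz, hr⟩
  exact ⟨h1, y, hy, z, hz, h.trans hr⟩

theorem distInf_le_dist1 (x y : Pt d) : distInf x y ≤ dist1 x y := by
  unfold distInf dist1
  refine Finset.sup_le fun i _ => ?_
  exact Finset.single_le_sum (f := fun i => (x i - y i).natAbs) (fun _ _ => Nat.zero_le _)
    (Finset.mem_univ i)

theorem Sinf_sub_Sr (ω : Config d) (r : ℝ) : Sinf ω ⊆ Sr ω r := by
  rintro x ⟨h1, h2⟩
  by_contra hcon
  apply h2
  obtain ⟨n, hn⟩ := exists_nat_ge r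
  refine Set.Finite.subset (boxAt x n).finite_toSet fun y hy => ?_
  rw [Finset.mem_coe, mem_boxAt]
  by_contra hgt
  apply hcon
  refine ⟨h1, x, ⟨h1, h1, Relation.ReflTransGen.refl⟩, y, hy, hn.trans ?_⟩
  have := distInf_le_dist1 x y
  exact_mod_cast (by omega : n ≤ dist1 x y)

theorem Sinf_of_Sr (ω : Config d) (x : Pt d) (h : ∀ n : ℕ, ∃ r : ℝ, n ≤ r ∧ x ∈ Sr ω r) :
    x ∈ Sinf ω := by
  refine ⟨(h 0).choose_spec.2.1, fun hfin => ?_⟩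
  obtain ⟨n, hn⟩ : ∃ n : ℕ, ∀ e ∈ hfin.toFinset ×ˢ hfin.toFinset, dist1 e.1 e.2 ≤ n :=
    ⟨(hfin.toFinset ×ˢ hfin.toFinset).sup fun e => dist1 e.1 e.2, fun e he =>
      Finset.le_sup (f := fun e : Pt d × Pt d => dist1 e.1 e.2) he⟩
  obtain ⟨r, hr, -, y, hy, z, hz, hyz⟩ := h (n+1)
  have := hn (y, z) (by simp [hy, hz])
  have h2 : ((n+1:ℕ):ℝ) ≤ (dist1 y z:ℝ) := hr.trans hyz
  have h3 : n + 1 ≤ dist1 y z := by exact_mod_cast h2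
  simp only at this
  omega

theorem Sinf_conn (ω : Config d) {x y : Pt d} (hx : x ∈ Sinf ω) (h : connIn (SS ω) x y) :
    y ∈ Sinf ω := by
  refine ⟨h.2.1, hx.2.mono fun z hz => ?_⟩
  exact connIn_trans (connIn_symm h) hz

theorem Sr_conn (ω : Config d) {x y : Pt d} {r : ℝ} (hx : x ∈ Sr ω r) (h : connIn (SS ω) x y) :
    y ∈ Sr ω r := by
  obtain ⟨h1, a, ha, b, hb, hr⟩ := hx
  exact ⟨h.2.1, a, connIn_trans (connIn_symm h) ha, b, connIn_trans (connIn_symm h) hb, hr⟩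

theorem conn_Sinf (ω : Config d) (B : Set (Pt d)) {x y : Pt d} (hx : x ∈ Sinf ω)
    (h : connIn (SS ω ∩ B) x y) : connIn (Sinf ω ∩ B) x y := by
  obtain ⟨hxB, hyB, h⟩ := h
  induction h with
  | refl => exact ⟨⟨hx, hxB.2⟩, ⟨hx, hxB.2⟩, Relation.ReflTransGen.refl⟩
  | tail hab hbc ih =>
    have ih' := ih hbc.2.1
    have hc : _ ∈ Sinf ω := Sinf_conn ω ih'.2.1.1
      ⟨hbc.2.1.1, hbc.2.2.1, Relation.ReflTransGen.single ⟨hbc.1, hbc.2.1.1, hbc.2.2.1⟩⟩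
    exact ⟨⟨hx, hxB.2⟩, ⟨hc, hyB.2⟩, ih'.2.2.tail ⟨hbc.1, ih'.2.1, ⟨hc, hyB.2⟩⟩⟩

/-- Bad scale at `v`. -/
def BadAt (j : ℕ) (v : Pt d) (ω : Config d) : Prop :=
  shift v ω ∉ locUniq1 d (2^j) ∩ locUniq2 d (2^j)

theorem good_conn (ω : Config d) (v : Pt d) (J : ℕ) (h : ∀ j, J ≤ j → ¬ BadAt j v ω) (j : ℕ)
    (hj : J ≤ j) (x y : Pt d) (hx : x ∈ Sinf ω) (hxb : distInf v x ≤ 2^j)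
    (hy : y ∈ Sinf ω) (hyb : distInf v y ≤ 2^j) :
    connIn (Sinf ω ∩ ballZ v (2^(j+1))) x y := by
  have h2 := (not_not.1 (h j hj)).2
  refine conn_Sinf ω _ hx ?_
  have := shift_lu2 v ω _ h2 x ⟨Sinf_sub_Sr ω _ hx, hxb⟩ y ⟨Sinf_sub_Sr ω _ hy, hyb⟩
  rwa [pow_succ, mul_comm]

theorem good_exists (ω : Config d) (v : Pt d) (J : ℕ) (h : ∀ j, J ≤ j → ¬ BadAt j v ω) :
    ∃ y ∈ Sinf ω, distInf v y ≤ 2^J := by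
  have h1 : ∀ j, J ≤ j → (Sr ω ((2^j : ℕ):ℝ) ∩ ballZ v (2^j)).Nonempty := fun j hj =>
    shift_lu1 v ω _ (not_not.1 (h j hj)).1
  obtain ⟨x0, hx0, hx0b⟩ := h1 J le_rfl
  refine ⟨x0, ?_, hx0b⟩
  have key : ∀ j, J ≤ j → ∃ x, x ∈ Sr ω ((2^j : ℕ):ℝ) ∧ distInf v x ≤ 2^j ∧ connIn (SS ω) x0 x := by
    intro j hj
    induction j, hj using Nat.le_induction with
    | base => exact ⟨x0, hx0, hx0b, ⟨hx0.1, hx0.1, Relation.ReflTransGen.refl⟩⟩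
    | succ j hj ih =>
      obtain ⟨x, hx, hxb, hxc⟩ := ih
      obtain ⟨y, hy, hyb⟩ := h1 (j+1) (by omega)
      refine ⟨y, hy, hyb, connIn_trans hxc ?_⟩
      have h2 := shift_lu2 v ω _ (not_not.1 (h (j+1) (by omega))).2
      refine connIn_mono Set.inter_subset_left (h2 x ⟨Sr_anti ω ?_ hx, ?_⟩ y ⟨Sr_anti ω ?_ hy, hyb⟩)
      · push_cast; rw [pow_succ]
        have : (0:ℝ) < 2^j := by positivity
        linarith
      · simp only [ballZ, Set.mem_ofPred_eq]
        rw [pow_succ]; omega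
      · push_cast
        have : (0:ℝ) < 2^(j+1) := by positivity
        linarith
  refine Sinf_of_Sr ω x0 fun n => ?_
  obtain ⟨x, hx, -, hc⟩ := key (max J n) (le_max_left _ _)
  refine ⟨((2^(max J n) : ℕ):ℝ), ?_, Sr_conn ω hx (connIn_symm hc)⟩
  have : n < 2^n := Nat.lt_two_pow_self
  have h2 : 2^n ≤ 2^(max J n) := Nat.pow_le_pow_right (by norm_num) (le_max_right _ _)
  exact_mod_cast (by omega : n ≤ 2^(max J n))

open scoped Classical in
/-- Weight of the bad scales at `v`. -/
noncomputable def Wt (s : ℕ) (v : Pt d) (ω : Config d) : ℝ≥0∞ :=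
  ∑' j : ℕ, if BadAt j v ω then (2:ℝ≥0∞)^(s*j) else 0

theorem Wt_scale (s : ℕ) (v : Pt d) (ω : Config d) (h : Wt s v ω ≠ ⊤) :
    ∃ J : ℕ, (∀ j, J ≤ j → ¬ BadAt j v ω) ∧ (2:ℝ)^(s*(J+3)) ≤ 2^(4*s) * (1 + (Wt s v ω).toReal) := by
  classical
  have hex : ∃ J : ℕ, ∀ j, J ≤ j → ¬ BadAt j v ω := by
    have := ENNReal.tendsto_atTop_zero_of_tsum_ne_top h
    have h2 := this.eventually (gt_mem_nhds (zero_lt_one))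
    obtain ⟨J, hJ⟩ := eventually_atTop.1 h2
    refine ⟨J, fun j hj hbad => ?_⟩
    have := hJ j hj
    rw [if_pos hbad] at this
    exact absurd this (not_lt.2 (one_le_pow₀ (by norm_num)))
  refine ⟨Nat.find hex, Nat.find_spec hex, ?_⟩
  set J := Nat.find hex with hJ
  have hW0 : 0 ≤ (Wt s v ω).toReal := ENNReal.toReal_nonneg
  rcases Nat.eq_zero_or_pos J with h0 | h0
  · rw [h0]
    calc (2:ℝ)^(s*(0+3)) ≤ 2^(4*s) := pow_le_pow_right₀ (by norm_num) (by omega)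
      _ ≤ _ := le_mul_of_one_le_right (by positivity) (by linarith)
  · obtain ⟨m, hm⟩ : ∃ m, J = m+1 := ⟨J-1, by omega⟩
    have hb : BadAt m v ω := by
      have := Nat.find_min hex (m := m) (by omega)
      push Not at this
      obtain ⟨j, hj, hbj⟩ := this
      have hjm : j = m := by
        by_contra hne
        exact Nat.find_spec hex j (by omega) hbj
      rwa [hjm] at hbj
    have h1 : (2:ℝ≥0∞)^(s*m) ≤ Wt s v ω := by
      unfold Wt
      refine le_trans ?_ (ENNReal.le_tsum m)
      rw [if_pos hb]
    have h2 : (2:ℝ)^(s*m) ≤ (Wt s v ω).toReal := by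
      have := ENNReal.toReal_mono h h1
      simpa using this
    rw [hm]
    calc (2:ℝ)^(s*(m+1+3)) = 2^(4*s) * 2^(s*m) := by rw [← pow_add]; congr 1; ring
      _ ≤ _ := by gcongr; linarith

theorem det_good (ω : Config d) (s : ℕ) (C : ℝ≥0∞) (hC : C ≠ ⊤)
    (hW : ∀ N : ℕ, 1 ≤ N → ∑ x ∈ boxAt (0 : Pt d) N, Wt s x ω ≤ C * N^d) :
    ∃ (π : Pt d → Pt d) (r : Pt d → ℕ) (M : ℝ),
    (∀ x ∈ Sinf ω, π x = x) ∧ (∀ x, 1 ≤ r x) ∧ (∀ x, distInf x (π x) ≤ r x) ∧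
    (∀ x i, connIn (Sinf ω ∩ ballZ x (r x)) (π x) (π (x + Pi.single i 1))) ∧
    (∀ N : ℕ, 1 ≤ N → ∑ x ∈ boxAt (0 : Pt d) N, (r x:ℝ)^s ≤ M * N^d) := by
  classical
  have hWf : ∀ x, Wt s x ω ≠ ⊤ := by
    intro x
    refine ne_top_of_le_ne_top ?_ ((Finset.single_le_sum_of_canonicallyOrdered
      (f := fun x => Wt s x ω) ((mem_boxAt 0 x (distInf 0 x + 1)).2 (by omega))).trans
      (hW (distInf 0 x + 1) (by omega)))
    exact ENNReal.mul_ne_top hC (ENNReal.pow_ne_top (by simp))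
  choose J hJ hJs using fun x => Wt_scale s x ω (hWf x)
  have hne : (Sinf ω).Nonempty := by
    obtain ⟨y, hy, -⟩ := good_exists ω 0 (J 0) (hJ 0)
    exact ⟨y, hy⟩
  have hmin : ∀ x, ∃ y ∈ Sinf ω, ∀ z ∈ Sinf ω, distInf x y ≤ distInf x z := fun x =>
    ⟨Function.argminOn (distInf x) (Sinf ω) hne, Function.argminOn_mem _ _ hne,
      fun z hz => Function.argminOn_le (distInf x) (Sinf ω) hz⟩
  choose π hπT hπmin using hmin
  have hπJ : ∀ x, distInf x (π x) ≤ 2^(J x) := by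
    intro x
    obtain ⟨y, hy, hb⟩ := good_exists ω x (J x) (hJ x)
    exact (hπmin x y hy).trans hb
  refine ⟨π, fun x => 2^(J x + 3), 2^(4*s) * (3^d + C.toReal), ?_, fun x => Nat.one_le_two_pow, ?_, ?_, ?_⟩
  · intro x hx
    have h := hπmin x x hx
    rw [distInf_self] at h
    funext i
    have := (distInf_le_iff x (π x) 0).1 h i
    simp at this
    linarith
  · intro x
    exact (hπJ x).trans (Nat.pow_le_pow_right (by norm_num) (by omega))
  · intro x i
    have h4 : 2^(J x + 2) = 4 * 2^(J x) := by rw [pow_add]; ring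
    have h1 : 1 ≤ 2^(J x) := Nat.one_le_two_pow
    refine good_conn ω x (J x) (hJ x) (J x + 2) (by omega) _ _ (hπT _) ?_ (hπT _) ?_
    · have := hπJ x; omega
    · set x' := x + Pi.single i 1 with hx'
      have a1 := hπmin x' (π x) (hπT x)
      have a2 := distInf_tri x' x (π x)
      have a3 := distInf_tri x x' (π x')
      have a4 : distInf x x' ≤ 1 := adj_distInf (adj_single x i)
      rw [distInf_comm x' x] at a2
      have := hπJ x
      omega
  · intro N hN
    have hN1 : (1:ℝ) ≤ N := by exact_mod_cast hN
    calc ∑ x ∈ boxAt (0 : Pt d) N, (((2^(J x + 3) : ℕ)):ℝ)^s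
        ≤ ∑ x ∈ boxAt (0 : Pt d) N, 2^(4*s) * (1 + (Wt s x ω).toReal) := by
          refine Finset.sum_le_sum fun x _ => ?_
          refine le_trans (le_of_eq ?_) (hJs x)
          push_cast
          rw [← pow_mul, mul_comm]
      _ = 2^(4*s) * ((2*N+1)^d + (∑ x ∈ boxAt (0 : Pt d) N, Wt s x ω).toReal) := by
          rw [← Finset.mul_sum, Finset.sum_add_distrib, ENNReal.toReal_sum fun x _ => hWf x]
          simp [card_boxAt]
      _ ≤ 2^(4*s) * (3^d * N^d + C.toReal * N^d) := by
          have e1 : (2*(N:ℝ)+1)^d ≤ 3^d * N^d := by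
            rw [← mul_pow]; gcongr; linarith
          have e2 : (∑ x ∈ boxAt (0 : Pt d) N, Wt s x ω).toReal ≤ C.toReal * N^d := by
            have := ENNReal.toReal_mono (ENNReal.mul_ne_top hC (ENNReal.pow_ne_top (by simp)))
              (hW N hN)
            simpa using this
          gcongr
      _ = _ := by ring
end Det

section Meas
variable {d : ℕ}

theorem meas_SS (x : Pt d) (B : Set (Pt d)) : MeasurableSet {ω : Config d | x ∈ SS ω ∩ B} := by
  have h1 : MeasurableSet {ω : Config d | ω x = true} :=
    measurableSet_eq_fun (measurable_pi_apply x) measurable_const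
  by_cases hB : x ∈ B
  · convert h1 using 1
    ext ω; simp [SS, hB]
  · convert MeasurableSet.empty using 1
    ext ω; simp [hB]

theorem meas_reach (B : Set (Pt d)) (x : Pt d) (n : ℕ) :
    ∃ R : Config d → Pt d → Prop, (∀ y, MeasurableSet {ω | R ω y}) ∧
      ∀ ω y, R ω y ↔ ∃ l : ℕ → Pt d, l 0 = x ∧ l n = y ∧
        ∀ i < n, stepRel (SS ω ∩ B) (l i) (l (i+1)) := by
  refine ⟨_, ?_, fun ω y => Iff.rfl⟩
  induction n with
  | zero =>
    intro y
    by_cases hxy : x = y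
    · convert MeasurableSet.univ using 1
      ext ω; simp only [Set.mem_ofPred_eq, Set.mem_univ, iff_true]
      exact ⟨fun _ => x, rfl, hxy, fun i hi => absurd hi (by omega)⟩
    · convert MeasurableSet.empty using 1
      ext ω; simp only [Set.mem_ofPred_eq, Set.mem_empty_iff_false, iff_false]
      rintro ⟨l, h1, h2, -⟩
      exact hxy (h1.symm.trans h2)
  | succ n ih =>
    intro y
    have : {ω : Config d | ∃ l : ℕ → Pt d, l 0 = x ∧ l (n+1) = y ∧
        ∀ i < n+1, stepRel (SS ω ∩ B) (l i) (l (i+1))} =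
        ⋃ z : Pt d, ({ω : Config d | ∃ l : ℕ → Pt d, l 0 = x ∧ l n = z ∧
        ∀ i < n, stepRel (SS ω ∩ B) (l i) (l (i+1))} ∩ {ω | stepRel (SS ω ∩ B) z y}) := by
      ext ω
      simp only [Set.mem_ofPred_eq, Set.mem_iUnion, Set.mem_inter_iff]
      constructor
      · rintro ⟨l, h1, h2, h3⟩
        exact ⟨l n, ⟨l, h1, rfl, fun i hi => h3 i (by omega)⟩, h2 ▸ h3 n (by omega)⟩
      · rintro ⟨z, ⟨l, h1, h2, h3⟩, h4⟩
        refine ⟨fun i => if i ≤ n then l i else y, by simp [h1], by simp, fun i hi => ?_⟩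
        rcases Nat.lt_or_ge i n with h | h
        · simp only [show i ≤ n by omega, show i + 1 ≤ n by omega, if_true]
          exact h3 i h
        · obtain rfl : i = n := by omega
          simpa [h2] using h4
    rw [this]
    refine MeasurableSet.iUnion fun z => (ih z).inter ?_
    have : {ω : Config d | stepRel (SS ω ∩ B) z y} =
      {ω | adj z y} ∩ ({ω : Config d | z ∈ SS ω ∩ B} ∩ {ω : Config d | y ∈ SS ω ∩ B}) := by
      ext ω; simp [stepRel]
    rw [this]
    exact (MeasurableSet.const _).inter ((meas_SS z B).inter (meas_SS y B))

theorem rtg_iff {α : Type*} (r : α → α → Prop) (x y : α) : Relation.ReflTransGen r x y ↔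
    ∃ n : ℕ, ∃ l : ℕ → α, l 0 = x ∧ l n = y ∧ ∀ i < n, r (l i) (l (i+1)) := by
  constructor
  · intro h
    induction h with
    | refl => exact ⟨0, fun _ => x, rfl, rfl, fun i hi => absurd hi (by omega)⟩
    | tail hab hbc ih =>
      obtain ⟨n, l, h1, h2, h3⟩ := ih
      rename_i b c
      refine ⟨n+1, fun i => if i ≤ n then l i else c, by simp [h1], by simp, fun i hi => ?_⟩
      rcases Nat.lt_or_ge i n with h | h
      · simp only [show i ≤ n by omega, show i + 1 ≤ n by omega, if_true]
        exact h3 i h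
      · obtain rfl : i = n := by omega
        simpa [h2] using hbc
  · rintro ⟨n, l, rfl, rfl, h3⟩
    induction n with
    | zero => exact Relation.ReflTransGen.refl
    | succ n ih => exact (ih fun i hi => h3 i (by omega)).tail (h3 n (by omega))

theorem meas_connIn (B : Set (Pt d)) (x y : Pt d) :
    MeasurableSet {ω : Config d | connIn (SS ω ∩ B) x y} := by
  have : {ω : Config d | connIn (SS ω ∩ B) x y} =
      {ω : Config d | x ∈ SS ω ∩ B} ∩ ({ω : Config d | y ∈ SS ω ∩ B} ∩
        ⋃ n : ℕ, {ω : Config d | ∃ l : ℕ → Pt d, l 0 = x ∧ l n = y ∧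
        ∀ i < n, stepRel (SS ω ∩ B) (l i) (l (i+1))}) := by
    ext ω
    simp only [connIn, rtg_iff, Set.mem_ofPred_eq, Set.mem_iUnion, Set.mem_inter_iff]
  rw [this]
  refine (meas_SS x B).inter ((meas_SS y B).inter (MeasurableSet.iUnion fun n => ?_))
  obtain ⟨R, hR, hR2⟩ := meas_reach B x n
  convert hR y using 1
  ext ω
  exact (hR2 ω y).symm

theorem meas_connIn' (x y : Pt d) : MeasurableSet {ω : Config d | connIn (SS ω) x y} := by
  have := meas_connIn Set.univ x y
  simpa using this

theorem meas_Sr (x : Pt d) (r : ℝ) : MeasurableSet {ω : Config d | x ∈ Sr ω r} := by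
  have : {ω : Config d | x ∈ Sr ω r} = {ω : Config d | x ∈ SS ω ∩ Set.univ} ∩
      ⋃ y : Pt d, ⋃ z : Pt d, ({ω : Config d | connIn (SS ω) x y} ∩
        ({ω : Config d | connIn (SS ω) x z} ∩ {ω | r ≤ (dist1 y z:ℝ)})) := by
    ext ω
    simp only [Sr, cluster, Set.mem_ofPred_eq, Set.mem_iUnion, Set.mem_inter_iff, Set.mem_univ]
    constructor
    · rintro ⟨h, y, hy, z, hz, hr⟩
      exact ⟨⟨h, trivial⟩, y, z, hy, hz, hr⟩
    · rintro ⟨⟨h, -⟩, y, z, hy, hz, hr⟩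
      exact ⟨h, y, hy, z, hz, hr⟩
  rw [this]
  exact (meas_SS x _).inter (MeasurableSet.iUnion fun y => MeasurableSet.iUnion fun z =>
    (meas_connIn' x y).inter ((meas_connIn' x z).inter (MeasurableSet.const _)))

theorem meas_Sinf (x : Pt d) : MeasurableSet {ω : Config d | x ∈ Sinf ω} := by
  have : {ω : Config d | x ∈ Sinf ω} = ⋂ n : ℕ, {ω : Config d | x ∈ Sr ω n} := by
    ext ω
    simp only [Set.mem_ofPred_eq, Set.mem_iInter]
    exact ⟨fun h n => Sinf_sub_Sr ω _ h, fun h => Sinf_of_Sr ω x fun n => ⟨n, le_rfl, h n⟩⟩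
  rw [this]
  exact MeasurableSet.iInter fun n => meas_Sr x n

theorem meas_lu1 (R : ℕ) : MeasurableSet (locUniq1 d R) := by
  have : locUniq1 d R = ⋃ x : Pt d, ({ω : Config d | x ∈ Sr ω R} ∩ {ω | x ∈ ballZ (0:Pt d) R}) := by
    ext ω
    simp only [locUniq1, Set.mem_ofPred_eq, Set.mem_iUnion, Set.mem_inter_iff]
    rfl
  rw [this]
  exact MeasurableSet.iUnion fun x => (meas_Sr x R).inter (MeasurableSet.const _)

theorem meas_lu2 (R : ℕ) : MeasurableSet (locUniq2 d R) := by
  have : locUniq2 d R = ⋂ x : Pt d, ⋂ y : Pt d,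
      ((({ω : Config d | x ∈ Sr ω ((R:ℝ)/10)} ∩ {ω | x ∈ ballZ (0:Pt d) R}) ∩
      ({ω : Config d | y ∈ Sr ω ((R:ℝ)/10)} ∩ {ω | y ∈ ballZ (0:Pt d) R}))ᶜ ∪
      {ω : Config d | connIn (SS ω ∩ ballZ (0 : Pt d) (2*R)) x y}) := by
    ext ω
    simp only [locUniq2, Set.mem_ofPred_eq, Set.mem_iInter, Set.mem_inter_iff, Set.mem_union,
      Set.mem_compl_iff]
    constructor
    · intro h x y
      by_cases hh : ((x ∈ Sr ω ((R:ℝ)/10) ∧ x ∈ ballZ (0:Pt d) R) ∧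
        (y ∈ Sr ω ((R:ℝ)/10) ∧ y ∈ ballZ (0:Pt d) R))
      · exact Or.inr (h x hh.1 y hh.2)
      · exact Or.inl hh
    · intro h x hx y hy
      exact (h x y).resolve_left fun h => h ⟨hx, hy⟩
  rw [this]
  exact MeasurableSet.iInter fun x => MeasurableSet.iInter fun y =>
    ((((meas_Sr x _).inter (MeasurableSet.const _)).inter
      ((meas_Sr y _).inter (MeasurableSet.const _))).compl).union (meas_connIn _ x y)

theorem meas_shift (x : Pt d) : Measurable (shift x : Config d → Config d) :=
  measurable_pi_lambda _ fun y => measurable_pi_apply (x + y)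

theorem shift_zero (ω : Config d) : shift 0 ω = ω := by
  funext y; simp [shift]

theorem shift_shift (x y : Pt d) (ω : Config d) : shift y (shift x ω) = shift (x + y) ω := by
  funext z; simp [shift, add_assoc]

theorem Wt_shift (s : ℕ) (x y : Pt d) (ω : Config d) : Wt s y (shift x ω) = Wt s (x + y) ω := by
  unfold Wt
  refine tsum_congr fun j => ?_
  have : BadAt j y (shift x ω) = BadAt j (x+y) ω := by unfold BadAt; rw [shift_shift]
  by_cases h : BadAt j (x+y) ω
  · rw [if_pos h, if_pos (this ▸ h)]
  · rw [if_neg h, if_neg (this ▸ h)]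

theorem meas_Bad (j : ℕ) (x : Pt d) : MeasurableSet {ω : Config d | BadAt j x ω} :=
  (meas_shift x ((meas_lu1 (2^j)).inter (meas_lu2 (2^j)))).compl

theorem meas_Wt (s : ℕ) (x : Pt d) : Measurable (Wt s x : Config d → ℝ≥0∞) := by
  unfold Wt
  refine Measurable.tsum fun j => ?_
  exact Measurable.ite (meas_Bad j x) measurable_const measurable_const

/-- Covering (weak-type) inequality. -/
theorem cover (w : Pt d → ℝ≥0∞) (lam : ℝ≥0∞) (N : Pt d → ℕ) (n : ℕ) :
    ∀ A : Finset (Pt d), A.card ≤ n →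
    (∀ a ∈ A, lam * (2*(N a)+1)^d ≤ ∑ y ∈ boxAt a (N a), w y) →
    lam * A.card ≤ 2^d * ∑ y ∈ A.biUnion (fun a => boxAt a (N a)), w y := by
  classical
  induction n with
  | zero =>
    intro A hA _
    have : A = ∅ := by simpa using hA
    subst this; simp
  | succ n ih =>
    intro A hA h
    rcases A.eq_empty_or_nonempty with rfl | hne
    · simp
    obtain ⟨a, ha, hmax⟩ := A.exists_max_image N hne
    set A' := A.filter (fun b => ¬ distInf a b ≤ 2 * N a) with hA'
    have hsub : A' ⊂ A := by
      refine Finset.filter_ssubset.2 ⟨a, ha, ?_⟩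
      simp [distInf_self]
    have ih' := ih A' (by have := Finset.card_lt_card hsub; omega)
      (fun b hb => h b (hsub.1 hb))
    have hcard : A.card ≤ A'.card + (4 * N a + 1)^d := by
      rw [← Finset.card_filter_add_card_filter_not (s := A) (fun b => distInf a b ≤ 2 * N a), add_comm]
      gcongr
      calc _ ≤ (boxAt a (2 * N a)).card := by
            refine Finset.card_le_card fun b hb => ?_
            rw [mem_boxAt]; exact (Finset.mem_filter.1 hb).2
        _ = _ := by rw [card_boxAt]; congr 1; ring
    have hdisj : Disjoint (A'.biUnion (fun a => boxAt a (N a))) (boxAt a (N a)) := by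
      rw [Finset.disjoint_left]
      intro y hy hy2
      obtain ⟨b, hb, hyb⟩ := Finset.mem_biUnion.1 hy
      rw [mem_boxAt] at hyb hy2
      have h1 := (Finset.mem_filter.1 hb).2
      have h2 := hmax b (hsub.1 hb)
      have h3 := distInf_tri a y b
      rw [distInf_comm y b] at h3
      omega
    calc lam * (A.card : ℝ≥0∞) ≤ lam * (A'.card + (4 * N a + 1)^d) := by
          gcongr; exact_mod_cast hcard
      _ ≤ lam * A'.card + 2^d * (lam * (2*(N a)+1)^d) := by
          rw [mul_add]
          refine add_le_add_right ?_ _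
          rw [mul_left_comm, ← mul_pow]
          gcongr
          calc (4 * (N a:ℝ≥0∞) + 1) ≤ 4 * N a + 2 := by gcongr; norm_num
            _ = _ := by ring
      _ ≤ 2^d * ∑ y ∈ A'.biUnion (fun a => boxAt a (N a)), w y + 2^d * ∑ y ∈ boxAt a (N a), w y := by
          gcongr
          exact h a ha
      _ = 2^d * ∑ y ∈ (A'.biUnion (fun a => boxAt a (N a))) ∪ boxAt a (N a), w y := by
          rw [Finset.sum_union hdisj, mul_add]
      _ ≤ _ := by
          gcongr
          refine Finset.union_subset (Finset.biUnion_subset_biUnion_of_subset_left _ hsub.1) ?_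
          exact Finset.subset_biUnion_of_mem (fun a => boxAt a (N a)) ha
end Meas

section Prob
variable {d : ℕ}

theorem box_shift (x : Pt d) (N : ℕ) (w : Pt d → ℝ≥0∞) :
    ∑ y ∈ boxAt x N, w y = ∑ y ∈ boxAt (0:Pt d) N, w (x + y) := by
  symm
  refine Finset.sum_bij (fun y _ => x + y) ?_ ?_ ?_ ?_
  · intro y hy
    rw [mem_boxAt] at hy ⊢
    have := distInf_add x 0 y
    rw [add_zero] at this; omega
  · intro a _ b _ h; simpa using h
  · intro y hy
    refine ⟨-x + y, ?_, by simp⟩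
    rw [mem_boxAt] at hy ⊢
    have := distInf_add x 0 (-x + y)
    simp at this; omega
  · intros; rfl

/-- The event that some average up to scale `M` around `x` exceeds `lam`. -/
def Ev (s : ℕ) (lam : ℝ≥0∞) (M : ℕ) (x : Pt d) : Set (Config d) :=
  {ω | ∃ N : ℕ, N ≤ M ∧ lam * (2*N+1)^d ≤ ∑ y ∈ boxAt x N, Wt s y ω}

theorem Ev_shift (s : ℕ) (lam : ℝ≥0∞) (M : ℕ) (x : Pt d) :
    Ev s lam M x = shift x ⁻¹' (Ev s lam M 0) := by
  ext ω
  simp only [Ev, Set.mem_preimage, Set.mem_ofPred_eq, Wt_shift]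
  constructor
  · rintro ⟨N, h, h2⟩; exact ⟨N, h, by rwa [box_shift] at h2⟩
  · rintro ⟨N, h, h2⟩; exact ⟨N, h, by rwa [box_shift]⟩

theorem meas_Ev (s : ℕ) (lam : ℝ≥0∞) (M : ℕ) (x : Pt d) : MeasurableSet (Ev s lam M x) := by
  have : Ev s lam M x = ⋃ N : ℕ, ({ω | N ≤ M} ∩
      {ω | lam * (2*N+1)^d ≤ ∑ y ∈ boxAt x N, Wt s y ω}) := by
    ext ω; simp [Ev]
  rw [this]
  refine MeasurableSet.iUnion fun N => (MeasurableSet.const _).inter ?_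
  exact measurableSet_le measurable_const (Finset.measurable_sum _ fun y _ => meas_Wt s y)

theorem count_Ev (s : ℕ) (lam : ℝ≥0∞) (M : ℕ) (ω : Config d) :
    lam * ∑ x ∈ boxAt (0:Pt d) M, (Ev s lam M x).indicator 1 ω
      ≤ 2^d * ∑ y ∈ boxAt (0:Pt d) (2*M), Wt s y ω := by
  classical
  set A := (boxAt (0:Pt d) M).filter (fun x => ω ∈ Ev s lam M x) with hA
  have hN : ∀ x : Pt d, ∃ N : ℕ, x ∈ A → N ≤ M ∧ lam * (2*N+1)^d ≤ ∑ y ∈ boxAt x N, Wt s y ω := by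
    intro x
    by_cases hx : x ∈ A
    · obtain ⟨N, h⟩ := (Finset.mem_filter.1 hx).2
      exact ⟨N, fun _ => h⟩
    · exact ⟨0, fun h => absurd h hx⟩
  choose N hN using hN
  have := cover (fun y => Wt s y ω) lam N A.card A le_rfl fun a ha => (hN a ha).2
  have h1 : ∑ x ∈ boxAt (0:Pt d) M, (Ev s lam M x).indicator (1 : Config d → ℝ≥0∞) ω = A.card := by
    rw [hA, Finset.card_filter]
    push_cast
    refine Finset.sum_congr rfl fun x _ => ?_
    simp [Set.indicator_apply]
  rw [h1]
  refine this.trans ?_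
  gcongr
  intro y hy
  obtain ⟨a, ha, hya⟩ := Finset.mem_biUnion.1 hy
  have h2 := (hN a ha).1
  have h3 := (Finset.mem_filter.1 ha).1
  rw [mem_boxAt] at *
  have := distInf_tri 0 a y
  omega

theorem max_ineq (μ : Measure (Config d)) (hμ : ∀ x : Pt d, MeasurePreserving (shift x) μ μ)
    (s : ℕ) (lam : ℝ≥0∞) (M : ℕ) :
    lam * μ (Ev s lam M 0) ≤ 4^d * ∫⁻ ω, Wt s 0 ω ∂μ := by
  have h1 := lintegral_mono (μ := μ) (fun ω => count_Ev (d := d) s lam M ω)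
  rw [lintegral_const_mul, lintegral_const_mul, lintegral_finsetSum, lintegral_finsetSum] at h1
  · have e1 : ∀ x : Pt d, ∫⁻ ω, (Ev s lam M x).indicator 1 ω ∂μ = μ (Ev s lam M 0) := by
      intro x
      rw [lintegral_indicator_one (meas_Ev _ _ _ _), Ev_shift,
        (hμ x).measure_preimage (meas_Ev _ _ _ _).nullMeasurableSet]
    have e2 : ∀ x : Pt d, ∫⁻ ω, Wt s x ω ∂μ = ∫⁻ ω, Wt s 0 ω ∂μ := by
      intro x
      rw [← (hμ x).lintegral_comp (meas_Wt s 0)]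
      simp only [Wt_shift, add_zero]
    simp only [e1, e2, Finset.sum_const, card_boxAt, nsmul_eq_mul] at h1
    have hpos : ((2*M+1:ℝ≥0∞)^d) ≠ 0 := by positivity
    have htop : ((2*M+1:ℝ≥0∞)^d) ≠ ⊤ := ENNReal.pow_ne_top (by finiteness)
    rw [← ENNReal.mul_le_mul_iff_right hpos htop]
    calc (2*M+1:ℝ≥0∞)^d * (lam * μ (Ev s lam M 0)) = lam * (((2*M+1)^d:ℕ) * μ (Ev s lam M 0)) := by
          push_cast; ring
      _ ≤ _ := h1
      _ ≤ 2^d * ((2 * (2*M+1))^d * ∫⁻ ω, Wt s 0 ω ∂μ) := by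
          gcongr
          push_cast
          gcongr
          calc (2 * (2*(M:ℝ≥0∞)) + 1) ≤ 2 * (2*M) + 2 := by gcongr; norm_num
            _ = _ := by ring
      _ = _ := by
          rw [mul_pow, show (4:ℝ≥0∞) = 2*2 by norm_num, mul_pow]; ring
  all_goals first
    | exact fun x _ => meas_Wt s x
    | exact fun x _ => measurable_one.indicator (meas_Ev _ _ _ _)
    | exact Finset.measurable_sum _ fun x _ => meas_Wt s x
    | exact Finset.measurable_sum _ fun x _ => measurable_one.indicator (meas_Ev _ _ _ _)

theorem ae_avg (μ : Measure (Config d)) (hμ : ∀ x : Pt d, MeasurePreserving (shift x) μ μ)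
    (s : ℕ) (hfin : ∫⁻ ω, Wt s (0:Pt d) ω ∂μ ≠ ⊤) :
    ∀ᵐ ω ∂μ, ∃ C : ℝ≥0∞, C ≠ ⊤ ∧
      ∀ N : ℕ, 1 ≤ N → ∑ x ∈ boxAt (0 : Pt d) N, Wt s x ω ≤ C * N^d := by
  set I := 4^d * ∫⁻ ω, Wt s (0:Pt d) ω ∂μ with hI
  have hItop : I ≠ ⊤ := ENNReal.mul_ne_top (by finiteness) hfin
  have h1 : ∀ k : ℕ, (k:ℝ≥0∞) * μ (⋃ M, Ev s k M 0) ≤ I := by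
    intro k
    have hmono : Monotone fun M => Ev s (k:ℝ≥0∞) M (0:Pt d) := by
      rintro M M' h ω ⟨N, hN, h2⟩
      exact ⟨N, hN.trans h, h2⟩
    rw [hmono.measure_iUnion, ENNReal.mul_iSup]
    exact iSup_le fun M => max_ineq μ hμ s k M
  have h2 : μ (⋂ k : ℕ, ⋃ M, Ev s (k:ℝ≥0∞) M (0:Pt d)) = 0 := by
    set m := μ (⋂ k : ℕ, ⋃ M, Ev s (k:ℝ≥0∞) M (0:Pt d)) with hm
    by_contra hne
    have h3 : ∀ k : ℕ, (k:ℝ≥0∞) * m ≤ I := fun k =>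
      le_trans (by gcongr; exact measure_mono (Set.iInter_subset _ k)) (h1 k)
    obtain ⟨k, hk⟩ := ENNReal.exists_nat_mul_gt hne hItop
    exact absurd (h3 k) (not_le.2 hk)
  rw [ae_iff]
  refine measure_mono_null ?_ h2
  intro ω hω
  simp only [Set.mem_ofPred_eq] at hω
  rw [Set.mem_iInter]
  intro k
  by_contra hk
  apply hω
  refine ⟨k * 3^d, by finiteness, fun N hN => ?_⟩
  rw [Set.mem_iUnion] at hk
  push Not at hk
  have h4 := hk N
  simp only [Ev, Set.mem_ofPred_eq] at h4
  push Not at h4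
  refine (h4 N le_rfl).le.trans ?_
  rw [mul_assoc, ← mul_pow]
  gcongr
  calc 2 * (N:ℝ≥0∞) + 1 ≤ 2 * N + N := by gcongr; exact_mod_cast hN
    _ = _ := by ring

theorem Wt_fin (a b : ℝ) (P : ℝ → Measure (Config d)) (Ax : Axioms d a b P) (u : ℝ)
    (hu : u ∈ Set.Ioo a b) (s : ℕ) : ∫⁻ ω, Wt s (0:Pt d) ω ∂(P u) ≠ ⊤ := by
  classical
  have := Ax.prob u hu
  have hΔ := Ax.ΔS_pos u hu
  have hbad : ∀ j : ℕ, P u {ω | BadAt j (0:Pt d) ω} ≤ ENNReal.ofReal (2 * Real.exp (-(Ax.fS u (2^j)))) := by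
    intro j
    have hsub : {ω : Config d | BadAt j (0:Pt d) ω} ⊆ (locUniq1 d (2^j))ᶜ ∪ (locUniq2 d (2^j))ᶜ := by
      intro ω hω
      simp only [BadAt, shift_zero, Set.mem_ofPred_eq] at hω
      rwa [← Set.compl_inter]
    refine (measure_mono hsub).trans ((measure_union_le _ _).trans ?_)
    rw [two_mul, ENNReal.ofReal_add (by positivity) (by positivity)]
    have hc : ∀ A : Set (Config d), MeasurableSet A →
        1 - Real.exp (-(Ax.fS u (2^j))) ≤ (P u A).toReal →
        P u Aᶜ ≤ ENNReal.ofReal (Real.exp (-(Ax.fS u (2^j)))) := by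
      intro A hA h
      rw [← ofReal_measureReal]
      refine ENNReal.ofReal_le_ofReal ?_
      rw [probReal_compl_eq_one_sub hA]
      have : (P u).real A = (P u A).toReal := rfl
      linarith
    exact add_le_add (hc _ (meas_lu1 _) (Ax.S1a u hu _ Nat.one_le_two_pow))
      (hc _ (meas_lu2 _) (Ax.S1b u hu _ Nat.one_le_two_pow))
  have hIntW : ∫⁻ ω, Wt s (0:Pt d) ω ∂(P u) =
      ∑' j : ℕ, (2:ℝ≥0∞)^(s*j) * P u {ω | BadAt j (0:Pt d) ω} := by
    unfold Wt
    rw [lintegral_tsum]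
    · refine tsum_congr fun j => ?_
      rw [← lintegral_indicator_const (meas_Bad j 0)]
      refine lintegral_congr fun ω => ?_
      simp only [Set.indicator_apply, Set.mem_ofPred_eq]
    · intro j
      exact (Measurable.ite (meas_Bad j 0) measurable_const measurable_const).aemeasurable
  rw [hIntW]
  have hle : ∀ j : ℕ, (2:ℝ≥0∞)^(s*j) * P u {ω | BadAt j (0:Pt d) ω} ≤
      ENNReal.ofReal ((2:ℝ)^(s*j) * (2 * Real.exp (-(Ax.fS u (2^j))))) := by
    intro j
    rw [ENNReal.ofReal_mul (by positivity), ENNReal.ofReal_pow (by norm_num)]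
    gcongr
    · simp
    · exact hbad j
  refine ne_top_of_le_ne_top ?_ (ENNReal.tsum_le_tsum hle)
  refine (Summable.tsum_ofReal_ne_top ?_)
  have hlog2 : 0 < Real.log 2 := Real.log_pos (by norm_num)
  have hev : ∀ᶠ j : ℕ in atTop, (2:ℝ)^(s*j) * (2 * Real.exp (-(Ax.fS u (2^j)))) ≤ 2 * (1/2)^j := by
    have t1 : Tendsto (fun j : ℕ => ((j:ℝ) * Real.log 2) ^ (Ax.ΔS u)) atTop atTop :=
      (tendsto_rpow_atTop hΔ).comp (tendsto_natCast_atTop_atTop.atTop_mul_const hlog2)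
    have t2 : Tendsto (fun j : ℕ => 2^j) atTop atTop := tendsto_pow_atTop_atTop_of_one_lt (by norm_num)
    filter_upwards [t1.eventually_ge_atTop ((s:ℝ)+1), t2.eventually_ge_atTop (Ax.RS u),
      eventually_ge_atTop 1] with j h1 h2 h3
    have h4 := Ax.fS_lb u hu (2^j) h2
    have hj : (0:ℝ) < j := by exact_mod_cast h3
    have hp : 0 < (j:ℝ) * Real.log 2 := by positivity
    push_cast at h4
    rw [Real.log_pow, Real.rpow_add hp, Real.rpow_one] at h4
    have h5 : (j:ℝ) * Real.log 2 * (s+1) ≤ Ax.fS u (2^j) :=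
      (mul_le_mul_of_nonneg_left h1 hp.le).trans h4
    have h6 : Real.exp (-(Ax.fS u (2^j))) ≤ Real.exp (-((j:ℝ) * Real.log 2 * (s+1))) :=
      Real.exp_le_exp.2 (by linarith)
    have h7 : Real.exp (-((j:ℝ) * Real.log 2 * (s+1))) = (1/2)^(j*(s+1)) := by
      rw [Real.exp_neg, show (j:ℝ) * Real.log 2 * (s+1) = ((j*(s+1) : ℕ):ℝ) * Real.log 2 by
        push_cast; ring, Real.exp_nat_mul, Real.exp_log (by norm_num)]
      rw [one_div, inv_pow]
    rw [h7] at h6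
    calc (2:ℝ)^(s*j) * (2 * Real.exp (-(Ax.fS u (2^j)))) ≤ 2^(s*j) * (2 * (1/2)^(j*(s+1))) := by gcongr
      _ = 2 * (1/2)^j * ((2:ℝ)^(s*j) * (1/2)^(s*j)) := by ring
      _ = _ := by rw [← mul_pow]; norm_num
  refine Summable.of_norm_bounded_eventually_nat (g := fun j : ℕ => 2 * (1/2:ℝ)^j)
    (Summable.mul_left _ summable_geometric_two) ?_
  filter_upwards [hev] with j hj
  rw [Real.norm_of_nonneg (by positivity)]
  exact hj

theorem ae_good (a b : ℝ) (P : ℝ → Measure (Config d)) (Ax : Axioms d a b P) (u : ℝ)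
    (hu : u ∈ Set.Ioo a b) (s : ℕ) : ∀ᵐ ω ∂(P u), ∃ C : ℝ≥0∞, C ≠ ⊤ ∧
      ∀ N : ℕ, 1 ≤ N → ∑ x ∈ boxAt (0 : Pt d) N, Wt s x ω ≤ C * N^d := by
  refine ae_avg (P u) (fun x => ?_) s (Wt_fin a b P Ax u hu s)
  by_cases hx : x = 0
  · subst hx
    have : (shift 0 : Config d → Config d) = id := by funext ω; exact shift_zero ω
    rw [this]; exact MeasurePreserving.id _
  · exact (Ax.ergodic u hu x hx).toMeasurePreserving
end Prob

section Ker
variable {d : ℕ}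

theorem adj_form {x y : Pt d} (h : adj x y) :
    ∃ i : Fin d, ∃ b : Bool, y = x + Pi.single i (if b then 1 else -1) := by
  unfold adj dist1 at h
  have hex : ∃ i, (x i - y i).natAbs ≠ 0 := by
    by_contra hc
    push Not at hc
    simp [hc] at h
  obtain ⟨i, hi⟩ := hex
  have hs := Finset.sum_erase_add Finset.univ (fun i => (x i - y i).natAbs) (Finset.mem_univ i)
  simp only [h] at hs
  have hz : ∑ j ∈ Finset.univ.erase i, (x j - y j).natAbs = 0 := by omega
  have h1 : (x i - y i).natAbs = 1 := by omega
  have hz' : ∀ j, j ≠ i → x j = y j := by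
    intro j hj
    have := Finset.sum_eq_zero_iff.1 hz j (by simp [hj])
    omega
  refine ⟨i, decide (x i < y i), ?_⟩
  funext j
  by_cases hj : j = i
  · subst hj
    simp only [Pi.add_apply, Pi.single_eq_same, decide_eq_true_eq]
    split_ifs <;> omega
  · simp [Pi.single_eq_of_ne hj, hz' j hj]

theorem adj_ne {x y : Pt d} (h : adj x y) : x ≠ y := by
  rintro rfl
  simp [adj, dist1] at h

theorem adj_card (F : Finset (Pt d)) (x : Pt d) (hF : ∀ y ∈ F, adj x y) : F.card ≤ 2 * d := by
  classical
  have : F ⊆ (Finset.univ : Finset (Fin d × Bool)).image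
      (fun e => x + Pi.single e.1 (if e.2 then 1 else -1)) := by
    intro y hy
    obtain ⟨i, b, h⟩ := adj_form (hF y hy)
    exact Finset.mem_image.2 ⟨(i, b), Finset.mem_univ _, h.symm⟩
  refine (Finset.card_le_card this).trans (Finset.card_image_le.trans ?_)
  simp [mul_comm]

open scoped Classical in
/-- Degree inside a finite set. -/
noncomputable def dgF (F : Finset (Pt d)) (x : Pt d) : ℕ := (F.filter (fun y => adj x y)).card

open scoped Classical in
/-- Reflecting kernel on a finite set. -/
noncomputable def pF (F : Finset (Pt d)) (x y : F) : ℝ :=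
  if adj x.1 y.1 then 1/(2*d) else if y = x then 1 - (dgF F x.1 : ℝ)/(2*d) else 0

theorem dgF_le (F : Finset (Pt d)) (x : Pt d) : dgF F x ≤ 2 * d := by
  classical
  exact adj_card _ x fun _ hy => (Finset.mem_filter.1 hy).2

theorem pF_sum (hd : 2 ≤ d) (F : Finset (Pt d)) (x : F) : ∑ y, pF F x y = 1 := by
  classical
  have hd0 : (0:ℝ) < d := by positivity
  have h1 : ∀ y, pF F x y = (if adj x.1 y.1 then 1/(2*(d:ℝ)) else 0) +
      (if y = x then 1 - (dgF F x.1 : ℝ)/(2*d) else 0) := by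
    intro y
    unfold pF
    by_cases h : adj x.1 y.1
    · have : y ≠ x := fun hh => adj_ne h (by rw [hh])
      simp [h, this]
    · simp [h]
  simp only [h1, Finset.sum_add_distrib]
  rw [Finset.sum_ite_eq' Finset.univ x, if_pos (Finset.mem_univ _)]
  have h2 : ∑ y : F, (if adj x.1 y.1 then 1/(2*(d:ℝ)) else 0) = dgF F x.1 / (2*d) := by
    rw [Finset.sum_coe_sort F (fun y => if adj x.1 y then 1/(2*(d:ℝ)) else 0),
      ← Finset.sum_filter, Finset.sum_const, dgF, nsmul_eq_mul]
    ring
  rw [h2]; ring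

theorem pF_symSt (hd : 2 ≤ d) (F : Finset (Pt d)) : SymSt (pF F) where
  symm x y := by
    unfold pF
    by_cases h : adj x.1 y.1
    · simp [h, adj_comm h]
    · have h' : ¬ adj y.1 x.1 := fun h2 => h (adj_comm h2)
      by_cases hxy : y = x
      · subst hxy; rfl
      · simp [h, h', hxy, Ne.symm hxy]
  nonneg x y := by
    have hd0 : (0:ℝ) < d := by positivity
    unfold pF
    split_ifs
    · positivity
    · rw [sub_nonneg, div_le_one (by positivity)]
      exact_mod_cast dgF_le F x.1
    · exact le_rfl
  sum_one := pF_sum hd F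

theorem pF_adj (F : Finset (Pt d)) {x y : F} (h : adj x.1 y.1) : pF F x y = 1/(2*d) := by
  unfold pF; rw [if_pos h]

theorem pF_qq (hd : 2 ≤ d) (F : Finset (Pt d)) (x : F) : 1/(4*(d:ℝ)^2) ≤ qq (pF F) x x := by
  classical
  have hp := pF_symSt hd F
  have hd0 : (2:ℝ) ≤ d := by exact_mod_cast hd
  have key : ∀ u : F, pF F x u * pF F u x ≤ qq (pF F) x x := fun u =>
    Finset.single_le_sum (f := fun u => pF F x u * pF F u x)
      (fun u _ => mul_nonneg (hp.nonneg _ _) (hp.nonneg _ _)) (Finset.mem_univ u)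
  rcases Nat.eq_zero_or_pos (dgF F x.1) with h | h
  · have h1 : pF F x x = 1 := by
      have : ¬ adj x.1 x.1 := fun h => adj_ne h rfl
      simp [pF, this, h]
    refine le_trans ?_ (key x)
    rw [h1, div_le_iff₀ (by positivity)]; nlinarith
  · obtain ⟨u, hu⟩ := Finset.card_pos.1 h
    obtain ⟨huF, hux⟩ := Finset.mem_filter.1 hu
    refine le_trans (le_of_eq ?_) (key ⟨u, huF⟩)
    rw [hp.symm ⟨u, huF⟩ x, pF_adj F (x := x) (y := ⟨u, huF⟩) hux]
    field_simp; norm_num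

theorem pF_lip (F : Finset (Pt d)) (z y y' : F) (h : pF F y y' ≠ 0) :
    |(distInf z.1 y.1 : ℝ) - distInf z.1 y'.1| ≤ 1 := by
  have hd : distInf y.1 y'.1 ≤ 1 := by
    unfold pF at h
    split_ifs at h with h1 h2
    · exact adj_distInf h1
    · rw [h2, distInf_self]; omega
    · exact absurd rfl h
  have t1 := distInf_tri z.1 y.1 y'.1
  have t2 := distInf_tri z.1 y'.1 y.1
  rw [distInf_comm y'.1 y.1] at t2
  have t1' : (distInf z.1 y'.1 : ℝ) ≤ distInf z.1 y.1 + 1 := by exact_mod_cast (by omega)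
  have t2' : (distInf z.1 y.1 : ℝ) ≤ distInf z.1 y'.1 + 1 := by exact_mod_cast (by omega)
  rw [abs_le]; constructor <;> linarith

/-- Iterated operator applied to a point mass. -/
noncomputable def GG {V : Type} [Fintype V] (p : V → V → ℝ) (f : V → ℝ) : ℕ → V → ℝ
  | 0 => f
  | n+1 => opP p (GG p f n)

theorem GG_adj {V : Type} [Fintype V] {p : V → V → ℝ} (hp : SymSt p) (f g : V → ℝ) (n : ℕ) :
    ∀ m, ∑ y, GG p f n y * GG p g m y = ∑ y, f y * GG p g (n+m) y := by
  induction n with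
  | zero => intro m; simp [GG]
  | succ n ih =>
    intro m
    have h1 := opP_selfadj hp (GG p f n) (GG p g m)
    have h2 := ih (m+1)
    rw [show n + 1 + m = n + (m+1) by ring, ← h2]
    exact h1.symm
end Ker

section Asm
variable {d : ℕ}

theorem GG_le {V : Type} [Fintype V] {p : V → V → ℝ} (hp : SymSt p) (f : V → ℝ) (n m : ℕ) (c : ℝ)
    (h : ∀ y, GG p f n y ≤ c) : ∀ y, GG p f (n+m) y ≤ c := by
  induction m with
  | zero => exact h
  | succ m ih =>
    intro y
    change opP p (GG p f (n+m)) y ≤ c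
    unfold opP
    calc ∑ z, p y z * GG p f (n+m) z ≤ ∑ z, p y z * c :=
          Finset.sum_le_sum fun z _ => mul_le_mul_of_nonneg_left (ih z) (hp.nonneg _ _)
      _ = c := by rw [← Finset.sum_mul, hp.sum_one, one_mul]

theorem GG_ff {V : Type} [Fintype V] (p : V → V → ℝ) (z : V) (k : ℕ) :
    GG p (ff p z 0) (2*k) = ff p z k := by
  induction k with
  | zero => rfl
  | succ k ih =>
    change opP p (opP p (GG p (ff p z 0) (2*k))) = opP p (opP p (ff p z k))
    rw [ih]

theorem GG_4k {V : Type} [Fintype V] {p : V → V → ℝ} (hp : SymSt p) (o x : V) (k : ℕ) :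
    GG p (ff p o 0) (4*k) x = ∑ y, ff p o k y * ff p x k y := by
  classical
  have h := GG_adj hp (ff p x 0) (ff p o 0) (2*k) (2*k)
  rw [GG_ff, GG_ff, show 2*k+2*k = 4*k by ring] at h
  have h2 : ∑ y, ff p x 0 y * GG p (ff p o 0) (4*k) y = GG p (ff p o 0) (4*k) x := by
    rw [Finset.sum_eq_single x]
    · simp [ff]
    · intro b _ hb; simp [ff, hb]
    · simp
  rw [← h2, ← h]
  exact Finset.sum_congr rfl fun y _ => mul_comm _ _

open scoped Classical in
/-- The finite piece of the infinite cluster. -/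
noncomputable def FL (ω : Config d) (L : ℕ) : Finset (Pt d) := (boxAt 0 L).filter (· ∈ Sinf ω)

theorem mem_FL (ω : Config d) (L : ℕ) (x : Pt d) : x ∈ FL ω L ↔ distInf 0 x ≤ L ∧ x ∈ Sinf ω := by
  classical
  unfold FL
  rw [Finset.mem_filter, mem_boxAt]

theorem adj_Sinf {ω : Config d} {x y : Pt d} (hx : x ∈ Sinf ω) (h : adj x y) (hy : y ∈ SS ω) :
    y ∈ Sinf ω :=
  Sinf_conn ω hx ⟨hx.1, hy, Relation.ReflTransGen.single ⟨h, hx.1, hy⟩⟩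

theorem degS_eq (ω : Config d) (L : ℕ) (z : Pt d) (hz : z ∈ Sinf ω) (hL : distInf 0 z + 1 ≤ L) :
    degS ω z = dgF (FL ω L) z := by
  classical
  unfold degS dgF
  rw [← Set.ncard_coe_finset]
  congr 1
  ext y
  simp only [Set.mem_ofPred_eq, Finset.coe_filter, mem_FL]
  constructor
  · rintro ⟨h1, h2⟩
    have := distInf_tri 0 z y
    have := adj_distInf h1
    exact ⟨⟨by omega, adj_Sinf hz h1 h2⟩, h1⟩
  · rintro ⟨⟨-, h2⟩, h1⟩
    exact ⟨h1, h2.1⟩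

theorem stepP_in (ω : Config d) (L : ℕ) (z y : FL ω L) (hL : distInf 0 z.1 + 1 ≤ L) :
    stepP d ω z.1 y.1 = pF (FL ω L) z y := by
  have hy : y.1 ∈ SS ω := ((mem_FL ω L _).1 y.2).2.1
  have hz := ((mem_FL ω L _).1 z.2).2
  unfold stepP pF
  rw [degS_eq ω L z.1 hz hL]
  by_cases h : adj z.1 y.1
  · simp [h, hy]
  · simp only [h, false_and, if_false, Subtype.ext_iff]

theorem stepP_out (ω : Config d) (L : ℕ) (z : FL ω L) (y : Pt d) (hy : y ∉ FL ω L)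
    (hL : distInf 0 z.1 + 1 ≤ L) : stepP d ω z.1 y = 0 := by
  have hz := ((mem_FL ω L _).1 z.2).2
  unfold stepP
  rw [if_neg, if_neg]
  · rintro rfl; exact hy z.2
  · rintro ⟨h1, h2⟩
    apply hy
    have := distInf_tri 0 z.1 y
    have := adj_distInf h1
    exact (mem_FL ω L y).2 ⟨by omega, adj_Sinf hz h1 h2⟩

theorem GG_supp (F : Finset (Pt d)) (o : F) (n : ℕ) :
    ∀ y, GG (pF F) (ff (pF F) o 0) n y ≠ 0 → distInf o.1 y.1 ≤ n := by
  induction n with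
  | zero =>
    intro y hy
    simp only [GG, ff] at hy
    split_ifs at hy with h
    · rw [h, distInf_self]
    · exact absurd rfl hy
  | succ n ih =>
    intro y hy
    change ∑ z, pF F y z * GG (pF F) (ff (pF F) o 0) n z ≠ 0 at hy
    obtain ⟨z, -, hz⟩ := Finset.exists_ne_zero_of_sum_ne_zero hy
    have h1 := ih z (right_ne_zero_of_mul hz)
    have h2 := pF_lip F o y z (left_ne_zero_of_mul hz)
    rw [abs_le] at h2
    have h3 : (distInf o.1 y.1 : ℝ) ≤ distInf o.1 z.1 + 1 := by linarith
    have h4 : distInf o.1 y.1 ≤ distInf o.1 z.1 + 1 := by exact_mod_cast h3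
    omega

theorem walk_eq (hd : 2 ≤ d) (ω : Config d) (L : ℕ) (o : FL ω L) (ho : o.1 = 0) (n : ℕ) (hn : n + 1 ≤ L) :
    (∀ y : FL ω L, walkP d ω n 0 y.1 = GG (pF (FL ω L)) (ff (pF (FL ω L)) o 0) n y) ∧
    (∀ y, y ∉ FL ω L → walkP d ω n 0 y = 0) := by
  classical
  induction n with
  | zero =>
    constructor
    · intro y
      simp only [walkP, GG, ff, Subtype.ext_iff, ho]
    · intro y hy
      simp only [walkP]
      rw [if_neg]
      rintro rfl
      exact hy (ho ▸ o.2)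
  | succ n ih =>
    obtain ⟨ih1, ih2⟩ := ih (by omega)
    have hp := pF_symSt hd (FL ω L)
    have key : ∀ y, walkP d ω (n+1) 0 y =
        ∑ z : FL ω L, GG (pF (FL ω L)) (ff (pF (FL ω L)) o 0) n z * stepP d ω z.1 y := by
      intro y
      simp only [walkP]
      rw [tsum_eq_sum (s := FL ω L) (fun z hz => by rw [ih2 z hz, zero_mul]), ← Finset.sum_coe_sort]
      exact Finset.sum_congr rfl fun z _ => by rw [ih1 z]
    have hsupp : ∀ z, GG (pF (FL ω L)) (ff (pF (FL ω L)) o 0) n z ≠ 0 → distInf 0 z.1 + 1 ≤ L := by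
      intro z hz
      have := GG_supp _ o n z hz
      rw [ho] at this; omega
    constructor
    · intro y
      rw [key]
      change _ = ∑ z, pF _ y z * GG (pF (FL ω L)) (ff (pF (FL ω L)) o 0) n z
      refine Finset.sum_congr rfl fun z _ => ?_
      by_cases hz : GG (pF (FL ω L)) (ff (pF (FL ω L)) o 0) n z = 0
      · rw [hz]; simp
      · rw [stepP_in ω L z y (hsupp z hz), hp.symm z y, mul_comm]
    · intro y hy
      rw [key]
      refine Finset.sum_eq_zero fun z _ => ?_
      by_cases hz : GG (pF (FL ω L)) (ff (pF (FL ω L)) o 0) n z = 0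
      · rw [hz]; simp
      · rw [stepP_out ω L z y hy (hsupp z hz), mul_zero]

/-- Extension by zero. -/
noncomputable def ext0 (F : Finset (Pt d)) (φ : F → ℝ) (x : Pt d) : ℝ :=
  open scoped Classical in if h : x ∈ F then φ ⟨x, h⟩ else 0

theorem ext0_in (F : Finset (Pt d)) (φ : F → ℝ) (x : F) : ext0 F φ x.1 = φ x := by
  unfold ext0; rw [dif_pos x.2]

theorem ext0_out (F : Finset (Pt d)) (φ : F → ℝ) (x : Pt d) (h : x ∉ F) : ext0 F φ x = 0 := by
  unfold ext0; rw [dif_neg h]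

theorem ext0_sum (F : Finset (Pt d)) (φ : F → ℝ) (B : Finset (Pt d)) (g : ℝ → ℝ) (hg : g 0 = 0)
    (hB : ∀ y : F, φ y ≠ 0 → y.1 ∈ B) : ∑ x ∈ B, g (ext0 F φ x) = ∑ y, g (φ y) := by
  classical
  have h1 : ∑ y, g (φ y) = ∑ x ∈ F, g (ext0 F φ x) := by
    rw [← Finset.sum_coe_sort F (fun x => g (ext0 F φ x))]
    exact Finset.sum_congr rfl fun y _ => by rw [ext0_in]
  have h2 : ∀ s : Finset (Pt d), (∀ y : F, φ y ≠ 0 → y.1 ∈ s) → s ⊆ F ∪ B →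
      ∑ x ∈ s, g (ext0 F φ x) = ∑ x ∈ F ∪ B, g (ext0 F φ x) := by
    intro s hs hsub
    refine Finset.sum_subset hsub fun x _ hx => ?_
    by_cases hxF : x ∈ F
    · by_cases h0 : φ ⟨x, hxF⟩ = 0
      · rw [ext0_in F φ ⟨x, hxF⟩, h0, hg]
      · exact absurd (hs ⟨x, hxF⟩ h0) hx
    · rw [ext0_out F φ x hxF, hg]
  rw [h1, h2 B hB Finset.subset_union_right, h2 F (fun y _ => y.2) Finset.subset_union_left]

theorem EE_en (hd : 2 ≤ d) (ω : Config d) (L : ℕ) (φ : FL ω L → ℝ) :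
    EE (Sinf ω) (boxAt 0 L) (ext0 _ φ) = 4 * d * en (pF (FL ω L)) φ := by
  classical
  have hd0 : (0:ℝ) < d := by positivity
  have h1 : EE (Sinf ω) (boxAt 0 L) (ext0 _ φ) = ∑ e ∈ FL ω L ×ˢ FL ω L,
      if adj e.1 e.2 then (ext0 _ φ e.1 - ext0 _ φ e.2)^2 else 0 := by
    unfold EE
    symm
    have hs : FL ω L ×ˢ FL ω L ⊆ boxAt 0 L ×ˢ boxAt 0 L := by
      unfold FL
      exact Finset.product_subset_product (Finset.filter_subset _ _) (Finset.filter_subset _ _)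
    rw [← Finset.sum_subset hs]
    · refine Finset.sum_congr rfl fun e he => ?_
      obtain ⟨ha, hb⟩ := Finset.mem_product.1 he
      have ha' := ((mem_FL _ _ _).1 ha).2
      have hb' := ((mem_FL _ _ _).1 hb).2
      simp only [stepRel, ha', hb', and_true]
    · intro e he hne
      obtain ⟨ha, hb⟩ := Finset.mem_product.1 he
      rw [if_neg]
      rintro ⟨-, h2, h3⟩
      exact hne (Finset.mem_product.2 ⟨(mem_FL _ _ _).2 ⟨(mem_boxAt _ _ _).1 ha, h2⟩,
        (mem_FL _ _ _).2 ⟨(mem_boxAt _ _ _).1 hb, h3⟩⟩)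
  rw [h1, Finset.sum_product, ← Finset.sum_coe_sort]
  unfold en
  rw [← mul_assoc, Finset.mul_sum]
  refine Finset.sum_congr rfl fun x _ => ?_
  rw [← Finset.sum_coe_sort, Finset.mul_sum]
  refine Finset.sum_congr rfl fun y _ => ?_
  simp only [ext0_in]
  by_cases h : adj x.1 y.1
  · rw [if_pos h, pF_adj _ h]; field_simp; norm_num
  · rw [if_neg h]
    by_cases hxy : y = x
    · subst hxy; simp
    · simp [pF, h, hxy]
end Asm

section Fin
variable {d : ℕ}

theorem LS_F (hd : 2 ≤ d) (ω : Config d) (Γ : ℝ) (hΓ : 0 < Γ)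
    (hLS : ∀ ρ : ℕ, 1 ≤ ρ → ∀ φ : Pt d → ℝ, (∀ x, 0 ≤ φ x) →
      (∀ x, φ x ≠ 0 → x ∈ Sinf ω ∧ distInf 0 x ≤ ρ) → ∑ x ∈ boxAt (0 : Pt d) ρ, φ x ≤ 1 →
      ∀ δ : ℝ, 0 < δ → ∀ W : Finset (Pt d), (∀ u v, adj u v → φ u ≠ 0 → u ∈ W ∧ v ∈ W) →
      ∑ x ∈ boxAt (0 : Pt d) ρ, φ x^2 ≤ δ * Γ * ρ * EE (Sinf ω) W φ + (1/δ)^d)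
    (L : ℕ) (z : FL ω L) (ρ : ℝ) (hρ : 1 ≤ ρ) (hρL : ρ + distInf 0 z.1 ≤ L) (φ : FL ω L → ℝ)
    (h0 : ∀ x, 0 ≤ φ x) (h1 : ∑ x, φ x ≤ 1)
    (h2 : ∀ y, ρ ≤ (distInf z.1 y.1 : ℝ) + 2 → φ y = 0) (δ : ℝ) (hδ : 0 < δ) :
    ∑ x, φ x ^ 2 ≤ δ * (8 * d * Γ) * (ρ + distInf 0 z.1) * en (pF (FL ω L)) φ + (1/δ)^d := by
  have hs : ∀ y : FL ω L, φ y ≠ 0 → (distInf 0 y.1 : ℝ) + 2 < ρ + distInf 0 z.1 := by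
    intro y hy
    have : ¬ (ρ ≤ (distInf z.1 y.1 : ℝ) + 2) := fun h => hy (h2 y h)
    push Not at this
    have t : (distInf 0 y.1 : ℝ) ≤ distInf 0 z.1 + distInf z.1 y.1 := by
      exact_mod_cast distInf_tri 0 z.1 y.1
    linarith
  set R : ℕ := ⌈ρ⌉₊ + distInf 0 z.1 with hR
  have hRle : (R:ℝ) ≤ 2 * (ρ + distInf 0 z.1) := by
    have := Nat.ceil_lt_add_one (show 0 ≤ ρ by linarith)
    have h3 : (0:ℝ) ≤ distInf 0 z.1 := by positivity
    rw [hR]; push_cast; linarith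
  have hRge : ρ + distInf 0 z.1 ≤ R := by
    have := Nat.le_ceil ρ
    rw [hR]; push_cast; linarith
  have hR1 : 1 ≤ R := by
    have h3 : (0:ℝ) ≤ distInf 0 z.1 := by positivity
    have : (1:ℝ) ≤ R := by linarith
    exact_mod_cast this
  have hsB : ∀ y : FL ω L, φ y ≠ 0 → y.1 ∈ boxAt 0 R := by
    intro y hy
    rw [mem_boxAt]
    have := hs y hy
    have h3 : (distInf 0 y.1 : ℝ) ≤ R := by linarith
    exact_mod_cast h3
  have hne : ∀ x, ext0 _ φ x ≠ 0 → ∃ y : FL ω L, y.1 = x ∧ φ y ≠ 0 := by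
    intro x hx
    by_cases hxF : x ∈ FL ω L
    · exact ⟨⟨x, hxF⟩, rfl, by rwa [ext0_in _ φ ⟨x, hxF⟩] at hx⟩
    · exact absurd (ext0_out _ φ x hxF) hx
  have main := hLS R hR1 (ext0 _ φ) ?_ ?_ ?_ δ hδ (boxAt 0 L) ?_
  · rw [ext0_sum _ φ _ (fun t => t^2) (by norm_num) hsB, EE_en hd] at main
    refine main.trans ?_
    have hen : 0 ≤ en (pF (FL ω L)) φ := by
      unfold en
      refine mul_nonneg (by norm_num) (Finset.sum_nonneg fun x _ => Finset.sum_nonneg fun y _ =>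
        mul_nonneg ((pF_symSt hd _).nonneg _ _) (sq_nonneg _))
    gcongr ?_ + _
    calc δ * Γ * R * (4 * d * en (pF (FL ω L)) φ)
        ≤ δ * Γ * (2 * (ρ + distInf 0 z.1)) * (4 * d * en (pF (FL ω L)) φ) := by gcongr
      _ = _ := by ring
  · intro x
    by_cases hxF : x ∈ FL ω L
    · rw [ext0_in _ φ ⟨x, hxF⟩]; exact h0 _
    · rw [ext0_out _ φ x hxF]
  · intro x hx
    obtain ⟨y, rfl, hy⟩ := hne x hx
    exact ⟨((mem_FL _ _ _).1 y.2).2, (mem_boxAt _ _ _).1 (hsB y hy)⟩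
  · rw [ext0_sum _ φ _ (fun t => t) rfl hsB]; exact h1
  · intro u v huv hu
    obtain ⟨y, rfl, hy⟩ := hne u hu
    refine ⟨(mem_boxAt _ _ _).2 ((mem_FL _ _ _).1 y.2).1, (mem_boxAt _ _ _).2 ?_⟩
    have h3 := hs y hy
    have h4 := distInf_tri 0 y.1 v
    have h5 := adj_distInf huv
    have h6 : (distInf 0 v : ℝ) ≤ distInf 0 y.1 + 1 := by exact_mod_cast (by omega)
    have h7 : (distInf 0 v : ℝ) ≤ L := by linarith
    exact_mod_cast h7

theorem bound_k {V : Type} [Fintype V] (p : V → V → ℝ) (hp : SymSt p) (o : V) (y : V) :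
    GG p (ff p o 0) 0 y ≤ 1 := by
  classical
  simp only [GG, ff]
  split_ifs <;> norm_num

theorem heat_det (hd : 2 ≤ d) (ω : Config d) (h0 : (0:Pt d) ∈ Sinf ω) (Γ : ℝ) (hΓ : 0 < Γ)
    (hLS : ∀ ρ : ℕ, 1 ≤ ρ → ∀ φ : Pt d → ℝ, (∀ x, 0 ≤ φ x) →
      (∀ x, φ x ≠ 0 → x ∈ Sinf ω ∧ distInf 0 x ≤ ρ) → ∑ x ∈ boxAt (0 : Pt d) ρ, φ x ≤ 1 →
      ∀ δ : ℝ, 0 < δ → ∀ W : Finset (Pt d), (∀ u v, adj u v → φ u ≠ 0 → u ∈ W ∧ v ∈ W) →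
      ∑ x ∈ boxAt (0 : Pt d) ρ, φ x^2 ≤ δ * Γ * ρ * EE (Sinf ω) W φ + (1/δ)^d) :
    ∃ K : ℝ, ∀ n : ℕ, 1 ≤ n → ∀ x : Pt d,
          walkP d ω n (0 : Pt d) x ≤ K * (n : ℝ) ^ (-(d : ℝ)/2) := by
  have hd0 : (0:ℝ) < d := by positivity
  obtain ⟨A, K, hA, hK, hoff⟩ := offdiag d (α := 1/(4*(d:ℝ)^2)) (Γ := 8*d*Γ) (by positivity)
    (by positivity)
  refine ⟨K * 8^((d:ℝ)/2), fun n hn x => ?_⟩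
  have hn0 : (0:ℝ) < n := by exact_mod_cast hn
  have hform : K * 8^((d:ℝ)/2) * (n:ℝ)^(-(d:ℝ)/2) = K * (8/(n:ℝ))^((d:ℝ)/2) := by
    rw [Real.div_rpow (by norm_num) hn0.le, neg_div, Real.rpow_neg hn0.le]
    ring
  rw [hform]
  have hpos : 0 ≤ K * (8/(n:ℝ))^((d:ℝ)/2) := by positivity
  set k := n / 4 with hk
  obtain ⟨c, hc⟩ := exists_nat_ge (2 * A * √(k:ℝ))
  set L := n + 1 + c with hL
  have ho : (0:Pt d) ∈ FL ω L := (mem_FL _ _ _).2 ⟨by rw [distInf_self]; omega, h0⟩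
  set o : FL ω L := ⟨0, ho⟩ with hodef
  have hp := pF_symSt hd (FL ω L)
  obtain ⟨w1, w2⟩ := walk_eq hd ω L o rfl n (by omega)
  by_cases hx : x ∈ FL ω L
  swap
  · rw [w2 x hx]; exact hpos
  rw [w1 ⟨x, hx⟩]
  have hle : ∀ y, GG (pF (FL ω L)) (ff (pF (FL ω L)) o 0) (4*k) y ≤ K * (8/(n:ℝ))^((d:ℝ)/2) := by
    rcases Nat.eq_zero_or_pos k with hk0 | hkpos
    · intro y
      rw [hk0]
      refine (bound_k _ hp o y).trans ?_
      have hn4 : n < 4 := by omega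
      have : (1:ℝ) ≤ 8 / n := by
        rw [le_div_iff₀ hn0, one_mul]
        have : (n:ℝ) < 4 := by exact_mod_cast hn4
        linarith
      have := Real.one_le_rpow this (show 0 ≤ (d:ℝ)/2 by positivity)
      nlinarith
    · intro y
      by_cases hy0 : GG (pF (FL ω L)) (ff (pF (FL ω L)) o 0) (4*k) y = 0
      · rw [hy0]; exact hpos
      have hyd : distInf 0 y.1 ≤ 4*k := GG_supp _ o (4*k) y hy0
      have hyn : distInf 0 y.1 ≤ n := by omega
      rw [GG_4k hp]
      have hk' : (0:ℝ) < k := by exact_mod_cast hkpos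
      have h := hoff (pF (FL ω L)) hp (fun a b => (distInf a.1 b.1 : ℝ)) o y (2 * A * √(k:ℝ))
        (fun _ _ => by positivity) (fun z => by simp [distInf_self])
        (fun z => by
          have := distInf_tri o.1 z.1 y.1
          rw [distInf_comm z.1 y.1] at this
          exact_mod_cast this)
        (fun z a b hab => pF_lip _ z a b hab) (pF_qq hd _) (by
          intro z hz ρ hρ hρL φ h0 h1 h2 δ hδ
          refine LS_F hd ω Γ hΓ hLS L z ρ hρ ?_ φ h0 h1 h2 δ hδ
          have hzn : distInf 0 z.1 ≤ n := by
            rcases hz with rfl | rfl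
            · rw [hodef, distInf_self]; omega
            · exact hyn
          have hzn' : (distInf 0 z.1 : ℝ) ≤ n := by exact_mod_cast hzn
          have hLr : (L:ℝ) = n + 1 + c := by rw [hL]; push_cast; ring
          linarith)
        k hkpos le_rfl
      have hsq : 0 < √(k:ℝ)^d := pow_pos (Real.sqrt_pos.2 hk') d
      rw [← le_div_iff₀ hsq] at h
      refine h.trans ?_
      rw [div_eq_mul_inv]
      gcongr
      have e1 : √(k:ℝ)^d = (k:ℝ)^((d:ℝ)/2) := by
        rw [Real.sqrt_eq_rpow, ← Real.rpow_natCast, ← Real.rpow_mul hk'.le]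
        congr 1; ring
      rw [e1, ← Real.inv_rpow hk'.le]
      refine Real.rpow_le_rpow (by positivity) ?_ (by positivity)
      rw [inv_eq_one_div, div_le_div_iff₀ hk' hn0]
      have : n ≤ 8 * k := by omega
      have : (n:ℝ) ≤ 8 * k := by exact_mod_cast this
      linarith
  have hfin := GG_le hp (ff (pF (FL ω L)) o 0) (4*k) (n - 4*k) _ hle ⟨x, hx⟩
  rwa [show 4*k + (n - 4*k) = n by omega] at hfin
end Fin

/-- Under P1–P3 and S1–S2, for each `u ∈ (a,b)` and
`P^u[·|0 ∈ S_∞]`-almost every `ω` there is `K(ω) < ∞` such that the lazy simple random walk on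
`S` started at `0` satisfies `P_{ω,0}[X_n = x] ≤ K·n^{−d/2}` for all `n ≥ 1` and `x ∈ ℤ^d`. -/
theorem stmt12 (d : ℕ) (hd : 2 ≤ d) (a b : ℝ) (ha : 0 ≤ a) (hab : a < b)
    (P : ℝ → Measure (Config d)) (Ax : Axioms d a b P) :
    ∀ u ∈ Set.Ioo a b,
      ∀ᵐ ω ∂(ProbabilityTheory.cond (P u) {ω | (0 : Pt d) ∈ Sinf ω}),
        ∃ K : ℝ, ∀ n : ℕ, 1 ≤ n → ∀ x : Pt d,
          walkP d ω n (0 : Pt d) x ≤ K * (n : ℝ) ^ (-(d : ℝ)/2) := by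
  intro u hu
  have h1 := ProbabilityTheory.cond_absolutelyContinuous (μ := P u) (s := {ω | (0 : Pt d) ∈ Sinf ω})
    |>.ae_le (ae_good a b P Ax u hu (3*d*d))
  have h2 := ProbabilityTheory.ae_cond_mem (μ := P u) (meas_Sinf (0:Pt d))
  filter_upwards [h1, h2] with ω ⟨C, hC, hW⟩ h0
  obtain ⟨π, r, M, a1, a2, a3, a4, a5⟩ := det_good ω (3*d*d) C hC hW
  obtain ⟨Γ, hΓ, hLS⟩ := LSdet hd (Sinf ω) π r M a1 a2 a3 a4 a5
  exact heat_det hd ω h0 Γ hΓ hLS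

end Perco
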